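/- Let d ≥ 3 and let B be a collision kernel satisfying the standing assumptions (1.1) and the Lipschitz assumption (1.2). Fix ε ∈ (0,1] and τ, T ∈ (0,∞) with τ ≤ T. There is a constant C < ∞, depending only on B, d, ε, τ and T, with the following property: for any N ∈ ℕ and any Kac process (μ_t^N)_{t≥0} in 𝒮_N with collision kernel B, if (μ_t)_{t≥τ} denotes the unique locally bounded measure solution of the spatially homogeneous Boltzmann equation with collision kernel B starting from μ_τ^N at time τ, then with probability exceeding 1 − ε one has W(μ_t^N, μ_t) ≤ C N^{−1/d} for all t ∈ [τ, T]. The same holds for d = 2 with N^{−1/d} replaced by N^{−1/2} log N. -/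

import Mathlib

open MeasureTheory ProbabilityTheory Filter
open scoped ENNReal NNReal RealInnerProductSpace

noncomputable section

abbrev Vd (d : ℕ) := EuclideanSpace ℝ (Fin d)

namespace KacModel

variable {d : ℕ}

/-- Post-collision velocity `v' = (v+v*)/2 + |v-v*|σ/2`. -/
def postV (v vs σ : Vd d) : Vd d := (2:ℝ)⁻¹ • (v + vs) + ((2:ℝ)⁻¹ * ‖v - vs‖) • σ

/-- Post-collision velocity `v'_* = (v+v*)/2 - |v-v*|σ/2`. -/
def postVs (v vs σ : Vd d) : Vd d := (2:ℝ)⁻¹ • (v + vs) - ((2:ℝ)⁻¹ * ‖v - vs‖) • σ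

/-- The unit sphere `S^{d-1}` regarded as a subset of `ℝ^d`. -/
def unitSphere (d : ℕ) : Set (Vd d) := {σ | ‖σ‖ = 1}

/-- Standing assumptions (1.1) on a collision kernel, regarded as a family of
measures on `ℝ^d` carried by the unit sphere. -/
structure IsCollisionKernel (B : Vd d → Measure (Vd d)) : Prop where
  measurable : ∀ s : Set (Vd d), MeasurableSet s → Measurable fun v => B v s
  prob : ∀ u : Vd d, ‖u‖ = 1 → IsProbabilityMeasure (B u)
  support : ∀ u : Vd d, ‖u‖ = 1 → B u ((unitSphere d \ {u, -u})ᶜ) = 0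
  scaling : ∀ (c : ℝ), 0 ≤ c → ∀ u : Vd d, ‖u‖ = 1 →
    B (c • u) = ENNReal.ofReal c • B u
  symm : ∀ (R : Vd d ≃ₗᵢ[ℝ] Vd d) (u : Vd d), ‖u‖ = 1 → B (R u) = (B u).map R

/-- Total variation distance between two finite measures (dual formulation). -/
def tvDist {E : Type*} [MeasurableSpace E] (μ ν : Measure E) : ℝ :=
  ⨆ f : {f : E → ℝ // Measurable f ∧ ∀ x, |f x| ≤ 1},
    ((∫ x, f.1 x ∂μ) - ∫ x, f.1 x ∂ν)

/-- The Lipschitz assumption (1.2). -/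
def IsLipschitzKernel (B : Vd d → Measure (Vd d)) (κ : ℝ) : Prop :=
  1 ≤ κ ∧ ∀ v v' : Vd d, tvDist (B v) (B v') ≤ κ * ‖v - v'‖

/-- The Boltzmann sphere 𝒮. -/
def boltzmannSphere (d : ℕ) : Set (Measure (Vd d)) :=
  {μ | IsProbabilityMeasure μ ∧ (∫ v, v ∂μ) = 0 ∧ (∫ v, ‖v‖ ^ 2 ∂μ) = 1}

/-- 𝒮_N : normalized empirical measures in the Boltzmann sphere. -/
def empiricalSphere (d N : ℕ) : Set (Measure (Vd d)) :=
  {μ | μ ∈ boltzmannSphere d ∧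
    ∃ x : Fin N → Vd d, μ = (N : ℝ≥0∞)⁻¹ • ∑ i, Measure.dirac (x i)}

/-- The class ℱ of test functions. -/
def testF (d : ℕ) : Set (Vd d → ℝ) :=
  {f | (∀ v, |f v / (1 + ‖v‖ ^ 2)| ≤ 1) ∧
    ∀ v v', |f v / (1 + ‖v‖ ^ 2) - f v' / (1 + ‖v'‖ ^ 2)| ≤ ‖v - v'‖}

/-- The weighted Wasserstein distance W. -/
def Wdist (μ ν : Measure (Vd d)) : ℝ :=
  ⨆ f : testF d, ((∫ v, (f : Vd d → ℝ) v ∂μ) - ∫ v, (f : Vd d → ℝ) v ∂ν)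

/-- The p-th moment `∫ |v|^p dμ`, as a lower integral. -/
def momentL (p : ℝ) (μ : Measure (Vd d)) : ℝ≥0∞ :=
  ∫⁻ v, (‖v‖₊ : ℝ≥0∞) ^ p ∂μ

/-- Total variation measure |μ - ν| of the difference of two finite measures. -/
def tvMeasure {E : Type*} [MeasurableSpace E] (μ ν : Measure E) : Measure E :=
  (μ - ν) + (ν - μ)

/-- The post-collision update `μ^{v,v_*,σ}` of an empirical measure. -/
def collUpdate (N : ℕ) (μ : Measure (Vd d)) (v vs σ : Vd d) : Measure (Vd d) :=
  μ + (N : ℝ≥0∞)⁻¹ • (Measure.dirac (postV v vs σ) + Measure.dirac (postVs v vs σ))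
    - (N : ℝ≥0∞)⁻¹ • (Measure.dirac v + Measure.dirac vs)

/-- The generator 𝒢 of the Kac process. -/
def kacGen (B : Vd d → Measure (Vd d)) (N : ℕ) (F : Measure (Vd d) → ℝ)
    (μ : Measure (Vd d)) : ℝ :=
  N * ∫ v, (∫ vs, (∫ σ, (F (collUpdate N μ v vs σ) - F μ) ∂(B (v - vs))) ∂μ) ∂μ

/-- A Kac process with collision kernel `B` and particle number `N`:
a càdlàg adapted 𝒮_N-valued process solving the martingale problem for 𝒢. -/
structure IsKacProcess {Ω : Type*} [m : MeasurableSpace Ω]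
    (B : Vd d → Measure (Vd d)) (N : ℕ) (P : Measure Ω)
    (𝓕 : Filtration ℝ m) (μp : ℝ → Ω → Measure (Vd d)) : Prop where
  mem : ∀ t ω, μp t ω ∈ empiricalSphere d N
  adapted : ∀ f ∈ testF d, Adapted 𝓕 fun t ω => ∫ v, f v ∂(μp t ω)
  rightCont : ∀ ω, ∀ f ∈ testF d, ∀ t : ℝ,
    ContinuousWithinAt (fun s => ∫ v, f v ∂(μp s ω)) (Set.Ici t) t
  leftLim : ∀ ω, ∀ f ∈ testF d, ∀ t : ℝ, 0 < t →
    ∃ L : ℝ, Tendsto (fun s => ∫ v, f v ∂(μp s ω)) (nhdsWithin t (Set.Iio t)) (nhds L)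
  martingale : ∀ G : Measure (Vd d) → ℝ, Measurable G → (∃ M : ℝ, ∀ ν, |G ν| ≤ M) →
    Martingale (fun t ω => G (μp t ω) - ∫ s in Set.Ioc (0:ℝ) t, kacGen B N G (μp s ω)) 𝓕 P

/-- `⟨f, Q(μ,ν)⟩`, the Boltzmann collision integral. -/
def QInt (B : Vd d → Measure (Vd d)) (f : Vd d → ℝ) (μ ν : Measure (Vd d)) : ℝ :=
  ∫ v, (∫ vs, (∫ σ, (f (postV v vs σ) + f (postVs v vs σ) - f v - f vs) ∂(B (v - vs))) ∂ν) ∂μ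

/-- Measure solution of the spatially homogeneous Boltzmann equation, started at time τ. -/
def IsBoltzmannSolutionFrom (B : Vd d → Measure (Vd d)) (τ : ℝ)
    (μt : ℝ → Measure (Vd d)) : Prop :=
  (∀ t, τ ≤ t → μt t ∈ boltzmannSphere d) ∧
  ∀ f : Vd d → ℝ, Measurable f → (∃ M, ∀ v, |f v| ≤ M) → HasCompactSupport f →
    ∀ t, τ ≤ t →
      (∫ v, f v ∂(μt t)) = (∫ v, f v ∂(μt τ)) + ∫ s in Set.Ioc τ t, QInt B f (μt s) (μt s)

/-- Measure solution of the spatially homogeneous Boltzmann equation (start time 0). -/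
def IsBoltzmannSolution (B : Vd d → Measure (Vd d)) (μt : ℝ → Measure (Vd d)) : Prop :=
  IsBoltzmannSolutionFrom B 0 μt

/-- Local boundedness in 𝒮(p) from time τ on. -/
def LocBddMomentFrom (p τ : ℝ) (μt : ℝ → Measure (Vd d)) : Prop :=
  ∀ T, τ ≤ T → ∃ M : ℝ≥0∞, M ≠ ⊤ ∧ ∀ t ∈ Set.Icc τ T, momentL p (μt t) ≤ M

/-- Sample mean. -/
def sampleMean {Ω : Type*} {N : ℕ} (Vs : Fin N → Ω → Vd d) (ω : Ω) : Vd d :=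
  (N : ℝ)⁻¹ • ∑ i, Vs i ω

/-- Sample mean square. -/
def sampleQ {Ω : Type*} {N : ℕ} (Vs : Fin N → Ω → Vd d) (ω : Ω) : ℝ :=
  (N : ℝ)⁻¹ * ∑ i, ‖Vs i ω‖ ^ 2

/-- Sample variance. -/
def sampleS {Ω : Type*} {N : ℕ} (Vs : Fin N → Ω → Vd d) (ω : Ω) : ℝ :=
  sampleQ Vs ω - ‖sampleMean Vs ω‖ ^ 2

/-- The rescaled empirical distribution μ̃^N. -/
def rescaledEmpirical {Ω : Type*} {N : ℕ} (Vs : Fin N → Ω → Vd d)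
    (μdef : Measure (Vd d)) (ω : Ω) : Measure (Vd d) :=
  if 0 < sampleS Vs ω then
    (N : ℝ≥0∞)⁻¹ • ∑ i, Measure.dirac
      ((Real.sqrt (sampleS Vs ω))⁻¹ • (Vs i ω - sampleMean Vs ω))
  else μdef

/-- The N-sample empirical distribution. -/
def empMeasure {Ω : Type*} {N : ℕ} (Vs : Fin N → Ω → Vd d) (ω : Ω) : Measure (Vd d) :=
  (N : ℝ≥0∞)⁻¹ • ∑ i, Measure.dirac (Vs i ω)

end KacModel

open KacModel

namespace KacModel

open Real (exp)
open Set (Ioc Icc Ici)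
/-- functions -/
abbrev Vf (d : ℕ) := Vd d → ℝ
/-- measures -/
abbrev Mv (d : ℕ) := Measure (Vd d)
lemma mll {a b c : ℝ} (h : b ≤ c) (h0 : 0 ≤ a) : a * b ≤ a * c := mul_le_mul_of_nonneg_left h h0
lemma mlr {a b c : ℝ} (h : b ≤ c) (h0 : 0 ≤ a) : b * a ≤ c * a := mul_le_mul_of_nonneg_right h h0
lemma pll {a b : ℝ} (h0 : 0 ≤ a) (h : a ≤ b) (n : ℕ) : a ^ n ≤ b ^ n := pow_le_pow_left₀ h0 h n

variable {d : ℕ} {k : ℕ} {C : ℝ} {f : Vf d}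

/-- weight -/
def pw (v : Vd d) : ℝ := 1 + ‖v‖

lemma pw_one_le (v : Vd d) : 1 ≤ pw v := by unfold pw; linarith [norm_nonneg v]
lemma pw_pos (v : Vd d) : 0 < pw v := lt_of_lt_of_le one_pos (pw_one_le v)
lemma norm_le_pw (v : Vd d) : ‖v‖ ≤ pw v := by unfold pw; linarith
lemma pw_meas : Measurable (pw : Vf d) := by unfold pw; fun_prop
lemma pw_pow_one_le (v : Vd d) (k : ℕ) : 1 ≤ pw v ^ k := one_le_pow₀ (pw_one_le v)
lemma pw_pow_mono (v : Vd d) {k l : ℕ} (h : k ≤ l) : pw v ^ k ≤ pw v ^ l :=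
  pow_le_pow_right₀ (pw_one_le v) h

lemma norm_sub_le_pw (v w : Vd d) : ‖v - w‖ ≤ pw v * pw w := by
  have := norm_sub_le v w
  unfold pw
  nlinarith [norm_nonneg v, norm_nonneg w, mul_nonneg (norm_nonneg v) (norm_nonneg w)]

lemma post_sq (v w σ : Vd d) (h : ‖σ‖ = 1) :
    ‖postV v w σ‖ ^ 2 + ‖postVs v w σ‖ ^ 2 = ‖v‖ ^ 2 + ‖w‖ ^ 2 := by
  have h1 := parallelogram_law_with_norm ℝ ((2:ℝ)⁻¹ • (v + w)) (((2:ℝ)⁻¹ * ‖v - w‖) • σ)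
  have h2 := parallelogram_law_with_norm ℝ v w
  rw [norm_smul, norm_smul, h, Real.norm_of_nonneg (by positivity), Real.norm_of_nonneg (by positivity)] at h1
  unfold postV postVs
  nlinarith

lemma norm_post_le (v w σ : Vd d) (h : ‖σ‖ = 1) :
    ‖postV v w σ‖ ≤ ‖v‖ + ‖w‖ ∧ ‖postVs v w σ‖ ≤ ‖v‖ + ‖w‖ := by
  have := post_sq v w σ h
  constructor <;> apply le_of_sq_le_sq _ (by positivity) <;>
  nlinarith [norm_nonneg v, norm_nonneg w, mul_nonneg (norm_nonneg v) (norm_nonneg w), sq_nonneg ‖postV v w σ‖, sq_nonneg ‖postVs v w σ‖]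

lemma pw_post_le (v w σ : Vd d) (h : ‖σ‖ = 1) :
    pw (postV v w σ) ≤ pw v * pw w ∧ pw (postVs v w σ) ≤ pw v * pw w := by
  have := norm_post_le v w σ h
  unfold pw
  constructor <;> nlinarith [mul_nonneg (norm_nonneg v) (norm_nonneg w), this.1, this.2]

lemma post_lip (v w x σ : Vd d) (h : ‖σ‖ = 1) :
    ‖postV v x σ - postV w x σ‖ ≤ ‖v - w‖ ∧ ‖postVs v x σ - postVs w x σ‖ ≤ ‖v - w‖ := by
  have e1 : postV v x σ - postV w x σ = (2:ℝ)⁻¹ • (v - w) + ((2:ℝ)⁻¹ * (‖v - x‖ - ‖w - x‖)) • σ := by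
    unfold postV; module
  have e2 : postVs v x σ - postVs w x σ = (2:ℝ)⁻¹ • (v - w) - ((2:ℝ)⁻¹ * (‖v - x‖ - ‖w - x‖)) • σ := by
    unfold postVs; module
  have h3 : |‖v - x‖ - ‖w - x‖| ≤ ‖v - w‖ := by
    have := abs_norm_sub_norm_le (v - x) (w - x); simpa using this
  have a1 : ‖(2:ℝ)⁻¹ • (v - w)‖ = 2⁻¹ * ‖v - w‖ := by rw [norm_smul]; norm_num
  have a2 : ‖((2:ℝ)⁻¹ * (‖v - x‖ - ‖w - x‖)) • σ‖ = 2⁻¹ * |‖v - x‖ - ‖w - x‖| := by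
    rw [norm_smul, h, norm_mul]; norm_num
  constructor
  · rw [e1]; refine (norm_add_le _ _).trans ?_; rw [a1, a2]; linarith
  · rw [e2]; refine (norm_sub_le _ _).trans ?_; rw [a1, a2]; linarith

lemma postV_meas : Measurable (fun z : (Vd d × Vd d) × Vd d => postV z.1.1 z.1.2 z.2) := by
  unfold postV; fun_prop
lemma postVs_meas : Measurable (fun z : (Vd d × Vd d) × Vd d => postVs z.1.1 z.1.2 z.2) := by
  unfold postVs; fun_prop

section kernel
variable {B : Vd d → Mv d} (hB : IsCollisionKernel B)
include hB

lemma B_eq (v : Vd d) (hv : v ≠ 0) :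
    ‖(‖v‖⁻¹ • v)‖ = 1 ∧ B v = ENNReal.ofReal ‖v‖ • B (‖v‖⁻¹ • v) := by
  have h1 : ‖(‖v‖⁻¹ • v)‖ = 1 := norm_smul_inv_norm (𝕜 := ℝ) hv
  refine ⟨h1, ?_⟩
  rw [← hB.scaling _ (norm_nonneg v) _ h1, smul_smul, mul_inv_cancel₀ (norm_ne_zero_iff.2 hv), one_smul]

lemma B_zero (hd : 0 < d) : B 0 = 0 := by
  have := hB.scaling 0 le_rfl (EuclideanSpace.single ⟨0, hd⟩ 1) (by simp)
  simpa using this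

lemma B_univ (hd : 0 < d) (v : Vd d) : B v Set.univ = ENNReal.ofReal ‖v‖ := by
  by_cases hv : v = 0
  · simp [hv, B_zero hB hd]
  · obtain ⟨h1, h2⟩ := B_eq hB v hv
    have := hB.prob _ h1
    rw [h2]; simp

lemma B_fin (hd : 0 < d) (v : Vd d) : IsFiniteMeasure (B v) :=
  ⟨by rw [B_univ hB hd]; exact ENNReal.ofReal_lt_top⟩

lemma B_real (hd : 0 < d) (v : Vd d) : (B v).real Set.univ = ‖v‖ := by
  rw [Measure.real, B_univ hB hd, ENNReal.toReal_ofReal (norm_nonneg v)]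

lemma B_sphere (hd : 0 < d) (v : Vd d) : ∀ᵐ σ ∂(B v), ‖σ‖ = 1 := by
  by_cases hv : v = 0
  · simp [hv, B_zero hB hd]
  · obtain ⟨h1, h2⟩ := B_eq hB v hv
    rw [h2]
    apply Measure.ae_smul_measure
    have := hB.support _ h1
    refine measure_mono_null ?_ this
    intro σ hσ
    simp only [Set.mem_compl_iff, Set.mem_ofPred_eq] at hσ
    simp only [Set.mem_compl_iff]
    exact fun h => hσ h.1

lemma B_neg (hd : 0 < d) (v : Vd d) : B (-v) = (B v).map (fun σ => -σ) := by
  by_cases hv : v = 0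
  · simp [hv, B_zero hB hd]
  · obtain ⟨h1, h2⟩ := B_eq hB v hv
    have h3 := hB.symm (LinearIsometryEquiv.neg ℝ) _ h1
    have e : -v = ‖v‖ • (-(‖v‖⁻¹ • v)) := by
      rw [smul_neg, smul_smul, mul_inv_cancel₀ (norm_ne_zero_iff.2 hv), one_smul]
    rw [e, hB.scaling _ (norm_nonneg v) _ (by rw [norm_neg, h1]), h2, Measure.map_smul]
    congr 1

lemma gamma_exists (hd : 0 < d) : ∃ γ : ℝ, 0 < γ ∧ γ ≤ 1 ∧ ∀ v : Vd d,
    ∫ σ, (‖v‖ ^ 2 - ⟪v, σ⟫ ^ 2) ∂(B v) = γ * ‖v‖ ^ 3 := by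
  set u0 : Vd d := EuclideanSpace.single ⟨0, hd⟩ 1 with hu0
  have hu : ‖u0‖ = 1 := by simp [hu0]
  have hp := hB.prob _ hu
  have hle : ∀ᵐ σ ∂(B u0), 0 < 1 - ⟪u0, σ⟫ ^ 2 := by
    have h1 := hB.support _ hu
    rw [← mem_ae_iff] at h1
    filter_upwards [h1] with σ hσ
    have hs : ‖σ‖ = 1 := hσ.1
    have h2 : |⟪u0, σ⟫| ≤ 1 := by
      have := abs_real_inner_le_norm u0 σ; rwa [hu, hs, one_mul] at this
    have h3 : |⟪u0, σ⟫| ≠ 1 := by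
      intro h
      have h4 := hσ.2
      simp only [Set.mem_insert_iff, Set.mem_singleton_iff, not_or] at h4
      rcases abs_eq (zero_le_one' ℝ) |>.1 h with h5 | h5
      · exact h4.1 ((inner_eq_one_iff_of_norm_eq_one (𝕜 := ℝ) hu hs).1 h5).symm
      · have : ⟪u0, -σ⟫ = 1 := by rw [inner_neg_right, h5]; norm_num
        have := (inner_eq_one_iff_of_norm_eq_one (𝕜 := ℝ) hu (by rw [norm_neg, hs])).1 this
        exact h4.2 (by rw [this, neg_neg])
    have h6 : |⟪u0, σ⟫| < 1 := lt_of_le_of_ne h2 h3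
    nlinarith [abs_nonneg ⟪u0, σ⟫, sq_abs ⟪u0, σ⟫]
  have hle1 : ∀ σ, 1 - ⟪u0, σ⟫ ^ 2 ≤ 1 := fun σ => by nlinarith [sq_nonneg ⟪u0, σ⟫]
  have hint : Integrable (fun σ => 1 - ⟪u0, σ⟫ ^ 2) (B u0) := by
    refine Integrable.of_bound (by fun_prop) 1 ?_
    filter_upwards [hle] with σ h
    rw [Real.norm_of_nonneg h.le]; exact hle1 σ
  refine ⟨∫ σ, (1 - ⟪u0, σ⟫ ^ 2) ∂(B u0), ?_, ?_, ?_⟩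
  · rw [integral_pos_iff_support_of_nonneg_ae (hle.mono fun _ h => h.le) hint]
    have : (B u0) (Function.support fun σ => 1 - ⟪u0, σ⟫ ^ 2) = 1 := by
      rw [← prob_compl_eq_zero_iff (measurableSet_support (by fun_prop))]
      exact mem_ae_iff.1 (hle.mono fun σ h => Function.mem_support.2 h.ne')
    rw [this]; exact one_pos
  · calc _ ≤ ∫ σ, (1:ℝ) ∂(B u0) := integral_mono hint (integrable_const _) hle1
      _ = 1 := by simp
  · intro v
    by_cases hv : v = 0
    · simp [hv, B_zero hB hd]
    obtain ⟨h1, h2⟩ := B_eq hB v hv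
    set u := ‖v‖⁻¹ • v with hudef
    have hvu : v = ‖v‖ • u := by
      rw [hudef, smul_smul, mul_inv_cancel₀ (norm_ne_zero_iff.2 hv), one_smul]
    have h3 := hB.symm (Submodule.reflection (ℝ ∙ (u0 - u))ᗮ) u0 hu
    rw [Submodule.reflection_sub (by rw [hu, h1])] at h3
    have h4 : ∫ σ, (‖v‖ ^ 2 - ⟪v, σ⟫ ^ 2) ∂(B u) = ‖v‖ ^ 2 * ∫ σ, (1 - ⟪u0, σ⟫ ^ 2) ∂(B u0) := by
      rw [h3, integral_map (by fun_prop) (by fun_prop), ← integral_const_mul]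
      congr 1; ext σ
      have : ⟪v, (Submodule.reflection (ℝ ∙ (u0 - u))ᗮ) σ⟫ = ‖v‖ * ⟪u0, σ⟫ := by
        conv_lhs => rw [hvu, real_inner_smul_left]
        have e : u = (Submodule.reflection (ℝ ∙ (u0 - u))ᗮ) u0 :=
          (Submodule.reflection_sub (by rw [hu, h1])).symm
        conv_lhs => enter [2, 2]; rw [e]
        rw [LinearIsometryEquiv.inner_map_map]
      rw [this]; ring
    rw [h2, integral_smul_measure, h4, ENNReal.toReal_ofReal (norm_nonneg v), smul_eq_mul]; ring

omit hB in
lemma tv_bound {E : Type*} [MeasurableSpace E] (μ ν : Measure E) [IsFiniteMeasure μ] [IsFiniteMeasure ν]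
    (f : E → ℝ) (hf : Measurable f) (h : ∀ x, |f x| ≤ 1) :
    (∫ x, f x ∂μ) - ∫ x, f x ∂ν ≤ tvDist μ ν := by
  unfold tvDist
  refine le_ciSup (f := fun f : {f : E → ℝ // Measurable f ∧ ∀ x, |f x| ≤ 1} =>
    ((∫ x, f.1 x ∂μ) - ∫ x, f.1 x ∂ν)) ?_ ⟨f, hf, h⟩
  refine ⟨μ.real Set.univ + ν.real Set.univ, ?_⟩
  rintro _ ⟨g, rfl⟩
  have h1 := norm_integral_le_of_norm_le_const (μ := μ) (f := g.1) (C := 1) (by simpa using ae_of_all _ g.2.2)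
  have h2 := norm_integral_le_of_norm_le_const (μ := ν) (f := g.1) (C := 1) (by simpa using ae_of_all _ g.2.2)
  rw [Real.norm_eq_abs, abs_le] at h1 h2
  show (∫ x, g.1 x ∂μ) - ∫ x, g.1 x ∂ν ≤ _
  linarith [h1.2, h2.1]

lemma B_lip (hd : 0 < d) {κ : ℝ} (hL : IsLipschitzKernel B κ) (v w : Vd d) (φ : Vd d → ℝ)
    (hφ : Measurable φ) (S : ℝ) (hS : 0 < S) (hb : ∀ σ, ‖σ‖ = 1 → |φ σ| ≤ S) :
    |(∫ σ, φ σ ∂(B v)) - ∫ σ, φ σ ∂(B w)| ≤ S * κ * ‖v - w‖ := by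
  have := B_fin hB hd v
  have := B_fin hB hd w
  set ψ : Vd d → ℝ := fun σ => if ‖σ‖ = 1 then S⁻¹ * φ σ else 0 with hψ
  have hψm : Measurable ψ :=
    Measurable.ite (measurableSet_eq_fun (by fun_prop) (by fun_prop)) (by fun_prop) (by fun_prop)
  have hψb : ∀ σ, |ψ σ| ≤ 1 := by
    intro σ
    simp only [hψ]
    split_ifs with h
    · rw [abs_mul, abs_of_pos (inv_pos.2 hS), inv_mul_le_iff₀ hS, mul_one]; exact hb σ h
    · simp
  have key : ∀ u, ∫ σ, φ σ ∂(B u) = S * ∫ σ, ψ σ ∂(B u) := by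
    intro u
    rw [← integral_const_mul]
    refine integral_congr_ae ?_
    filter_upwards [B_sphere hB hd u] with σ hσ
    simp only [hψ, hσ, if_true]; field_simp
  have h1 := (tv_bound (B v) (B w) ψ hψm hψb).trans (hL.2 v w)
  have h2 := (tv_bound (B w) (B v) ψ hψm hψb).trans (hL.2 w v)
  rw [norm_sub_rev] at h2
  rw [key, key, ← mul_sub, abs_mul, abs_of_pos hS, mul_assoc]
  gcongr
  rw [abs_le]; constructor <;> linarith

end kernel

/-- collision difference -/
def dl (f : Vf d) (v w σ : Vd d) : ℝ := f (postV v w σ) + f (postVs v w σ) - f v - f w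

/-- integrated collision difference -/
def qB (B : Vd d → Mv d) (f : Vf d) (v w : Vd d) : ℝ := ∫ σ, dl f v w σ ∂(B (v - w))

lemma QInt_eq (B : Vd d → Mv d) (f : Vf d) (μ ν : Mv d) :
    QInt B f μ ν = ∫ v, ∫ w, qB B f v w ∂ν ∂μ := rfl

/-- growth class -/
def Gr (k : ℕ) (C : ℝ) (f : Vf d) : Prop := Measurable f ∧ ∀ v, |f v| ≤ C * pw v ^ k

/-- moment bound -/
def Adm (μ : Mv d) (k : ℕ) (R : ℝ) : Prop :=
  IsProbabilityMeasure μ ∧ Integrable (fun v => pw v ^ k) μ ∧ ∫ v, pw v ^ k ∂μ ≤ R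

lemma Gr.nonneg (h : Gr k C f) : 0 ≤ C := by
  have := (abs_nonneg _).trans (h.2 0)
  simpa [pw] using this

lemma Gr.mono {k l : ℕ} {C D : ℝ} (h : Gr k C f) (hk : k ≤ l) (hC : C ≤ D) : Gr l D f :=
  ⟨h.1, fun v => (h.2 v).trans (mul_le_mul hC (pw_pow_mono v hk) (pow_nonneg (pw_pos v).le _)
    (h.nonneg.trans hC))⟩

lemma Gr.add {C D : ℝ} {f g : Vf d} (h : Gr k C f) (h' : Gr k D g) :
    Gr k (C + D) (fun v => f v + g v) :=
  ⟨h.1.add h'.1, fun v => (abs_add_le _ _).trans (by rw [add_mul]; exact add_le_add (h.2 v) (h'.2 v))⟩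

lemma Gr.smul (h : Gr k C f) (c : ℝ) :
    Gr k (|c| * C) (fun v => c * f v) :=
  ⟨h.1.const_mul c, fun v => by
    rw [abs_mul, mul_assoc]; exact mll (h.2 v) (abs_nonneg c)⟩

lemma Gr.sub {C D : ℝ} {f g : Vf d} (h : Gr k C f) (h' : Gr k D g) :
    Gr k (C + D) (fun v => f v - g v) :=
  ⟨h.1.sub h'.1, fun v => (abs_sub _ _).trans (by rw [add_mul]; exact add_le_add (h.2 v) (h'.2 v))⟩

lemma Adm.mono {μ : Mv d} {k l : ℕ} {R R' : ℝ} (h : Adm μ k R) (hl : l ≤ k) (hR : R ≤ R') :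
    Adm μ l R' := by
  obtain ⟨h1, h2, h3⟩ := h
  have : Integrable (fun v : Vd d => pw v ^ l) μ := by
    refine h2.mono' (pw_meas.pow_const l).aestronglyMeasurable (ae_of_all _ fun v => ?_)
    rw [Real.norm_of_nonneg (pow_nonneg (pw_pos v).le _)]; exact pw_pow_mono v hl
  exact ⟨h1, this, (integral_mono this h2 fun v => pw_pow_mono v hl).trans (h3.trans hR)⟩

lemma Adm.one_le {μ : Mv d} {R : ℝ} (h : Adm μ k R) : 1 ≤ R := by
  obtain ⟨h1, h2, h3⟩ := h
  refine le_trans ?_ h3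
  calc (1:ℝ) = ∫ _, (1:ℝ) ∂μ := by simp
    _ ≤ _ := integral_mono (integrable_const _) h2 fun v => pw_pow_one_le v k

lemma Gr.integrable {μ : Mv d} {R C : ℝ} (hf : Gr k C f) (h : Adm μ k R) :
    Integrable f μ :=
  (h.2.1.const_mul C).mono' hf.1.aestronglyMeasurable (ae_of_all _ hf.2)

lemma Gr.bound {μ : Mv d} {R C : ℝ} (hf : Gr k C f) (h : Adm μ k R) :
    |∫ v, f v ∂μ| ≤ C * R := by
  have := norm_integral_le_of_norm_le (f := f) (h.2.1.const_mul C) (ae_of_all _ hf.2)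
  rw [integral_const_mul] at this
  exact this.trans (mll h.2.2 hf.nonneg)

lemma dl_bound (hf : Gr k C f) (v w σ : Vd d) (h : ‖σ‖ = 1) :
    |dl f v w σ| ≤ 4 * C * (pw v ^ k * pw w ^ k) := by
  have hC := hf.nonneg
  have h1 : ∀ x, pw x ≤ pw v * pw w → |f x| ≤ C * (pw v ^ k * pw w ^ k) := fun x hx => by
    refine (hf.2 x).trans (mll ?_ hC)
    rw [← mul_pow]; exact pll (pw_pos x).le hx k
  have a1 := h1 _ (pw_post_le v w σ h).1
  have a2 := h1 _ (pw_post_le v w σ h).2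
  have a3 := h1 v (le_mul_of_one_le_right (pw_pos v).le (pw_one_le w))
  have a4 := h1 w (le_mul_of_one_le_left (pw_pos w).le (pw_one_le v))
  unfold dl
  rw [abs_le] at *
  constructor <;> linarith [a1.1, a1.2, a2.1, a2.2, a3.1, a3.2, a4.1, a4.2]

lemma dl_meas (hf : Measurable f) :
    Measurable (fun z : (Vd d × Vd d) × Vd d => dl f z.1.1 z.1.2 z.2) := by
  unfold dl
  exact (((hf.comp postV_meas).add (hf.comp postVs_meas)).sub (hf.comp (by fun_prop))).sub (hf.comp (by fun_prop))

lemma dl_meas1 (hf : Measurable f) (v w : Vd d) : Measurable (fun σ => dl f v w σ) :=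
  (dl_meas hf).comp (g := fun z : (Vd d × Vd d) × Vd d => dl f z.1.1 z.1.2 z.2) (f := fun σ => ((v, w), σ)) (by fun_prop)

/-- normalized kernel -/
def B1 (B : Vd d → Mv d) (hB : IsCollisionKernel B) : Kernel (Vd d) (Vd d) :=
  ⟨fun v => B (‖v‖⁻¹ • v), Measure.measurable_of_measurable_coe _ fun s hs =>
    (hB.measurable s hs).comp (by fun_prop)⟩

section
variable {B : Vd d → Mv d} (hB : IsCollisionKernel B) (hd : 0 < d)
include hB hd

lemma B1_fin : IsFiniteKernel (B1 B hB) := by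
  refine ⟨1, ENNReal.one_lt_top, fun v => ?_⟩
  change B (‖v‖⁻¹ • v) Set.univ ≤ 1
  rw [B_univ hB hd, ← ENNReal.ofReal_one]
  apply ENNReal.ofReal_le_ofReal
  rw [norm_smul, norm_inv, norm_norm]
  exact inv_mul_le_one

lemma intB_eq (v : Vd d) (φ : Vf d) : ∫ σ, φ σ ∂(B v) = ‖v‖ * ∫ σ, φ σ ∂(B1 B hB v) := by
  by_cases hv : v = 0
  · simp [hv, B_zero hB hd]
  · rw [(B_eq hB v hv).2, integral_smul_measure, ENNReal.toReal_ofReal (norm_nonneg v), smul_eq_mul]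
    rfl

lemma iB_meas {F : (Vd d × Vd d) × Vd d → ℝ} (hF : Measurable F) :
    Measurable (fun z : Vd d × Vd d => ∫ σ, F (z, σ) ∂(B (z.1 - z.2))) := by
  have := B1_fin hB hd
  simp_rw [intB_eq hB hd]
  refine Measurable.mul (by fun_prop) ?_
  exact (StronglyMeasurable.integral_kernel_prod_right' (κ := (B1 B hB).comap
    (fun z : Vd d × Vd d => z.1 - z.2) (by fun_prop)) hF.stronglyMeasurable).measurable

lemma qB_meas (hf : Measurable f) :
    Measurable (fun z : Vd d × Vd d => qB B f z.1 z.2) := iB_meas hB hd (dl_meas hf)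

lemma B_int_const (v : Vd d) (c : ℝ) : ∫ _, c ∂(B v) = ‖v‖ * c := by
  rw [integral_const, B_real hB hd, smul_eq_mul]

lemma B_integrable (v : Vd d) {φ : Vf d} (hφ : Measurable φ) (S : ℝ)
    (h : ∀ σ, ‖σ‖ = 1 → |φ σ| ≤ S) : Integrable φ (B v) := by
  have := B_fin hB hd v
  exact Integrable.of_bound hφ.aestronglyMeasurable S ((B_sphere hB hd v).mono fun σ hσ => h σ hσ)

lemma B_int_le (v : Vd d) (φ : Vf d) (S : ℝ)
    (h : ∀ σ, ‖σ‖ = 1 → |φ σ| ≤ S) : |∫ σ, φ σ ∂(B v)| ≤ ‖v‖ * S := by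
  have := B_fin hB hd v
  have := norm_integral_le_of_norm_le_const (f := φ) ((B_sphere hB hd v).mono fun σ hσ => h σ hσ)
  rw [B_real hB hd, mul_comm] at this
  exact this

lemma dl_integrable (hf : Gr k C f) (v w u : Vd d) :
    Integrable (fun σ => dl f v w σ) (B u) :=
  B_integrable hB hd u (dl_meas1 hf.1 v w) _ fun σ hσ => dl_bound hf v w σ hσ

lemma qB_bound (hf : Gr k C f) (v w : Vd d) :
    |qB B f v w| ≤ 4 * C * (pw v ^ (k + 1) * pw w ^ (k + 1)) := by
  refine (B_int_le hB hd (v - w) _ _ fun σ hσ => dl_bound hf v w σ hσ).trans ?_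
  have h1 := norm_sub_le_pw v w
  have h2 : 0 ≤ 4 * C * (pw v ^ k * pw w ^ k) :=
    mul_nonneg (by linarith [hf.nonneg]) (mul_nonneg (pow_nonneg (pw_pos v).le _) (pow_nonneg (pw_pos w).le _))
  calc _ ≤ (pw v * pw w) * (4 * C * (pw v ^ k * pw w ^ k)) := mlr h1 h2
    _ = _ := by ring

lemma qB_integrable {C R R' : ℝ} (hf : Gr k C f) {μ ν : Mv d}
    (hμ : Adm μ (k + 1) R) (hν : Adm ν (k + 1) R') :
    Integrable (fun z : Vd d × Vd d => qB B f z.1 z.2) (μ.prod ν) := by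
  have := hμ.1
  have := hν.1
  exact ((hμ.2.1.mul_prod hν.2.1).const_mul (4 * C)).mono' (qB_meas hB hd hf.1).aestronglyMeasurable
    (ae_of_all _ fun z => qB_bound hB hd hf z.1 z.2)

lemma QInt_prod {C R R' : ℝ} (hf : Gr k C f) {μ ν : Mv d}
    (hμ : Adm μ (k + 1) R) (hν : Adm ν (k + 1) R') :
    QInt B f μ ν = ∫ z, qB B f z.1 z.2 ∂(μ.prod ν) := by
  have := hμ.1
  have := hν.1
  rw [integral_prod _ (qB_integrable hB hd hf hμ hν)]; rfl

lemma QInt_bound {C R R' : ℝ} (hf : Gr k C f) {μ ν : Mv d}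
    (hμ : Adm μ (k + 1) R) (hν : Adm ν (k + 1) R') : |QInt B f μ ν| ≤ 4 * C * (R * R') := by
  have := hμ.1
  have := hν.1
  rw [QInt_prod hB hd hf hμ hν]
  have h := norm_integral_le_of_norm_le (f := fun z : Vd d × Vd d => qB B f z.1 z.2) ((hμ.2.1.mul_prod hν.2.1).const_mul (4 * C))
    (ae_of_all _ fun z : Vd d × Vd d => qB_bound hB hd hf z.1 z.2)
  rw [integral_const_mul, integral_prod_mul (fun v : Vd d => pw v ^ (k + 1)) (fun v : Vd d => pw v ^ (k + 1))] at h
  refine h.trans (mll ?_ (by linarith [hf.nonneg]))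
  exact mul_le_mul hμ.2.2 hν.2.2 (integral_nonneg fun v => pow_nonneg (pw_pos v).le _) (by linarith [hμ.one_le])

lemma qB_lin {C D : ℝ} {f g : Vf d} (hf : Gr k C f) (hg : Gr k D g) (a b : ℝ) (v w : Vd d) :
    qB B (fun v => a * f v + b * g v) v w = a * qB B f v w + b * qB B g v w := by
  unfold qB
  rw [← integral_const_mul, ← integral_const_mul, ← integral_add ((dl_integrable hB hd hf v w _).const_mul a)
    ((dl_integrable hB hd hg v w _).const_mul b)]
  congr 1; ext σ; unfold dl; ring

lemma QInt_lin {C D R R' : ℝ} {f g : Vf d} (hf : Gr k C f) (hg : Gr k D g) (a b : ℝ)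
    {μ ν : Mv d} (hμ : Adm μ (k + 1) R) (hν : Adm ν (k + 1) R') :
    QInt B (fun v => a * f v + b * g v) μ ν = a * QInt B f μ ν + b * QInt B g μ ν := by
  rw [QInt_prod hB hd ((hf.smul a).add (hg.smul b)) hμ hν, QInt_prod hB hd hf hμ hν, QInt_prod hB hd hg hμ hν,
    ← integral_const_mul, ← integral_const_mul, ← integral_add ((qB_integrable hB hd hf hμ hν).const_mul a)
      ((qB_integrable hB hd hg hμ hν).const_mul b)]
  congr 1; ext z; exact qB_lin hB hd hf hg a b z.1 z.2

lemma qB_symm (hf : Measurable f) (v w : Vd d) : qB B f v w = qB B f w v := by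
  unfold qB
  rw [← neg_sub v w, B_neg hB hd, integral_map (by fun_prop) (dl_meas1 hf w v).aestronglyMeasurable]
  congr 1; ext σ
  have e1 : postV w v (-σ) = postVs v w σ := by
    unfold postV postVs; rw [norm_sub_rev, add_comm w v]; module
  have e2 : postVs w v (-σ) = postV v w σ := by
    unfold postV postVs; rw [norm_sub_rev, add_comm w v]; module
  unfold dl; rw [e1, e2]; ring

lemma QInt_symm {C R R' : ℝ} (hf : Gr k C f) {μ ν : Mv d}
    (hμ : Adm μ (k + 1) R) (hν : Adm ν (k + 1) R') : QInt B f μ ν = QInt B f ν μ := by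
  have := hμ.1
  have := hν.1
  rw [QInt_prod hB hd hf hμ hν, QInt_prod hB hd hf hν hμ, ← integral_prod_swap]
  congr 1; ext z; exact qB_symm hB hd hf.1 _ _

omit hB hd in
lemma ker_meas {α : Type*} [MeasurableSpace α] {c : α → Mv d} (hc : Measurable c)
    (hp : ∀ a, IsProbabilityMeasure (c a)) {h : Vd d × Vd d → ℝ} (hh : Measurable h) :
    Measurable (fun a => ∫ v, ∫ w, h (v, w) ∂(c a) ∂(c a)) := by
  let K : Kernel α (Vd d) := ⟨c, hc⟩
  have : IsMarkovKernel K := ⟨hp⟩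
  have h1 : StronglyMeasurable (fun z : α × Vd d => ∫ w, h (z.2, w) ∂(c z.1)) :=
    StronglyMeasurable.integral_kernel_prod_right' (κ := K.comap (Prod.fst : α × Vd d → α) measurable_fst)
      (f := fun y : (α × Vd d) × Vd d => h (y.1.2, y.2)) (hh.comp (by fun_prop)).stronglyMeasurable
  exact (StronglyMeasurable.integral_kernel_prod_right' (κ := K) h1).measurable

lemma QInt_meas {α : Type*} [MeasurableSpace α] {c : α → Mv d} (hc : Measurable c)
    (hp : ∀ a, IsProbabilityMeasure (c a)) (hf : Measurable f) :
    Measurable (fun a => QInt B f (c a) (c a)) := ker_meas hc hp (qB_meas hB hd hf)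

omit hB hd in
lemma int_meas {α : Type*} [MeasurableSpace α] {c : α → Mv d} (hc : Measurable c)
    (hp : ∀ a, IsProbabilityMeasure (c a)) (hf : Measurable f) :
    Measurable (fun a => ∫ v, f v ∂(c a)) := by
  let K : Kernel α (Vd d) := ⟨c, hc⟩
  have : IsMarkovKernel K := ⟨hp⟩
  exact (StronglyMeasurable.integral_kernel_prod_right' (κ := K) (f := fun z : α × Vd d => f z.2)
    (hf.comp measurable_snd).stronglyMeasurable).measurable
end

/-- weighted Lipschitz class -/
def Ft (C : ℝ) (f : Vf d) : Prop := (∀ v, |f v| ≤ C * (1 + ‖v‖ ^ 2)) ∧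
  ∀ v w, |f v - f w| ≤ C * (‖v - w‖ * (1 + ‖v‖ ^ 2 + ‖w‖ ^ 2))

/-- cubic weighted Lipschitz class -/
def Lp (C : ℝ) (f : Vf d) : Prop := (∀ v, |f v| ≤ C * pw v ^ 3) ∧
  ∀ v w, |f v - f w| ≤ C * (‖v - w‖ * (pw v ^ 3 * pw w ^ 3))

lemma int_sub_add {α : Type*} [MeasurableSpace α] {μ : Measure α} {f g h : α → ℝ} (hf : Integrable f μ)
    (hg : Integrable g μ) (hh : Integrable h μ) :
    ∫ x, (f x - g x + h x) ∂μ = ∫ x, f x ∂μ - ∫ x, g x ∂μ + ∫ x, h x ∂μ := by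
  rw [← integral_sub hf hg]; exact integral_add (hf.sub hg) hh

lemma cont_of_lip {K : Vd d → Vd d → ℝ} (hK : ∀ v, Continuous fun w => K w v)
    (h : ∀ v w, |f v - f w| ≤ ‖v - w‖ * K v w) : Continuous f := by
  rw [continuous_iff_continuousAt]
  intro v
  rw [ContinuousAt, tendsto_iff_norm_sub_tendsto_zero]
  refine squeeze_zero (fun _ => norm_nonneg _) (fun w => h w v) ?_
  have : Continuous fun w => ‖w - v‖ * K w v := by have := hK v; fun_prop
  simpa using this.tendsto v

lemma pw_cont : Continuous (pw : Vf d) := by unfold pw; fun_prop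

lemma Ft.meas (h : Ft C f) : Measurable f :=
  (cont_of_lip (K := fun v w => C * (1 + ‖v‖ ^ 2 + ‖w‖ ^ 2)) (fun v => by fun_prop)
    fun v w => (h.2 v w).trans_eq (by ring)).measurable

lemma Lp.meas (h : Lp C f) : Measurable f :=
  (cont_of_lip (K := fun v w => C * (pw v ^ 3 * pw w ^ 3)) (fun v => by have := @pw_cont d; fun_prop)
    fun v w => (h.2 v w).trans_eq (by ring)).measurable

lemma sq_le_pw (v : Vd d) : 1 + ‖v‖ ^ 2 ≤ pw v ^ 2 := by unfold pw; nlinarith [norm_nonneg v]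
lemma pw_le_sq (v : Vd d) : pw v ≤ 2 * (1 + ‖v‖ ^ 2) := by
  unfold pw; nlinarith [sq_nonneg (‖v‖ - 1)]

lemma Ft.gr (h : Ft C f) (hC : 0 ≤ C) : Gr 2 C f :=
  ⟨h.meas, fun v => (h.1 v).trans (mll (sq_le_pw v) hC)⟩

lemma Lp.gr (h : Lp C f) : Gr 3 C f := ⟨h.meas, h.1⟩

/-- linearized operator -/
def Lop (B : Vd d → Mv d) (f : Vf d) (a : Mv d) (v : Vd d) : ℝ :=
  ∫ x, qB B f v x ∂a

section
variable {B : Vd d → Mv d} (hB : IsCollisionKernel B) (hd : 0 < d)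

lemma q3_integrable {a : Mv d} {R : ℝ} (ha : Adm a 3 R) (w : Vd d) :
    Integrable (fun x => ‖w - x‖) a := by
  refine (ha.2.1.const_mul (pw w)).mono' (by fun_prop) (ae_of_all _ fun x => ?_)
  rw [norm_norm]
  exact (norm_sub_le_pw w x).trans (mll (by
    simpa using pw_pow_mono x (show 1 ≤ 3 by norm_num)) (pw_pos w).le)

lemma m_bound {a : Mv d} {R : ℝ} (ha : Adm a 3 R) (w : Vd d) :
    ∫ x, ‖w - x‖ ∂a ≤ R * pw w := by
  calc _ ≤ ∫ x, pw w * pw x ^ 3 ∂a := integral_mono (q3_integrable ha w) (ha.2.1.const_mul _) fun x =>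
        (norm_sub_le_pw w x).trans (mll (by
          simpa using pw_pow_mono x (show 1 ≤ 3 by norm_num)) (pw_pos w).le)
    _ ≤ _ := by
      rw [integral_const_mul, mul_comm]; exact mlr ha.2.2 (pw_pos w).le

lemma q3_bound {a : Mv d} {R : ℝ} (ha : Adm a 3 R) (w : Vd d) {Φ : Vf d} {A K : ℝ} (hK : 0 ≤ K)
    (h : ∀ x, |Φ x| ≤ A * ‖w - x‖ + K * pw x ^ 3) : |∫ x, Φ x ∂a| ≤ A * (∫ x, ‖w - x‖ ∂a) + K * R := by
  have h1 := (q3_integrable ha w).const_mul A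
  have h2 := ha.2.1.const_mul K
  have := norm_integral_le_of_norm_le (f := Φ) (h1.add h2) (ae_of_all _ h)
  simp only [Pi.add_apply] at this
  rw [integral_add h1 h2, integral_const_mul, integral_const_mul] at this
  exact this.trans (by gcongr; exact ha.2.2)

include hB hd

lemma qB_G (hf : Ft 1 f) (v x : Vd d) :
    |qB B f v x + ‖v - x‖ * f v| ≤ (1 + ‖v‖ ^ 2) * ‖v - x‖ + 2 * pw v * pw x ^ 3 := by
  have e : qB B f v x + ‖v - x‖ * f v = ∫ σ, (dl f v x σ + f v) ∂(B (v - x)) := by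
    have := B_fin hB hd (v - x)
    rw [integral_add (dl_integrable hB hd (hf.gr zero_le_one) v x _) (integrable_const _), B_int_const hB hd]; rfl
  rw [e]
  refine (B_int_le hB hd (v - x) _ (3 + ‖v‖ ^ 2 + 2 * ‖x‖ ^ 2) fun σ hσ => ?_).trans ?_
  · have := post_sq v x σ hσ
    have h1 := abs_le.1 (hf.1 (postV v x σ))
    have h2 := abs_le.1 (hf.1 (postVs v x σ))
    have h3 := abs_le.1 (hf.1 x)
    unfold dl
    rw [abs_le]; constructor <;> linarith [h1.1, h1.2, h2.1, h2.2, h3.1, h3.2]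
  · have h1 := norm_sub_le_pw v x
    have h2 := sq_le_pw x
    have h3 : ‖v - x‖ * (1 + ‖x‖ ^ 2) ≤ (pw v * pw x) * pw x ^ 2 := mul_le_mul h1 h2 (by positivity)
      (mul_nonneg (pw_pos v).le (pw_pos x).le)
    nlinarith

lemma qB_G2 {κ : ℝ} (hL : IsLipschitzKernel B κ) (hf : Ft 1 f) (v w x : Vd d) :
    |qB B f v x - qB B f w x + ‖w - x‖ * (f v - f w)| ≤
      (‖v - w‖ * (1 + ‖v‖ ^ 2 + ‖w‖ ^ 2)) * ‖w - x‖ +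
        (‖v - w‖ * (2 * pw w + 6 * κ * (1 + ‖v‖ ^ 2))) * pw x ^ 3 := by
  have hκ : 1 ≤ κ := hL.1
  have i1 := dl_integrable hB hd (hf.gr zero_le_one) v x (w - x)
  have i2 := dl_integrable hB hd (hf.gr zero_le_one) w x (w - x)
  have e : qB B f v x - qB B f w x + ‖w - x‖ * (f v - f w) =
      (∫ σ, (dl f v x σ - dl f w x σ + (f v - f w)) ∂(B (w - x))) +
      ((∫ σ, dl f v x σ ∂(B (v - x))) - ∫ σ, dl f v x σ ∂(B (w - x))) := by
    have := B_fin hB hd (w - x)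
    rw [int_sub_add i1 i2 (integrable_const _), B_int_const hB hd]
    unfold qB; ring
  rw [e]
  have h1 : |∫ σ, (dl f v x σ - dl f w x σ + (f v - f w)) ∂(B (w - x))| ≤
      ‖w - x‖ * (‖v - w‖ * (2 + ‖v‖ ^ 2 + ‖w‖ ^ 2 + 2 * ‖x‖ ^ 2)) := by
    refine B_int_le hB hd (w - x) _ _ fun σ hσ => ?_
    have l := post_lip v w x σ hσ
    have s1 := post_sq v x σ hσ
    have s2 := post_sq w x σ hσ
    have a1 := (hf.2 (postV v x σ) (postV w x σ)).trans (mll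
      (mlr l.1 (by positivity)) zero_le_one)
    have a2 := (hf.2 (postVs v x σ) (postVs w x σ)).trans (mll
      (mlr l.2 (by positivity)) zero_le_one)
    have e2 : dl f v x σ - dl f w x σ + (f v - f w) =
      (f (postV v x σ) - f (postV w x σ)) + (f (postVs v x σ) - f (postVs w x σ)) := by unfold dl; ring
    rw [e2]
    refine (abs_add_le _ _).trans ((add_le_add a1 a2).trans_eq ?_)
    linear_combination ‖v - w‖ * (s1 + s2)
  have h2 := B_lip hB hd hL (v - x) (w - x) (fun σ => dl f v x σ) (dl_meas1 hf.meas v x)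
    (4 + 2 * ‖v‖ ^ 2 + 2 * ‖x‖ ^ 2) (by positivity) (fun σ hσ => by
      have := post_sq v x σ hσ
      have h1 := abs_le.1 (hf.1 (postV v x σ))
      have h2 := abs_le.1 (hf.1 (postVs v x σ))
      have h3 := abs_le.1 (hf.1 x)
      have h4 := abs_le.1 (hf.1 v)
      unfold dl
      rw [abs_le]; constructor <;> linarith [h1.1, h1.2, h2.1, h2.2, h3.1, h3.2, h4.1, h4.2])
  rw [sub_sub_sub_cancel_right] at h2
  refine (abs_add_le _ _).trans ((add_le_add h1 h2).trans ?_)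
  have p1 : ‖w - x‖ * (1 + 2 * ‖x‖ ^ 2) ≤ 2 * pw w * pw x ^ 3 := by
    have h1 := norm_sub_le_pw w x
    have h2 := sq_le_pw x
    have h3 : ‖w - x‖ * (1 + ‖x‖ ^ 2) ≤ (pw w * pw x) * pw x ^ 2 := mul_le_mul h1 h2 (by positivity)
      (mul_nonneg (pw_pos w).le (pw_pos x).le)
    nlinarith [norm_nonneg (w - x)]
  have p2 : 4 + 2 * ‖v‖ ^ 2 + 2 * ‖x‖ ^ 2 ≤ 6 * (1 + ‖v‖ ^ 2) * pw x ^ 3 := by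
    have h2 := (sq_le_pw x).trans (pw_pow_mono x (show 2 ≤ 3 by norm_num))
    have := mll h2 (show 0 ≤ 6 * (1 + ‖v‖ ^ 2) by positivity)
    nlinarith [sq_nonneg ‖v‖, sq_nonneg ‖x‖, mul_nonneg (sq_nonneg ‖v‖) (sq_nonneg ‖x‖)]
  have p3 := mll p1 (norm_nonneg (v - w))
  have p4 := mll p2 (mul_nonneg (by linarith : 0 ≤ κ) (norm_nonneg (v - w)))
  nlinarith

lemma L_int (hf : Ft 1 f) {a : Mv d} {R : ℝ} (ha : Adm a 3 R) (v : Vd d) :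
    Integrable (fun x => qB B f v x) a := by
  refine (ha.2.1.const_mul (4 * 1 * pw v ^ 3)).mono' ((qB_meas hB hd hf.meas).comp
    (by fun_prop : Measurable fun x : Vd d => (v, x))).aestronglyMeasurable (ae_of_all _ fun x => ?_)
  exact (qB_bound hB hd (hf.gr zero_le_one) v x).trans_eq (by ring)

lemma L_G (hf : Ft 1 f) {a : Mv d} {R : ℝ} (ha : Adm a 3 R) (v : Vd d) :
    |Lop B f a v + (∫ x, ‖v - x‖ ∂a) * f v| ≤ (1 + ‖v‖ ^ 2) * (∫ x, ‖v - x‖ ∂a) + 2 * pw v * R := by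
  have := q3_bound ha v (mul_nonneg zero_le_two (pw_pos v).le) (fun x => qB_G hB hd hf v x)
  rwa [integral_add (L_int hB hd hf ha v) ((q3_integrable ha v).mul_const _), integral_mul_const] at this

lemma L_G2 {κ : ℝ} (hL : IsLipschitzKernel B κ) (hf : Ft 1 f) {a : Mv d} {R : ℝ} (ha : Adm a 3 R) (v w : Vd d) :
    |Lop B f a v - Lop B f a w + (∫ x, ‖w - x‖ ∂a) * (f v - f w)| ≤
      (‖v - w‖ * (1 + ‖v‖ ^ 2 + ‖w‖ ^ 2)) * (∫ x, ‖w - x‖ ∂a) +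
        (‖v - w‖ * (2 * pw w + 6 * κ * (1 + ‖v‖ ^ 2))) * R := by
  have hκ : 1 ≤ κ := hL.1
  have := q3_bound ha w (mul_nonneg (norm_nonneg (v - w)) (add_nonneg (mul_nonneg zero_le_two (pw_pos w).le)
    (by positivity : 0 ≤ 6 * κ * (1 + ‖v‖ ^ 2)))) (fun x => qB_G2 hB hd hL hf v w x)
  rwa [int_sub_add (L_int hB hd hf ha v) (L_int hB hd hf ha w) ((q3_integrable ha w).mul_const _),
    integral_mul_const] at this

lemma L_bound (hf : Ft 1 f) {a : Mv d} {R : ℝ} (ha : Adm a 3 R) (v : Vd d) :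
    |Lop B f a v| ≤ 4 * R * pw v ^ 3 := by
  have := norm_integral_le_of_norm_le (f := fun x => qB B f v x) (ha.2.1.const_mul (4 * pw v ^ 3)) (ae_of_all _ fun x =>
    (qB_bound hB hd (hf.gr zero_le_one) v x).trans_eq (by ring))
  rw [integral_const_mul] at this
  refine this.trans ?_
  nlinarith [ha.2.2, pow_nonneg (pw_pos v).le 3]

lemma L_Lp {κ : ℝ} (hL : IsLipschitzKernel B κ) (hf : Ft 1 f) {a : Mv d} {R : ℝ}
    (ha : Adm a 3 R) : Lp (12 * κ * R) (Lop B f a) := by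
  have hκ : 1 ≤ κ := hL.1
  have hR := ha.one_le
  refine ⟨fun v => (L_bound hB hd hf ha v).trans (mlr (by nlinarith) (pow_nonneg (pw_pos v).le _)),
    fun v w => ?_⟩
  have h := L_G2 hB hd hL hf ha v w
  have hm := m_bound ha w
  have hm0 : 0 ≤ ∫ x, ‖w - x‖ ∂a := integral_nonneg fun x => norm_nonneg _
  have hs := hf.2 v w
  rw [one_mul] at hs
  set m := ∫ x, ‖w - x‖ ∂a
  have h1 : |Lop B f a v - Lop B f a w| ≤ m * |f v - f w| + ((‖v - w‖ * (1 + ‖v‖ ^ 2 + ‖w‖ ^ 2)) * m +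
        (‖v - w‖ * (2 * pw w + 6 * κ * (1 + ‖v‖ ^ 2))) * R) := by
    have e : Lop B f a v - Lop B f a w = (Lop B f a v - Lop B f a w + m * (f v - f w)) - m * (f v - f w) := by ring
    rw [e]
    refine (abs_sub _ _).trans ?_
    rw [abs_mul m, abs_of_nonneg hm0]; linarith
  have h2 : m * |f v - f w| ≤ m * (‖v - w‖ * (1 + ‖v‖ ^ 2 + ‖w‖ ^ 2)) := mll hs hm0
  have p1 : 1 + ‖v‖ ^ 2 + ‖w‖ ^ 2 ≤ pw v ^ 2 * pw w ^ 2 := by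
    have := mul_le_mul (sq_le_pw v) (sq_le_pw w) (by positivity) (by positivity)
    nlinarith [mul_nonneg (sq_nonneg ‖v‖) (sq_nonneg ‖w‖)]
  have a1 := pw_one_le v
  have a2 := pw_one_le w
  have p2 : (1 + ‖v‖ ^ 2 + ‖w‖ ^ 2) * m ≤ (pw v ^ 3 * pw w ^ 3) * R := by
    calc _ ≤ (pw v ^ 2 * pw w ^ 2) * (R * pw w) := mul_le_mul p1 hm hm0 (by positivity)
      _ = (pw v ^ 2 * pw w ^ 3) * R := by ring
      _ ≤ _ := by gcongr; norm_num
  have q1 : 1 ≤ pw v ^ 3 := pw_pow_one_le v 3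
  have q2 : 1 ≤ pw w ^ 3 := pw_pow_one_le w 3
  have q3 : pw w ≤ pw w ^ 3 := by simpa using pw_pow_mono w (show 1 ≤ 3 by norm_num)
  have q4 : 1 + ‖v‖ ^ 2 ≤ pw v ^ 3 := (sq_le_pw v).trans (pw_pow_mono v (by norm_num))
  have p3 : pw w ≤ pw v ^ 3 * pw w ^ 3 := by nlinarith
  have p4 : 1 + ‖v‖ ^ 2 ≤ pw v ^ 3 * pw w ^ 3 := by nlinarith
  set X := pw v ^ 3 * pw w ^ 3
  have hX : 1 ≤ X := by nlinarith
  refine h1.trans ((add_le_add_left h2 _).trans ?_)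
  have key : m * (1 + ‖v‖ ^ 2 + ‖w‖ ^ 2) + ((1 + ‖v‖ ^ 2 + ‖w‖ ^ 2) * m + (2 * pw w + 6 * κ * (1 + ‖v‖ ^ 2)) * R)
      ≤ 12 * κ * R * X := by
    have b1 : (2 * pw w + 6 * κ * (1 + ‖v‖ ^ 2)) * R ≤ (2 * X + 6 * κ * X) * R :=
      mlr (by nlinarith) (by linarith)
    have b2 : 0 ≤ (κ - 1) * (R * X) := mul_nonneg (by linarith) (by nlinarith)
    have b3 : 0 ≤ R * X := by nlinarith
    nlinarith
  have := mll key (norm_nonneg (v - w))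
  nlinarith

/-- cutoff -/
def chi (q : ℝ) (v : Vd d) : ℝ := 1 / (1 + q * ‖v‖)

lemma F_step {κ : ℝ} (hL : IsLipschitzKernel B κ) (hf : Ft 1 f) {a : Mv d} {R : ℝ}
    (ha : Adm a 3 R) {h : ℝ} (h0 : 0 < h) (hR1 : h * R ≤ 1) :
    Ft (1 + 40 * κ * R * h) (fun v => f v + h * (chi (h * R) v * Lop B f a v)) := by
  have hκ : 1 ≤ κ := hL.1
  have hR := ha.one_le
  set q := h * R with hq
  have q0 : 0 < q := by positivity
  have c0 : ∀ v : Vd d, 0 < 1 + q * ‖v‖ := fun v => by positivity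
  have c1 : ∀ v : Vd d, 0 < chi q v := fun v => by unfold chi; have := c0 v; positivity
  have c2 : ∀ v : Vd d, chi q v ≤ 1 := fun v => by
    unfold chi; rw [div_le_one (c0 v)]; nlinarith [norm_nonneg v]
  have hm0 : ∀ w : Vd d, 0 ≤ ∫ x, ‖w - x‖ ∂a := fun w => integral_nonneg fun x => norm_nonneg _
  have c3 : ∀ v : Vd d, h * chi q v * (∫ x, ‖v - x‖ ∂a) ≤ 1 := fun v => by
    have h1 := m_bound ha v
    have h2 : h * (∫ x, ‖v - x‖ ∂a) ≤ 1 + q * ‖v‖ := by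
      have := mll h1 h0.le
      unfold pw at this
      nlinarith
    unfold chi
    rw [mul_assoc, div_mul_eq_mul_div, one_mul, ← mul_div_assoc, div_le_one (c0 v)]; exact h2
  have c4 : ∀ v : Vd d, 0 ≤ h * chi q v * (∫ x, ‖v - x‖ ∂a) := fun v =>
    mul_nonneg (mul_nonneg h0.le (c1 v).le) (hm0 v)
  constructor
  · intro v
    have hG := L_G hB hd hf ha v
    have hfv := hf.1 v
    rw [one_mul] at hfv
    have e : f v + h * (chi q v * Lop B f a v) = (1 - h * chi q v * (∫ x, ‖v - x‖ ∂a)) * f v +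
      (h * chi q v) * (Lop B f a v + (∫ x, ‖v - x‖ ∂a) * f v) := by ring
    change |f v + h * (chi q v * Lop B f a v)| ≤ _
    rw [e]
    refine (abs_add_le _ _).trans ?_
    rw [abs_mul, abs_mul (h * chi q v), abs_of_nonneg (by linarith [c3 v]), abs_of_nonneg (mul_nonneg h0.le (c1 v).le)]
    have t1 := mll hfv (by linarith [c3 v] : 0 ≤ 1 - h * chi q v * (∫ x, ‖v - x‖ ∂a))
    have t2 := mll hG (mul_nonneg h0.le (c1 v).le)
    have t3 : h * chi q v * (2 * pw v * R) ≤ h * (4 * R * (1 + ‖v‖ ^ 2)) := by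
      rw [mul_assoc]
      refine mll ?_ h0.le
      calc chi q v * (2 * pw v * R) ≤ 1 * (2 * pw v * R) := mlr (c2 v)
            (mul_nonneg (mul_nonneg zero_le_two (pw_pos v).le) (by linarith))
        _ ≤ _ := by nlinarith [pw_le_sq v]
    have t4 : h * (4 * R * (1 + ‖v‖ ^ 2)) ≤ 40 * κ * R * h * (1 + ‖v‖ ^ 2) := by
      have : 0 ≤ h * R * (1 + ‖v‖ ^ 2) := by positivity
      nlinarith
    nlinarith
  · intro v w
    have hG := L_G2 hB hd hL hf ha v w
    have hfv := hf.2 v w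
    rw [one_mul] at hfv
    have hLv := L_bound hB hd hf ha v
    set m := ∫ x, ‖w - x‖ ∂a with hm
    set S := 1 + ‖v‖ ^ 2 + ‖w‖ ^ 2 with hS
    have e : f v + h * (chi q v * Lop B f a v) - (f w + h * (chi q w * Lop B f a w)) =
      (1 - h * chi q w * m) * (f v - f w) +
      (h * chi q w) * (Lop B f a v - Lop B f a w + m * (f v - f w)) + h * ((chi q v - chi q w) * Lop B f a v) := by ring
    change |f v + h * (chi q v * Lop B f a v) - (f w + h * (chi q w * Lop B f a w))| ≤ _
    rw [e]
    refine (abs_add_le _ _).trans (((add_le_add_left (abs_add_le _ _) _)).trans ?_)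
    rw [abs_mul (1 - _), abs_mul (h * chi q w), abs_mul h (_ * _), abs_mul (chi q v - _), abs_of_nonneg (by linarith [c3 w] : 0 ≤ 1 - h * chi q w * m),
      abs_of_nonneg (mul_nonneg h0.le (c1 w).le), abs_of_pos h0]
    have t1 := mll hfv (by linarith [c3 w] : 0 ≤ 1 - h * chi q w * m)
    have t2 := mll hG (mul_nonneg h0.le (c1 w).le)
    have x1 : |chi q v - chi q w| ≤ q * ‖v - w‖ / (1 + q * ‖v‖) := by
      have : chi q v - chi q w = (q * (‖w‖ - ‖v‖) / (1 + q * ‖v‖)) * chi q w := by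
        unfold chi; have := (c0 v).ne'; have := (c0 w).ne'; field_simp; ring
      rw [this, abs_mul, abs_div, abs_mul, abs_of_pos q0, abs_of_pos (c0 v), abs_of_pos (c1 w)]
      have n1 : |‖w‖ - ‖v‖| ≤ ‖v - w‖ := by rw [abs_sub_comm]; exact abs_norm_sub_norm_le v w
      calc _ ≤ q * |‖w‖ - ‖v‖| / (1 + q * ‖v‖) * 1 := mll (c2 w) (by have := c0 v; positivity)
        _ ≤ _ := by rw [mul_one]; have := c0 v; gcongr
    have x2 : |chi q v - chi q w| * |Lop B f a v| ≤ ‖v - w‖ * (4 * R * pw v ^ 2) := by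
      calc _ ≤ (q * ‖v - w‖ / (1 + q * ‖v‖)) * (4 * R * pw v ^ 3) := mul_le_mul x1 hLv (abs_nonneg _)
            (by have := c0 v; positivity)
        _ = (q * pw v / (1 + q * ‖v‖)) * (‖v - w‖ * (4 * R * pw v ^ 2)) := by ring
        _ ≤ 1 * (‖v - w‖ * (4 * R * pw v ^ 2)) := by
          refine mlr ?_ (by positivity)
          rw [div_le_one (c0 v)]; unfold pw; nlinarith
        _ = _ := one_mul _
    have x3 : pw v ^ 2 ≤ 2 * S := by
      rw [hS]; unfold pw; nlinarith [sq_nonneg (‖v‖ - 1), sq_nonneg ‖w‖]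
    have x4 : 2 * pw w + 6 * κ * (1 + ‖v‖ ^ 2) ≤ 10 * κ * S := by
      have := pw_le_sq w
      have : 0 ≤ (κ - 1) * ‖w‖ ^ 2 := mul_nonneg (by linarith) (sq_nonneg _)
      rw [hS]; nlinarith [sq_nonneg ‖v‖, sq_nonneg ‖w‖]
    have S0 : 0 < S := by positivity
    have t3 : h * chi q w * ((‖v - w‖ * (2 * pw w + 6 * κ * (1 + ‖v‖ ^ 2))) * R) ≤ h * (10 * κ * R * (‖v - w‖ * S)) := by
      rw [mul_assoc]
      refine mll ?_ h0.le
      have p : 0 ≤ 2 * pw w + 6 * κ * (1 + ‖v‖ ^ 2) := add_nonneg (mul_nonneg zero_le_two (pw_pos w).le) (by positivity)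
      calc _ ≤ 1 * ((‖v - w‖ * (2 * pw w + 6 * κ * (1 + ‖v‖ ^ 2))) * R) :=
            mlr (c2 w) (by positivity)
        _ ≤ 1 * ((‖v - w‖ * (10 * κ * S)) * R) := by gcongr
        _ = _ := by ring
    have t4 : h * (|chi q v - chi q w| * |Lop B f a v|) ≤ h * (8 * R * (‖v - w‖ * S)) := by
      refine mll (x2.trans ?_) h0.le
      have := mll x3 (show 0 ≤ 4 * R * ‖v - w‖ by positivity)
      nlinarith
    have t5 : 0 ≤ h * R * (‖v - w‖ * S) := by positivity
    have t6 : 0 ≤ (κ - 1) * (h * R * (‖v - w‖ * S)) := mul_nonneg (by linarith) t5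
    nlinarith
end

lemma sphere_adm {μ : Mv d} (h : μ ∈ boltzmannSphere d) :
    Integrable (fun v : Vd d => ‖v‖ ^ 2) μ ∧ Adm μ 2 4 := by
  obtain ⟨h1, _, h3⟩ := h
  have i : Integrable (fun v : Vd d => ‖v‖ ^ 2) μ := by
    by_contra hn
    rw [integral_undef hn] at h3; norm_num at h3
  have b : ∀ v : Vd d, pw v ^ 2 ≤ 2 + 2 * ‖v‖ ^ 2 := fun v => by unfold pw; nlinarith [sq_nonneg (‖v‖ - 1)]
  have i2 : Integrable (fun v : Vd d => 2 + 2 * ‖v‖ ^ 2) μ := (integrable_const _).add (i.const_mul 2)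
  have i3 : Integrable (fun v : Vd d => pw v ^ 2) μ := by
    refine i2.mono' (pw_meas.pow_const 2).aestronglyMeasurable (ae_of_all _ fun v => ?_)
    rw [Real.norm_of_nonneg (by positivity)]; exact b v
  refine ⟨i, h1, i3, (integral_mono i3 i2 b).trans ?_⟩
  rw [integral_add (integrable_const _) (i.const_mul 2), integral_const_mul, h3]
  norm_num

lemma m1_le {μ : Mv d} (h : μ ∈ boltzmannSphere d) :
    Integrable (fun v : Vd d => ‖v‖) μ ∧ ∫ v, ‖v‖ ∂μ ≤ 1 := by
  obtain ⟨i, ha⟩ := sphere_adm h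
  have := ha.1
  have i2 : Integrable (fun v : Vd d => 2⁻¹ + 2⁻¹ * ‖v‖ ^ 2) μ := (integrable_const _).add (i.const_mul _)
  have b : ∀ v : Vd d, ‖v‖ ≤ 2⁻¹ + 2⁻¹ * ‖v‖ ^ 2 := fun v => by nlinarith [sq_nonneg (‖v‖ - 1)]
  have i3 : Integrable (fun v : Vd d => ‖v‖) μ := by
    refine i2.mono' (by fun_prop) (ae_of_all _ fun v => ?_)
    rw [norm_norm]; exact b v
  refine ⟨i3, (integral_mono i3 i2 b).trans ?_⟩
  rw [integral_add (integrable_const _) (i.const_mul _), integral_const_mul, h.2.2]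
  norm_num

lemma prim_meas {q : ℝ → ℝ} {τ K : ℝ} (hq : ∀ s, τ < s → |q s| ≤ K) :
    Measurable (fun t => ∫ s in Ioc τ t, q s) := by
  classical
  set I : Set ℝ := {t | τ ≤ t ∧ IntegrableOn q (Ioc τ t)} with hI
  have hIm : MeasurableSet I := by
    refine Set.OrdConnected.measurableSet ⟨fun x hx y hy z hz => ⟨hx.1.trans hz.1, ?_⟩⟩
    exact hy.2.mono_set (Set.Ioc_subset_Ioc_right hz.2)
  have e : (fun t => ∫ s in Ioc τ t, q s) = I.piecewise (fun t => ∫ s in Ioc τ t, q s) 0 := by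
    ext t
    by_cases ht : t ∈ I
    · rw [Set.piecewise_eq_of_mem _ _ _ ht]
    · rw [Set.piecewise_eq_of_notMem _ _ _ ht]
      by_cases h1 : τ ≤ t
      · exact integral_undef fun h2 => ht ⟨h1, h2⟩
      · rw [Set.Ioc_eq_empty (by intro h; exact h1 h.le)]; simp
  rw [e]
  refine ContinuousOn.measurable_piecewise ?_ continuousOn_const hIm
  have key : ∀ x ∈ I, ∀ y ∈ I, x ≤ y → |(∫ s in Ioc τ y, q s) - ∫ s in Ioc τ x, q s| ≤ |K| * |y - x| := by
    intro x hx y hy hxy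
    have : Ioc τ y = Ioc τ x ∪ Ioc x y := (Set.Ioc_union_Ioc_eq_Ioc hx.1 hxy).symm
    rw [this, setIntegral_union (Set.Ioc_disjoint_Ioc_of_le le_rfl) measurableSet_Ioc hx.2
      (hy.2.mono_set (Set.Ioc_subset_Ioc_left hx.1)), add_sub_cancel_left]
    have := norm_setIntegral_le_of_norm_le_const (μ := volume) (s := Ioc x y) (f := q) (C := |K|) (by simp)
      (fun s hs => (hq s (hx.1.trans_lt hs.1)).trans (le_abs_self K))
    refine this.trans ?_
    rw [Real.volume_real_Ioc_of_le hxy, abs_of_nonneg (sub_nonneg.2 hxy)]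
  have : LipschitzOnWith (Real.toNNReal |K|) (fun t => ∫ s in Ioc τ t, q s) I := by
    refine LipschitzOnWith.of_dist_le_mul fun x hx y hy => ?_
    rw [Real.coe_toNNReal _ (abs_nonneg K), Real.dist_eq, Real.dist_eq]
    rcases le_total x y with h | h
    · rw [abs_sub_comm, abs_sub_comm x y]; exact key x hx y hy h
    · exact key y hy x hx h
  exact this.continuousOn

lemma of_ev {α : Type*} [MeasurableSpace α] {μ : Measure α} {f : ℕ → α → ℝ} {g : α → ℝ} {K : ℝ} (hK : 0 ≤ K)
    (hg : Measurable g) (h0 : ∀ n x, 0 ≤ f n x) (hi : ∀ n, Integrable (f n) μ)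
    (hb : ∀ n, ∫ x, f n x ∂μ ≤ K) (he : ∀ x, ∀ᶠ n in atTop, f n x = g x) :
    Integrable g μ ∧ ∫ x, g x ∂μ ≤ K := by
  have g0 : ∀ x, 0 ≤ g x := fun x => by
    obtain ⟨n, hn⟩ := (he x).exists
    rw [← hn]; exact h0 n x
  have h1 : ∫⁻ x, ENNReal.ofReal (g x) ∂μ ≤ ENNReal.ofReal K := by
    calc _ = ∫⁻ x, liminf (fun n => ENNReal.ofReal (f n x)) atTop ∂μ := by
          congr 1; ext x
          refine (Tendsto.liminf_eq ?_).symm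
          exact tendsto_const_nhds.congr' ((he x).mono fun n hn => by simp [hn])
      _ ≤ liminf (fun n => ∫⁻ x, ENNReal.ofReal (f n x) ∂μ) atTop :=
          lintegral_liminf_le' fun n => (hi n).1.aemeasurable.ennreal_ofReal
      _ ≤ ENNReal.ofReal K := by
          refine liminf_le_of_le (by isBoundedDefault) fun b hb' => ?_
          obtain ⟨n, hn⟩ := hb'.exists
          refine hn.trans ?_
          rw [← ofReal_integral_eq_lintegral_ofReal (hi n) (ae_of_all _ (h0 n))]
          exact ENNReal.ofReal_le_ofReal (hb n)
  have h2 : Integrable g μ := ⟨hg.aestronglyMeasurable, by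
    rw [hasFiniteIntegral_iff_ofReal (ae_of_all _ g0)]
    exact h1.trans_lt ENNReal.ofReal_lt_top⟩
  refine ⟨h2, ?_⟩
  rw [← ofReal_integral_eq_lintegral_ofReal h2 (ae_of_all _ g0)] at h1
  exact (ENNReal.ofReal_le_ofReal_iff hK).1 h1

/-- regularized solution -/
structure Sol (B : Vd d → Mv d) (τ : ℝ) (c : ℝ → Mv d) : Prop where
  meas : Measurable c
  mem : ∀ t, c t ∈ boltzmannSphere d
  weak : ∀ f : Vd d → ℝ, Measurable f → (∃ M, ∀ v, |f v| ≤ M) → HasCompactSupport f →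
    ∀ t, τ ≤ t → (∫ v, f v ∂(c t)) = (∫ v, f v ∂(c τ)) + ∫ s in Ioc τ t, QInt B f (c s) (c s)

lemma bdd_gr (hf : Measurable f) {M : ℝ} (h : ∀ v, |f v| ≤ M) : Gr 0 M f :=
  ⟨hf, fun v => by simpa using h v⟩

section
variable {B : Vd d → Mv d} (hB : IsCollisionKernel B) (hd : 0 < d)
include hB hd

lemma sol_of {τ : ℝ} {b : ℝ → Mv d} (hb : IsBoltzmannSolutionFrom B τ b) :
    Sol B τ (fun t => b (max t τ)) := by
  have hmem : ∀ t, b (max t τ) ∈ boltzmannSphere d := fun t => hb.1 _ (le_max_right _ _)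
  have hw : ∀ f : Vd d → ℝ, Measurable f → (∃ M, ∀ v, |f v| ≤ M) → HasCompactSupport f →
    ∀ t, τ ≤ t → (∫ v, f v ∂(b (max t τ))) = (∫ v, f v ∂(b (max τ τ))) + ∫ s in Ioc τ t, QInt B f (b (max s τ)) (b (max s τ)) := by
    intro f h1 h2 h3 t ht
    rw [max_eq_left ht, max_self, hb.2 f h1 h2 h3 t ht]
    congr 1
    refine setIntegral_congr_fun measurableSet_Ioc fun s hs => ?_
    simp only [max_eq_left hs.1.le]
  refine ⟨?_, hmem, hw⟩
  have h1 : ∀ f : Vd d → ℝ, Measurable f → (∃ M, ∀ v, |f v| ≤ M) → HasCompactSupport f →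
      Measurable (fun t => ∫ v, f v ∂(b (max t τ))) := by
    rintro f h1 ⟨M, h2⟩ h3
    have e : (fun t => ∫ v, f v ∂(b (max t τ))) = fun t => (∫ v, f v ∂(b (max τ τ))) +
        ∫ s in Ioc τ (max t τ), QInt B f (b (max s τ)) (b (max s τ)) := by
      ext t
      have := hw f h1 ⟨M, h2⟩ h3 (max t τ) (le_max_right _ _)
      rwa [max_eq_left (le_max_right t τ)] at this
    rw [e]
    refine Measurable.const_add ?_ _
    refine (prim_meas (K := 4 * M * (4 * 4)) (q := fun s => QInt B f (b (max s τ)) (b (max s τ))) fun s _ => ?_).comp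
      (by fun_prop : Measurable fun t : ℝ => max t τ)
    exact QInt_bound hB hd ((bdd_gr h1 h2).mono (Nat.zero_le 1) le_rfl) (sphere_adm (hmem s)).2 (sphere_adm (hmem s)).2
  refine Measure.measurable_of_measurable_coe _ fun s hs => ?_
  have e : (fun t => b (max t τ) s) = fun t => ⨆ n : ℕ, b (max t τ) (s ∩ Metric.closedBall 0 n) := by
    ext t
    rw [← Monotone.measure_iUnion, ← Set.inter_iUnion, Metric.iUnion_closedBall_nat, Set.inter_univ]
    exact fun n m hnm => Set.inter_subset_inter_right _ (Metric.closedBall_subset_closedBall (by exact_mod_cast hnm))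
  rw [e]
  refine Measurable.iSup fun n => ?_
  have hsn : MeasurableSet (s ∩ Metric.closedBall 0 (n:ℝ)) := hs.inter measurableSet_closedBall
  have h2 := h1 ((s ∩ Metric.closedBall 0 (n:ℝ)).indicator 1) (measurable_one.indicator hsn)
    ⟨1, fun v => by
      by_cases hv : v ∈ s ∩ Metric.closedBall 0 (n:ℝ) <;> simp [Set.indicator, hv]⟩
    (HasCompactSupport.of_support_subset_isCompact (isCompact_closedBall 0 (n:ℝ))
      (Set.support_indicator_subset.trans Set.inter_subset_right))
  have e2 : (fun t => b (max t τ) (s ∩ Metric.closedBall 0 (n:ℝ))) = fun t =>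
      ENNReal.ofReal (∫ v, (s ∩ Metric.closedBall 0 (n:ℝ)).indicator 1 v ∂(b (max t τ))) := by
    ext t
    have := (hmem t).1
    rw [integral_indicator_one hsn, ofReal_measureReal]
  rw [e2]; exact h2.ennreal_ofReal

lemma Sol.ext {τ T R : ℝ} {c : ℝ → Mv d} (hc : Sol B τ c) (hR : ∀ t ∈ Icc τ T, Adm (c t) 6 R)
    {g : Vf d} (hg : Gr 3 C g) {t : ℝ} (ht : t ∈ Icc τ T) :
    (∫ v, g v ∂(c t)) = (∫ v, g v ∂(c τ)) + ∫ s in Ioc τ t, QInt B g (c s) (c s) := by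
  have hC := hg.nonneg
  have hR1 := (hR t ht).one_le
  have hτ : τ ∈ Icc τ T := ⟨le_rfl, ht.1.trans ht.2⟩
  have key : ∀ n : ℕ, |(∫ v, g v ∂(c t)) - (∫ v, g v ∂(c τ)) - ∫ s in Ioc τ t, QInt B g (c s) (c s)| ≤
      (2 * C * R + 4 * C * (R * R) * (t - τ)) * (1 / ((n:ℝ) + 1)) := by
    intro n
    set gn : Vd d → ℝ := (Metric.closedBall 0 ((n:ℝ) + 1)).indicator g with hgn
    have m1 : Measurable gn := hg.1.indicator measurableSet_closedBall
    have g1 : Gr 3 C gn := ⟨m1, fun v => by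
      by_cases hv : v ∈ Metric.closedBall 0 ((n:ℝ) + 1)
      · rw [hgn, Set.indicator_of_mem hv]; exact hg.2 v
      · rw [hgn, Set.indicator_of_notMem hv, abs_zero]; exact mul_nonneg hC (pow_nonneg (pw_pos v).le _)⟩
    have g2 : Gr 4 (C * (1 / ((n:ℝ) + 1))) (fun v => 1 * g v + (-1) * gn v) := by
      refine ⟨(hg.1.const_mul 1).add (m1.const_mul (-1)), fun v => ?_⟩
      by_cases hv : v ∈ Metric.closedBall 0 ((n:ℝ) + 1)
      · simp only [hgn, Set.indicator_of_mem hv]; simp; have := pw_pos v; positivity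
      · simp only [hgn, Set.indicator_of_notMem hv, one_mul, mul_zero, add_zero]
        refine (hg.2 v).trans ?_
        rw [mul_assoc]
        refine mll ?_ hC
        rw [one_div, inv_mul_eq_div, le_div_iff₀ (by positivity), pow_succ (pw v) 3]
        refine mll ?_ (pow_nonneg (pw_pos v).le _)
        simp only [Metric.mem_closedBall, dist_zero_right, not_le] at hv
        linarith [norm_le_pw v]
    have g3 : ∃ M, ∀ v, |gn v| ≤ M := by
      refine ⟨C * (n + 2) ^ 3, fun v => ?_⟩
      by_cases hv : v ∈ Metric.closedBall 0 ((n:ℝ) + 1)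
      · rw [hgn, Set.indicator_of_mem hv]
        refine (hg.2 v).trans (mll (pll (pw_pos v).le ?_ 3) hC)
        simp only [Metric.mem_closedBall, dist_zero_right] at hv
        unfold pw; linarith
      · rw [hgn, Set.indicator_of_notMem hv, abs_zero]; positivity
    have w := hc.weak gn m1 g3 (HasCompactSupport.of_support_subset_isCompact (isCompact_closedBall 0 _)
      Set.support_indicator_subset) t ht.1
    have e1 : ∀ s ∈ Icc τ T, (∫ v, g v ∂(c s)) - (∫ v, gn v ∂(c s)) = ∫ v, (1 * g v + (-1) * gn v) ∂(c s) := by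
      intro s hs
      have a := (hR s hs).mono (show 3 ≤ 6 by norm_num) le_rfl
      rw [← integral_sub (hg.integrable a) (g1.integrable a)]
      congr 1; ext v; ring
    have b1 : ∀ s ∈ Icc τ T, |(∫ v, g v ∂(c s)) - (∫ v, gn v ∂(c s))| ≤ C * (1 / ((n:ℝ) + 1)) * R := by
      intro s hs
      rw [e1 s hs]
      exact g2.bound ((hR s hs).mono (by norm_num) le_rfl)
    have b2 : ∀ s ∈ Icc τ T, |QInt B g (c s) (c s) - QInt B gn (c s) (c s)| ≤ 4 * (C * (1 / ((n:ℝ) + 1))) * (R * R) := by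
      intro s hs
      have a := (hR s hs).mono (show 4 ≤ 6 by norm_num) le_rfl
      have a5 := (hR s hs).mono (show 5 ≤ 6 by norm_num) le_rfl
      have := QInt_lin hB hd hg g1 1 (-1) a a
      have e : QInt B g (c s) (c s) - QInt B gn (c s) (c s) = QInt B (fun v => 1 * g v + (-1) * gn v) (c s) (c s) := by
        rw [this]; ring
      rw [e]; exact QInt_bound hB hd g2 a5 a5
    have hint : ∀ f : Vd d → ℝ, Gr 3 C f → IntegrableOn (fun s => QInt B f (c s) (c s)) (Ioc τ t) := by
      intro f hf
      refine Measure.integrableOn_of_bounded (M := 4 * C * (R * R)) (by simp)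
        (QInt_meas hB hd hc.meas (fun a => (hc.mem a).1) hf.1).aestronglyMeasurable ?_
      refine (ae_restrict_iff' measurableSet_Ioc).2 (ae_of_all _ fun s hs => ?_)
      have a := (hR s ⟨hs.1.le, hs.2.trans ht.2⟩).mono (show 4 ≤ 6 by norm_num) le_rfl
      exact QInt_bound hB hd hf a a
    have b3 : |(∫ s in Ioc τ t, QInt B g (c s) (c s)) - ∫ s in Ioc τ t, QInt B gn (c s) (c s)| ≤
        4 * (C * (1 / ((n:ℝ) + 1))) * (R * R) * (t - τ) := by
      rw [← integral_sub (hint g hg) (hint gn g1)]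
      have := norm_setIntegral_le_of_norm_le_const (μ := volume) (s := Ioc τ t)
        (f := fun s => QInt B g (c s) (c s) - QInt B gn (c s) (c s)) (C := 4 * (C * (1 / ((n:ℝ) + 1))) * (R * R)) (by simp)
        (fun s hs => b2 s ⟨hs.1.le, hs.2.trans ht.2⟩)
      rwa [Real.volume_real_Ioc_of_le ht.1] at this
    have c1 := abs_le.1 (b1 t ht)
    have c2 := abs_le.1 (b1 τ hτ)
    have c3 := abs_le.1 b3
    rw [abs_le]; constructor <;> linarith [c1.1, c1.2, c2.1, c2.2, c3.1, c3.2]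
  have lim : Tendsto (fun n : ℕ => (2 * C * R + 4 * C * (R * R) * (t - τ)) * (1 / ((n:ℝ) + 1))) atTop (nhds 0) := by
    have := tendsto_one_div_add_atTop_nhds_zero_nat (𝕜 := ℝ)
    simpa using this.const_mul (2 * C * R + 4 * C * (R * R) * (t - τ))
  have := ge_of_tendsto' lim key
  have := abs_nonpos_iff.1 this
  linarith
end

/-- truncated cube -/
def psi (R x : ℝ) : ℝ := if x ≤ R then x ^ 3 else 3 * R ^ 2 * x - 2 * R ^ 3

lemma psi_meas (R : ℝ) : Measurable (psi R) := by
  unfold psi; exact Measurable.ite measurableSet_Iic (by fun_prop) (by fun_prop)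

lemma psi_facts {R x : ℝ} (hR : 0 ≤ R) (hx : 0 ≤ x) : 0 ≤ psi R x ∧ psi R x ≤ x ^ 3 ∧ psi R x ≤ 3 * R ^ 2 * x := by
  unfold psi
  split_ifs with h
  · refine ⟨by positivity, le_rfl, ?_⟩
    have : x ^ 2 ≤ R ^ 2 := pll hx h 2
    nlinarith [mul_nonneg hx (sq_nonneg R)]
  · push Not at h
    refine ⟨by nlinarith [mul_nonneg (sq_nonneg R) (sub_nonneg.2 h.le), pow_nonneg hR 3], ?_, by nlinarith [pow_nonneg hR 3]⟩
    have : 0 ≤ (x - R) ^ 2 * (x + 2 * R) := by positivity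
    nlinarith

lemma psi_super {R x y : ℝ} (hR : 0 ≤ R) (hx : 0 ≤ x) (hy : 0 ≤ y) : psi R x + psi R y ≤ psi R (x + y) := by
  obtain ⟨a1, a2, a3⟩ := psi_facts hR hx
  obtain ⟨b1, b2, b3⟩ := psi_facts hR hy
  have key : ∀ x y : ℝ, 0 ≤ x → 0 ≤ y → ¬ x ≤ R → psi R y ≤ 3 * R ^ 2 * y → psi R x + psi R y ≤ psi R (x + y) := by
    intro x y hx hy h h3
    push Not at h
    have e1 : psi R x = 3 * R ^ 2 * x - 2 * R ^ 3 := if_neg (by linarith)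
    have e2 : psi R (x + y) = 3 * R ^ 2 * (x + y) - 2 * R ^ 3 := if_neg (by linarith)
    rw [e1, e2]; linarith
  by_cases h1 : x ≤ R
  · by_cases h2 : y ≤ R
    · by_cases h3 : x + y ≤ R
      · have e : psi R (x + y) = (x + y) ^ 3 := if_pos h3
        rw [e]; nlinarith [mul_nonneg (mul_nonneg hx hy) (add_nonneg hx hy)]
      · have e : psi R (x + y) = 3 * R ^ 2 * (x + y) - 2 * R ^ 3 := if_neg h3
        push Not at h3
        have p1 : x ^ 3 ≤ R ^ 2 * x := by nlinarith [pll hx h1 2]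
        have p2 : y ^ 3 ≤ R ^ 2 * y := by nlinarith [pll hy h2 2]
        rw [e]; nlinarith [mul_nonneg (sq_nonneg R) (sub_nonneg.2 h3.le)]
    · rw [add_comm, add_comm x]; exact key y x hy hx h2 a3
  · exact key x y hx hy h1 b3

lemma psi_diff {R x y : ℝ} (hR : 0 ≤ R) (hy : 0 ≤ y) (hyx : y ≤ x) :
    x * (psi R (x + y) - psi R x) ≤ 12 * y * psi R x := by
  have hx := hy.trans hyx
  by_cases h1 : x ≤ R
  · have e1 : psi R x = x ^ 3 := if_pos h1
    have := (psi_facts hR (add_nonneg hx hy)).2.1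
    rw [e1]
    have h2 := mll this hx
    have h3 : 0 ≤ x * y * (x - y) := by have := sub_nonneg.2 hyx; positivity
    have h4 : 0 ≤ x ^ 2 * y * (x - y) := by have := sub_nonneg.2 hyx; positivity
    have h5 : 0 ≤ x * y ^ 2 * (x - y) := by have := sub_nonneg.2 hyx; positivity
    have h6 : 0 ≤ x ^ 3 * y := by positivity
    nlinarith
  · have e1 : psi R x = 3 * R ^ 2 * x - 2 * R ^ 3 := if_neg h1
    push Not at h1
    have e2 : psi R (x + y) = 3 * R ^ 2 * (x + y) - 2 * R ^ 3 := if_neg (by linarith)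
    rw [e1, e2]
    have : 0 ≤ R ^ 2 * y * (x - R) := by have := sub_nonneg.2 h1.le; positivity
    have : 0 ≤ R ^ 2 * y * x := by positivity
    nlinarith

lemma psi_coll {R : ℝ} (hR : 0 ≤ R) (v w : Vd d) :
    ‖v - w‖ * (psi R (‖v‖ ^ 2 + ‖w‖ ^ 2) - psi R (‖v‖ ^ 2) - psi R (‖w‖ ^ 2)) ≤
      24 * (‖w‖ * psi R (‖v‖ ^ 2) + ‖v‖ * psi R (‖w‖ ^ 2)) := by
  have key : ∀ v w : Vd d, ‖w‖ ≤ ‖v‖ → ‖v - w‖ * (psi R (‖v‖ ^ 2 + ‖w‖ ^ 2) - psi R (‖v‖ ^ 2) - psi R (‖w‖ ^ 2)) ≤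
      24 * (‖w‖ * psi R (‖v‖ ^ 2) + ‖v‖ * psi R (‖w‖ ^ 2)) := by
    intro v w h
    obtain ⟨a1, -, -⟩ := psi_facts hR (sq_nonneg ‖v‖)
    obtain ⟨b1, -, -⟩ := psi_facts hR (sq_nonneg ‖w‖)
    have hs := psi_super hR (sq_nonneg ‖v‖) (sq_nonneg ‖w‖)
    have hdf := psi_diff hR (sq_nonneg ‖w‖) (pll (norm_nonneg w) h 2)
    have hn := norm_sub_le v w
    rcases (norm_nonneg v).eq_or_lt with h0 | h0
    · have : ‖w‖ = 0 := le_antisymm (by linarith) (norm_nonneg w)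
      have : ‖v - w‖ = 0 := le_antisymm (by linarith) (norm_nonneg _)
      rw [this, zero_mul]; positivity
    · set D := psi R (‖v‖ ^ 2 + ‖w‖ ^ 2) - psi R (‖v‖ ^ 2) - psi R (‖w‖ ^ 2)
      have hD : 0 ≤ D := by linarith
      have h1 : ‖v - w‖ * D ≤ 2 * ‖v‖ * D := mlr (by linarith) hD
      have h2 : ‖v‖ * (2 * ‖v‖ * D) ≤ ‖v‖ * (24 * (‖w‖ * psi R (‖v‖ ^ 2))) := by
        have p1 : ‖v‖ ^ 2 * D ≤ 12 * ‖w‖ ^ 2 * psi R (‖v‖ ^ 2) := by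
          refine le_trans (mll ?_ (sq_nonneg ‖v‖)) hdf
          linarith
        have p2 : ‖w‖ * ‖w‖ * psi R (‖v‖ ^ 2) ≤ ‖v‖ * ‖w‖ * psi R (‖v‖ ^ 2) := by gcongr
        nlinarith
      have h3 := le_of_mul_le_mul_left h2 h0
      have h4 : 0 ≤ ‖v‖ * psi R (‖w‖ ^ 2) := by positivity
      linarith
  rcases le_total ‖w‖ ‖v‖ with h | h
  · exact key v w h
  · have := key w v h
    rw [norm_sub_rev w v, add_comm (‖w‖ ^ 2)] at this
    linarith

lemma gron {u q : ℝ → ℝ} {τ K : ℝ} (hq : Measurable q) (hK : ∀ s, |q s| ≤ K) (hu0 : ∀ t, 0 ≤ u t)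
    (hu : ∀ t, τ ≤ t → u t = u τ + ∫ s in Ioc τ t, q s) (hqu : ∀ s, q s ≤ 48 * u s) {t : ℝ} (ht : τ ≤ t) :
    u t ≤ u τ * exp (48 * (t - τ)) := by
  have hi : ∀ a b, IntervalIntegrable q volume a b := fun a b => by
    rw [intervalIntegrable_iff]
    exact Measure.integrableOn_of_bounded (M := K) (by simp) hq.aestronglyMeasurable (ae_of_all _ hK)
  set U : ℝ → ℝ := fun t => u τ + ∫ s in τ..t, q s with hU
  have hUc : Continuous U := continuous_const.add (intervalIntegral.continuous_primitive hi τ)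
  have hUu : ∀ t, τ ≤ t → U t = u t := fun t ht => by
    rw [hU, hu t ht, ← intervalIntegral.integral_of_le ht]
  set F : ℝ → ℝ := fun t => u τ + ∫ s in τ..t, 48 * U s with hF
  have hFd : ∀ t, HasDerivAt F (48 * U t) t := fun t => by
    have := (continuous_const.mul hUc : Continuous fun s => 48 * U s).integral_hasStrictDerivAt τ t
    exact this.hasDerivAt.const_add (u τ)
  have hUF : ∀ t, τ ≤ t → U t ≤ F t := fun t ht => by
    refine add_le_add_right (intervalIntegral.integral_mono_on ht (hi _ _)
      ((continuous_const.mul hUc).intervalIntegrable _ _) fun s hs => ?_) (u τ)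
    change q s ≤ 48 * U s
    rw [hUu s hs.1]; exact hqu s
  have hU0 : ∀ t, τ ≤ t → 0 ≤ U t := fun t ht => by rw [hUu t ht]; exact hu0 t
  have := norm_le_gronwallBound_of_norm_deriv_right_le (f := F) (f' := fun t => 48 * U t) (δ := u τ) (K := 48) (ε := 0)
    (a := τ) (b := t) (fun x _ => (hFd x).continuousAt.continuousWithinAt) (fun x _ => (hFd x).hasDerivWithinAt)
    (by simp [hF, abs_of_nonneg (hu0 τ)]) (fun x hx => by
      rw [Real.norm_of_nonneg (mul_nonneg (by norm_num) (hU0 x hx.1)), Real.norm_of_nonneg ((hU0 x hx.1).trans (hUF x hx.1)), add_zero]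
      have := hUF x hx.1
      linarith) t ⟨ht, le_rfl⟩
  rw [gronwallBound_ε0] at this
  rw [← hUu t ht]
  exact (hUF t ht).trans ((le_abs_self _).trans this)

section
variable {B : Vd d → Mv d} (hB : IsCollisionKernel B) (hd : 0 < d)
include hB hd

lemma Sol.psi_le {τ : ℝ} {c : ℝ → Mv d} (hc : Sol B τ c) {R : ℝ} (hR : 0 ≤ R) {t : ℝ} (ht : τ ≤ t) :
    Integrable (fun v => psi R (‖v‖ ^ 2)) (c t) ∧
    ∫ v, psi R (‖v‖ ^ 2) ∂(c t) ≤ (∫ v, psi R (‖v‖ ^ 2) ∂(c τ)) * exp (48 * (t - τ)) := by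
  set f : Vd d → ℝ := fun v => psi R (‖v‖ ^ 2) - 3 * R ^ 2 * ‖v‖ ^ 2 + 2 * R ^ 3 with hf
  have hpm : Measurable (fun v : Vd d => psi R (‖v‖ ^ 2)) := (psi_meas R).comp (by fun_prop)
  have hfm : Measurable f := by
    have : Measurable (fun v : Vd d => 3 * R ^ 2 * ‖v‖ ^ 2) := by fun_prop
    exact (hpm.sub this).add_const _
  have hfz : ∀ v : Vd d, ¬ ‖v‖ ^ 2 ≤ R → f v = 0 := fun v hv => by
    rw [hf]; simp only [psi, if_neg hv]; ring
  have hfb : ∀ v, |f v| ≤ 6 * R ^ 3 := fun v => by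
    by_cases hv : ‖v‖ ^ 2 ≤ R
    · obtain ⟨a, -, b⟩ := psi_facts hR (sq_nonneg ‖v‖)
      have p : R ^ 2 * ‖v‖ ^ 2 ≤ R ^ 2 * R := mll hv (sq_nonneg R)
      have p2 : 0 ≤ R ^ 2 * ‖v‖ ^ 2 := by positivity
      have p3 : 0 ≤ R ^ 3 := by positivity
      rw [abs_le, hf]; constructor <;> simp only <;> nlinarith
    · rw [hfz v hv, abs_zero]; positivity
  have hfc : HasCompactSupport f := by
    refine HasCompactSupport.of_support_subset_isCompact (isCompact_closedBall 0 (R + 1)) fun v hv => ?_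
    rw [Metric.mem_closedBall, dist_zero_right]
    by_contra h
    push Not at h
    exact hv (hfz v (by nlinarith))
  have hg : Gr 1 (6 * R ^ 3) f := (bdd_gr hfm hfb).mono (Nat.zero_le _) le_rfl
  have hpi : ∀ t, Integrable (fun v => psi R (‖v‖ ^ 2)) (c t) := fun t => by
    refine ((sphere_adm (hc.mem t)).1.const_mul (3 * R ^ 2)).mono' hpm.aestronglyMeasurable (ae_of_all _ fun v => ?_)
    obtain ⟨a, -, b⟩ := psi_facts hR (sq_nonneg ‖v‖)
    rw [Real.norm_of_nonneg a]; exact b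
  refine ⟨hpi t, ?_⟩
  have e1 : ∀ t, ∫ v, f v ∂(c t) = ∫ v, psi R (‖v‖ ^ 2) ∂(c t) - 3 * R ^ 2 + 2 * R ^ 3 := fun t => by
    have := (hc.mem t).1
    rw [hf, int_sub_add (hpi t) ((sphere_adm (hc.mem t)).1.const_mul _) (integrable_const _), integral_const_mul,
      (hc.mem t).2.2]
    simp
  have hq : ∀ v w, qB B f v w ≤ 24 * (‖w‖ * psi R (‖v‖ ^ 2) + ‖v‖ * psi R (‖w‖ ^ 2)) := fun v w => by
    refine le_trans ?_ (psi_coll hR v w)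
    rw [← B_int_const hB hd]
    have := B_fin hB hd (v - w)
    refine integral_mono_ae (dl_integrable hB hd hg v w _) (integrable_const _) ((B_sphere hB hd (v - w)).mono fun σ hσ => ?_)
    have s := post_sq v w σ hσ
    have := psi_super hR (sq_nonneg ‖postV v w σ‖) (sq_nonneg ‖postVs v w σ‖)
    rw [s] at this
    simp only [dl, hf]
    nlinarith
  have hQ : ∀ t, QInt B f (c t) (c t) ≤ 48 * ∫ v, psi R (‖v‖ ^ 2) ∂(c t) := fun t => by
    have ha := (sphere_adm (hc.mem t)).2
    have := ha.1
    obtain ⟨i1, i2⟩ := m1_le (hc.mem t)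
    rw [QInt_prod hB hd hg ha ha]
    have j1 := i1.mul_prod (hpi t)
    have j2 := (hpi t).mul_prod i1
    have j3 : Integrable (fun z : Vd d × Vd d => 24 * (‖z.2‖ * psi R (‖z.1‖ ^ 2) + ‖z.1‖ * psi R (‖z.2‖ ^ 2))) ((c t).prod (c t)) := by
      refine (Integrable.add ?_ j1).const_mul 24
      refine j2.congr (ae_of_all _ fun z => mul_comm _ _)
    refine (integral_mono (qB_integrable hB hd hg ha ha) j3 fun z => hq z.1 z.2).trans ?_
    rw [integral_const_mul, integral_add (j2.congr (ae_of_all _ fun z => mul_comm _ _)) j1]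
    have k1 := integral_prod_mul (μ := c t) (ν := c t) (fun v : Vd d => ‖v‖) (fun v : Vd d => psi R (‖v‖ ^ 2))
    have k2 := integral_prod_mul (μ := c t) (ν := c t) (fun v : Vd d => psi R (‖v‖ ^ 2)) (fun v : Vd d => ‖v‖)
    simp_rw [mul_comm ‖Prod.snd _‖]
    rw [k1, k2]
    have k3 : 0 ≤ ∫ v, psi R (‖v‖ ^ 2) ∂(c t) := integral_nonneg fun v => (psi_facts hR (sq_nonneg _)).1
    nlinarith
  refine gron (u := fun t => ∫ v, psi R (‖v‖ ^ 2) ∂(c t)) (q := fun s => QInt B f (c s) (c s))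
    (K := 4 * (6 * R ^ 3) * (4 * 4)) (QInt_meas hB hd hc.meas (fun a => (hc.mem a).1) hfm)
    (fun s => QInt_bound hB hd hg (sphere_adm (hc.mem s)).2 (sphere_adm (hc.mem s)).2)
    (fun t => integral_nonneg fun v => (psi_facts hR (sq_nonneg _)).1) (fun t ht => ?_) hQ ht
  have := hc.weak f hfm ⟨_, hfb⟩ hfc t ht
  rw [e1, e1] at this
  linarith

lemma Sol.adm {τ T R : ℝ} {c : ℝ → Mv d} (hc : Sol B τ c) (hR : Adm (c τ) 6 R) {t : ℝ} (ht : t ∈ Icc τ T) :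
    Adm (c t) 6 (32 * (1 + R * exp (48 * (T - τ)))) := by
  have hp := (hc.mem t).1
  have hR1 := hR.one_le
  have i0 : Integrable (fun v : Vd d => (‖v‖ ^ 2) ^ 3) (c τ) := by
    refine hR.2.1.mono' (by fun_prop) (ae_of_all _ fun v => ?_)
    rw [Real.norm_of_nonneg (by positivity), ← pow_mul]
    exact pll (norm_nonneg v) (norm_le_pw v) _
  have h0 : ∫ v, (‖v‖ ^ 2) ^ 3 ∂(c τ) ≤ R := (integral_mono i0 hR.2.1 fun v => by
    simp only [← pow_mul]; exact pll (norm_nonneg v) (norm_le_pw v) _).trans hR.2.2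
  have hE : exp (48 * (t - τ)) ≤ exp (48 * (T - τ)) := Real.exp_le_exp.2 (by linarith [ht.2])
  obtain ⟨j1, j2⟩ := of_ev (μ := c t) (f := fun n : ℕ => fun v : Vd d => psi n (‖v‖ ^ 2)) (g := fun v => (‖v‖ ^ 2) ^ 3)
    (K := R * exp (48 * (T - τ))) (by positivity) (by fun_prop)
    (fun n v => (psi_facts (Nat.cast_nonneg n) (sq_nonneg _)).1)
    (fun n => (hc.psi_le hB hd (Nat.cast_nonneg n) ht.1).1) (fun n => by
      refine (hc.psi_le hB hd (Nat.cast_nonneg n) ht.1).2.trans ?_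
      refine mul_le_mul ?_ hE (Real.exp_pos _).le (by linarith)
      exact (integral_mono (hc.psi_le hB hd (Nat.cast_nonneg n) le_rfl).1 i0 fun v =>
        (psi_facts (Nat.cast_nonneg n) (sq_nonneg _)).2.1).trans h0)
    (fun v => by
      filter_upwards [eventually_ge_atTop ⌈‖v‖ ^ 2⌉₊] with n hn
      exact if_pos (Nat.ceil_le.1 hn))
  have b : ∀ v : Vd d, pw v ^ 6 ≤ 32 * (1 + (‖v‖ ^ 2) ^ 3) := fun v => by
    have := add_pow_le zero_le_one (norm_nonneg v) 6
    rw [← pow_mul]; unfold pw; norm_num at this ⊢; linarith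
  have j3 : Integrable (fun v : Vd d => 32 * (1 + (‖v‖ ^ 2) ^ 3)) (c t) := ((integrable_const _).add j1).const_mul _
  have j4 : Integrable (fun v : Vd d => pw v ^ 6) (c t) := by
    refine j3.mono' (pw_meas.pow_const 6).aestronglyMeasurable (ae_of_all _ fun v => ?_)
    rw [Real.norm_of_nonneg (pow_nonneg (pw_pos v).le _)]; exact b v
  refine ⟨hp, j4, (integral_mono j4 j3 b).trans ?_⟩
  rw [integral_const_mul, integral_add (integrable_const _) j1]
  simp only [integral_const, probReal_univ, smul_eq_mul, mul_one]
  linarith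
end

/-- drift-compensated functional -/
def Mg (B : Vd d → Mv d) (a : ℝ → Mv d) (τ : ℝ) (g : Vf d) (t : ℝ) : ℝ :=
  ∫ v, g v ∂(a t) - ∫ v, g v ∂(a τ) - ∫ s in Ioc τ t, QInt B g (a s) (a s)

/-- difference of collision terms -/
def DQ (B : Vd d → Mv d) (a c : ℝ → Mv d) (g : Vf d) (s : ℝ) : ℝ :=
  QInt B g (a s) (a s) - QInt B g (c s) (c s)

/-- integrated difference -/
def eta (B : Vd d → Mv d) (a c : ℝ → Mv d) (τ : ℝ) (g : Vf d) (t : ℝ) : ℝ :=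
  ∫ s in Ioc τ t, DQ B a c g s

/-- pair of flows with moments -/
structure Pair (a c : ℝ → Mv d) (τ T R : ℝ) : Prop where
  ma : Measurable a
  mc : Measurable c
  pa : ∀ t, IsProbabilityMeasure (a t)
  pc : ∀ t, IsProbabilityMeasure (c t)
  aR : ∀ t ∈ Icc τ T, Adm (a t) 6 R
  cR : ∀ t ∈ Icc τ T, Adm (c t) 6 R

lemma Ft.smul (h : Ft C f) {k : ℝ} (hk : 0 ≤ k) : Ft (k * C) (fun v => k * f v) :=
  ⟨fun v => by rw [abs_mul, abs_of_nonneg hk, mul_assoc]; exact mll (h.1 v) hk,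
   fun v w => by
    rw [← mul_sub, abs_mul, abs_of_nonneg hk, mul_assoc]; exact mll (h.2 v w) hk⟩

lemma Ft.add {C D : ℝ} {f g : Vf d} (h : Ft C f) (h' : Ft D g) : Ft (C + D) (fun v => f v + g v) :=
  ⟨fun v => (abs_add_le _ _).trans (by rw [add_mul]; exact add_le_add (h.1 v) (h'.1 v)),
   fun v w => by
    rw [add_sub_add_comm, add_mul]; exact (abs_add_le _ _).trans (add_le_add (h.2 v w) (h'.2 v w))⟩

lemma Lp.add {C D : ℝ} {f g : Vf d} (h : Lp C f) (h' : Lp D g) : Lp (C + D) (fun v => f v + g v) :=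
  ⟨fun v => (abs_add_le _ _).trans (by rw [add_mul]; exact add_le_add (h.1 v) (h'.1 v)),
   fun v w => by
    rw [add_sub_add_comm, add_mul]; exact (abs_add_le _ _).trans (add_le_add (h.2 v w) (h'.2 v w))⟩

lemma Ft.lp (h : Ft 1 f) : Lp 1 f := by
  refine ⟨fun v => (h.1 v).trans (mll ((sq_le_pw v).trans (pw_pow_mono v (by norm_num))) zero_le_one),
    fun v w => (h.2 v w).trans (mll (mll ?_ (norm_nonneg _)) zero_le_one)⟩
  have h1 := (sq_le_pw v).trans (pw_pow_mono v (show 2 ≤ 3 by norm_num))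
  have h2 := (sq_le_pw w).trans (pw_pow_mono w (show 2 ≤ 3 by norm_num))
  have := mul_le_mul h1 h2 (by positivity) (pow_nonneg (pw_pos v).le _)
  nlinarith [mul_nonneg (sq_nonneg ‖v‖) (sq_nonneg ‖w‖)]

lemma testF_Ft (h : f ∈ testF d) : Ft 2 f := by
  obtain ⟨h1, h2⟩ := h
  have p : ∀ v : Vd d, 0 < 1 + ‖v‖ ^ 2 := fun v => by positivity
  have e : ∀ v, f v = f v / (1 + ‖v‖ ^ 2) * (1 + ‖v‖ ^ 2) := fun v => by field_simp [(p v).ne']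
  constructor
  · intro v
    rw [e v, abs_mul, abs_of_pos (p v)]
    exact mlr ((h1 v).trans (by norm_num)) (p v).le
  · intro v w
    rw [e v, e w]
    have a1 := h2 v w
    have a2 := h1 w
    set x := f v / (1 + ‖v‖ ^ 2)
    set y := f w / (1 + ‖w‖ ^ 2)
    have e2 : x * (1 + ‖v‖ ^ 2) - y * (1 + ‖w‖ ^ 2) = (x - y) * (1 + ‖v‖ ^ 2) + y * ((‖v‖ - ‖w‖) * (‖v‖ + ‖w‖)) := by ring
    rw [e2]
    refine (abs_add_le _ _).trans ?_
    rw [abs_mul, abs_mul, abs_mul, abs_of_pos (p v), abs_of_nonneg (by positivity : 0 ≤ ‖v‖ + ‖w‖)]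
    have b1 := mlr a1 (p v).le
    have b2 : |y| * (|‖v‖ - ‖w‖| * (‖v‖ + ‖w‖)) ≤ 1 * (‖v - w‖ * (‖v‖ + ‖w‖)) :=
      mul_le_mul a2 (mlr (abs_norm_sub_norm_le v w) (by positivity)) (by positivity) zero_le_one
    have b3 : ‖v‖ + ‖w‖ ≤ 1 + ‖v‖ ^ 2 + 2 * ‖w‖ ^ 2 := by nlinarith [sq_nonneg (‖v‖ - 1), sq_nonneg (‖w‖ - 1)]
    have b4 := mll b3 (norm_nonneg (v - w))
    nlinarith

section
variable {B : Vd d → Mv d} (hB : IsCollisionKernel B) (hd : 0 < d)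
  {a c : ℝ → Mv d} {τ T R : ℝ}
include hB hd

lemma DQ_bound (hp : Pair a c τ T R) (hk : k ≤ 5) {g : Vf d} (hg : Gr k C g) {s : ℝ} (hs : s ∈ Icc τ T) :
    |DQ B a c g s| ≤ 8 * C * (R * R) := by
  have a1 := (hp.aR s hs).mono (show k + 1 ≤ 6 by omega) le_rfl
  have c1 := (hp.cR s hs).mono (show k + 1 ≤ 6 by omega) le_rfl
  have h1 := abs_le.1 (QInt_bound hB hd hg a1 a1)
  have h2 := abs_le.1 (QInt_bound hB hd hg c1 c1)
  unfold DQ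
  rw [abs_le]; constructor <;> linarith [h1.1, h1.2, h2.1, h2.2]

lemma DQ_meas (hp : Pair a c τ T R) {g : Vf d} (hg : Measurable g) : Measurable (DQ B a c g) :=
  (QInt_meas hB hd hp.ma hp.pa hg).sub (QInt_meas hB hd hp.mc hp.pc hg)

lemma DQ_intOn (hp : Pair a c τ T R) (hk : k ≤ 5) {g : Vf d} (hg : Gr k C g) {s t : ℝ}
    (hs : τ ≤ s) (ht : t ≤ T) : IntegrableOn (DQ B a c g) (Ioc s t) := by
  refine Measure.integrableOn_of_bounded (M := 8 * C * (R * R)) (by simp)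
    (DQ_meas hB hd hp hg.1).aestronglyMeasurable ?_
  refine (ae_restrict_iff' measurableSet_Ioc).2 (ae_of_all _ fun r hr => ?_)
  exact DQ_bound hB hd hp hk hg ⟨hs.trans hr.1.le, hr.2.trans ht⟩

lemma DQ_lin (hp : Pair a c τ T R) (hk : k ≤ 5) {C D : ℝ} {f g : Vf d} (hf : Gr k C f) (hg : Gr k D g)
    (x y : ℝ) {s : ℝ} (hs : s ∈ Icc τ T) :
    DQ B a c (fun v => x * f v + y * g v) s = x * DQ B a c f s + y * DQ B a c g s := by
  have a1 := (hp.aR s hs).mono (show k + 1 ≤ 6 by omega) le_rfl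
  have c1 := (hp.cR s hs).mono (show k + 1 ≤ 6 by omega) le_rfl
  unfold DQ
  rw [QInt_lin hB hd hf hg x y a1 a1, QInt_lin hB hd hf hg x y c1 c1]; ring

lemma eta_lin (hp : Pair a c τ T R) (hk : k ≤ 5) {C D : ℝ} {f g : Vf d} (hf : Gr k C f) (hg : Gr k D g)
    (x y : ℝ) {t : ℝ} (ht : t ∈ Icc τ T) :
    eta B a c τ (fun v => x * f v + y * g v) t = x * eta B a c τ f t + y * eta B a c τ g t := by
  unfold eta
  rw [← integral_const_mul, ← integral_const_mul, ← integral_add ((DQ_intOn hB hd hp hk hf le_rfl ht.2).const_mul x)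
    ((DQ_intOn hB hd hp hk hg le_rfl ht.2).const_mul y)]
  exact setIntegral_congr_fun measurableSet_Ioc fun s hs => DQ_lin hB hd hp hk hf hg x y ⟨hs.1.le, hs.2.trans ht.2⟩

lemma eta_bound (hp : Pair a c τ T R) (hk : k ≤ 5) {g : Vf d} (hg : Gr k C g) {t : ℝ} (ht : t ∈ Icc τ T) :
    |eta B a c τ g t| ≤ 8 * C * (R * R) * (T - τ) := by
  have := norm_setIntegral_le_of_norm_le_const (μ := volume) (s := Ioc τ t)
    (f := DQ B a c g) (C := 8 * C * (R * R)) (by simp) (fun s hs => DQ_bound hB hd hp hk hg ⟨hs.1.le, hs.2.trans ht.2⟩)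
  rw [Real.volume_real_Ioc_of_le ht.1] at this
  have hC := hg.nonneg
  exact this.trans (mll (by linarith [ht.2]) (by have := mul_self_nonneg R; positivity))

lemma eta_sub (hp : Pair a c τ T R) (hk : k ≤ 5) {g : Vf d} (hg : Gr k C g) {s t : ℝ} (hs : τ ≤ s)
    (hst : s ≤ t) (ht : t ≤ T) : eta B a c τ g t = eta B a c τ g s + ∫ r in Ioc s t, DQ B a c g r := by
  unfold eta
  rw [← Set.Ioc_union_Ioc_eq_Ioc hs hst, setIntegral_union (Set.Ioc_disjoint_Ioc_of_le le_rfl) measurableSet_Ioc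
    (DQ_intOn hB hd hp hk hg le_rfl (hst.trans ht)) (DQ_intOn hB hd hp hk hg hs ht)]

lemma DQ_L {κ : ℝ} (hL : IsLipschitzKernel B κ) (hp : Pair a c τ T R) (hf : Ft 1 f) {r : ℝ} (hr : r ∈ Icc τ T) :
    DQ B a c f r = ∫ v, (Lop B f (a r) v + Lop B f (c r) v) ∂(a r) - ∫ v, (Lop B f (a r) v + Lop B f (c r) v) ∂(c r) := by
  have a3 := (hp.aR r hr).mono (show 3 ≤ 6 by norm_num) le_rfl
  have c3 := (hp.cR r hr).mono (show 3 ≤ 6 by norm_num) le_rfl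
  have la := (L_Lp hB hd hL hf a3).gr
  have lc := (L_Lp hB hd hL hf c3).gr
  rw [integral_add (la.integrable a3) (lc.integrable a3), integral_add (la.integrable c3) (lc.integrable c3)]
  have := QInt_symm hB hd (hf.gr zero_le_one) a3 c3
  simp only [QInt_eq, DQ, Lop] at this ⊢
  linarith

lemma eta_step {κ δ : ℝ} (hL : IsLipschitzKernel B κ) (hp : Pair a c τ T R)
    (hid : ∀ g C, Gr 3 C g → ∀ t ∈ Icc τ T, ∫ v, g v ∂(a t) - ∫ v, g v ∂(c t) = Mg B a τ g t + eta B a c τ g t)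
    (hM : ∀ g C, Lp C g → ∀ t ∈ Icc τ T, |Mg B a τ g t| ≤ C * δ) {s h D : ℝ} (hs : τ ≤ s) (hh : 0 < h)
    (hsh : s + h ≤ T) (hh1 : 2 * h * R ≤ 1) (ih : ∀ f, Ft 1 f → eta B a c τ f s ≤ D) (hf : Ft 1 f) :
    eta B a c τ f (s + h) ≤ (1 + 80 * κ * R * h) * D +
      h * (400 * κ * R ^ 4 * (1 + (T - τ)) * h + 24 * κ * R * δ) := by
  have hκ : 1 ≤ κ := hL.1
  have hsT : s ∈ Icc τ T := ⟨hs, by linarith⟩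
  have hR1 := (hp.aR s hsT).one_le
  have key : ∀ r ∈ Ioc s (s + h), DQ B a c f r ≤ ((1 + 80 * κ * R * h) * D - eta B a c τ f s) / h +
      (400 * κ * R ^ 4 * (1 + (T - τ)) * h + 24 * κ * R * δ) := by
    intro r hr
    have hrT : r ∈ Icc τ T := ⟨hs.trans hr.1.le, hr.2.trans hsh⟩
    have a3 := (hp.aR r hrT).mono (show 3 ≤ 6 by norm_num) le_rfl
    have c3 := (hp.cR r hrT).mono (show 3 ≤ 6 by norm_num) le_rfl
    set g : Vd d → ℝ := fun v => Lop B f (a r) v + Lop B f (c r) v with hg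
    have gL : Lp (24 * κ * R) g := by
      have := (L_Lp hB hd hL hf a3).add (L_Lp hB hd hL hf c3)
      convert this using 1; ring
    have gG := gL.gr
    have e1 : DQ B a c f r = Mg B a τ g r + eta B a c τ g r := by
      rw [DQ_L hB hd hL hp hf hrT, ← hid g _ gG r hrT]
    have e2 := eta_sub hB hd hp (by norm_num) gG hs hr.1.le hrT.2
    have b1 := (le_abs_self _).trans (hM g _ gL r hrT)
    have b2 : ∫ x in Ioc s r, DQ B a c g x ≤ 8 * (24 * κ * R) * (R * R) * h := by
      have := norm_setIntegral_le_of_norm_le_const (μ := volume) (s := Ioc s r)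
        (f := DQ B a c g) (C := 8 * (24 * κ * R) * (R * R)) (by simp)
        (fun x hx => DQ_bound hB hd hp (by norm_num) gG ⟨hs.trans hx.1.le, hx.2.trans hrT.2⟩)
      rw [Real.volume_real_Ioc_of_le hr.1.le] at this
      refine (le_abs_self _).trans (this.trans (mll (by linarith [hr.2]) (by positivity)))
    set q := 2 * h * R with hq
    have q0 : 0 < q := by positivity
    have cm : Measurable (chi q : Vf d) := by unfold chi; fun_prop
    have c0 : ∀ v : Vd d, 0 < 1 + q * ‖v‖ := fun v => by positivity
    have c1 : ∀ v : Vd d, 0 ≤ chi q v := fun v => by unfold chi; have := c0 v; positivity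
    have c2 : ∀ v : Vd d, chi q v ≤ 1 := fun v => by
      unfold chi; rw [div_le_one (c0 v)]; nlinarith [norm_nonneg v]
    have c4 : ∀ v : Vd d, 1 - chi q v ≤ q * pw v := fun v => by
      have : 1 - chi q v = q * ‖v‖ * chi q v := by unfold chi; have := (c0 v).ne'; field_simp; ring
      rw [this]
      calc _ ≤ q * ‖v‖ * 1 := mll (c2 v) (by positivity)
        _ ≤ _ := by rw [mul_one]; exact mll (norm_le_pw v) q0.le
    have g1 : Gr 3 (24 * κ * R) (fun v => chi q v * g v) := ⟨cm.mul gL.meas, fun v => by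
      rw [abs_mul, abs_of_nonneg (c1 v)]
      exact (mul_le_of_le_one_left (abs_nonneg _) (c2 v)).trans (gL.1 v)⟩
    have g2 : Gr 4 (q * (24 * κ * R)) (fun v => (1 - chi q v) * g v) := ⟨(measurable_const.sub cm).mul gL.meas, fun v => by
      rw [abs_mul, abs_of_nonneg (by linarith [c2 v])]
      calc _ ≤ (q * pw v) * (24 * κ * R * pw v ^ 3) := mul_le_mul (c4 v) (gL.1 v) (abs_nonneg _)
            (mul_nonneg q0.le (pw_pos v).le)
        _ = _ := by ring⟩
    have e3 : eta B a c τ g s = eta B a c τ (fun v => chi q v * g v) s + eta B a c τ (fun v => (1 - chi q v) * g v) s := by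
      have := eta_lin hB hd hp (by norm_num) (g1.mono (show 3 ≤ 4 by norm_num) le_rfl) g2 1 1 hsT
      rw [one_mul, one_mul] at this
      rw [← this]; congr 1; ext v; ring
    have b3 := (le_abs_self _).trans (eta_bound hB hd hp (by norm_num) g2 hsT)
    have F1 := F_step hB hd hL hf a3 (h := 2 * h) (by linarith) hh1
    have F2 := F_step hB hd hL hf c3 (h := 2 * h) (by linarith) hh1
    have F3 := (F1.smul (k := 2⁻¹) (by norm_num)).add (F2.smul (k := 2⁻¹) (by norm_num))
    have A0 : 0 < 1 + 80 * κ * R * h := by positivity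
    have F4 := F3.smul (k := (1 + 80 * κ * R * h)⁻¹) (by positivity)
    have e4 : (1 + 80 * κ * R * h)⁻¹ * (2⁻¹ * (1 + 40 * κ * R * (2 * h)) + 2⁻¹ * (1 + 40 * κ * R * (2 * h))) = 1 := by
      field_simp; ring
    rw [e4] at F4
    have b4 := ih _ F4
    have e5 : (fun v => (1 + 80 * κ * R * h)⁻¹ * (2⁻¹ * (f v + 2 * h * (chi (2 * h * R) v * Lop B f (a r) v)) +
        2⁻¹ * (f v + 2 * h * (chi (2 * h * R) v * Lop B f (c r) v)))) =
        fun v => (1 + 80 * κ * R * h)⁻¹ * f v + ((1 + 80 * κ * R * h)⁻¹ * h) * (chi q v * g v) := by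
      ext v; rw [hg, hq]; ring
    rw [e5, eta_lin hB hd hp (by norm_num) ((hf.gr zero_le_one).mono (show 2 ≤ 3 by norm_num) le_rfl) g1 _ _ hsT,
      mul_assoc (1 + 80 * κ * R * h)⁻¹ h, ← mul_add, inv_mul_le_iff₀ A0] at b4
    have b5 : eta B a c τ (fun v => chi q v * g v) s ≤ ((1 + 80 * κ * R * h) * D - eta B a c τ f s) / h := by
      rw [le_div_iff₀ hh]; linarith
    have hTτ : 0 ≤ T - τ := by linarith [hsT.1, hsT.2]
    have b6 : 8 * (24 * κ * R) * (R * R) * h + 8 * (q * (24 * κ * R)) * (R * R) * (T - τ) ≤ 400 * κ * R ^ 4 * (1 + (T - τ)) * h := by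
      have p1 : 0 ≤ κ * R ^ 3 * h * (R - 1) := mul_nonneg (by positivity) (by linarith)
      have p2 : 0 ≤ κ * R ^ 4 * h * (T - τ) := by positivity
      have p3 : 0 ≤ κ * R ^ 3 * h := by positivity
      rw [hq]; nlinarith
    linarith
  rw [eta_sub hB hd hp (by norm_num) (hf.gr zero_le_one) hs (by linarith : s ≤ s + h) hsh]
  have := setIntegral_mono_on (DQ_intOn hB hd hp (by norm_num) (hf.gr zero_le_one) hs hsh) (integrableOn_const (by simp))
    measurableSet_Ioc key
  rw [setIntegral_const, Real.volume_real_Ioc_of_le (by linarith), smul_eq_mul, add_sub_cancel_left, mul_add,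
    mul_div_cancel₀ _ hh.ne'] at this
  linarith

lemma pathwise {κ δ : ℝ} (hL : IsLipschitzKernel B κ) (hp : Pair a c τ T R) (h0 : a τ = c τ)
    (hw : ∀ g C, Gr 3 C g → ∀ t ∈ Icc τ T, (∫ v, g v ∂(c t)) = (∫ v, g v ∂(c τ)) + ∫ s in Ioc τ t, QInt B g (c s) (c s))
    (hM : ∀ g C, Lp C g → ∀ t ∈ Icc τ T, |Mg B a τ g t| ≤ C * δ) {t : ℝ} (ht : t ∈ Icc τ T) :
    Wdist (a t) (c t) ≤ 2 * (exp (80 * κ * R * (T - τ)) * (T - τ) * (24 * κ * R) + 1) * δ := by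
  have hκ : 1 ≤ κ := hL.1
  have hR1 := (hp.aR t ht).one_le
  have hTτ : 0 ≤ T - τ := by linarith [ht.1, ht.2]
  have hid : ∀ g C, Gr 3 C g → ∀ t ∈ Icc τ T, ∫ v, g v ∂(a t) - ∫ v, g v ∂(c t) = Mg B a τ g t + eta B a c τ g t := by
    intro g C hg t ht
    have i : ∀ b : ℝ → Mv d, Measurable b → (∀ t, IsProbabilityMeasure (b t)) → (∀ t ∈ Icc τ T, Adm (b t) 6 R) →
        IntegrableOn (fun s => QInt B g (b s) (b s)) (Ioc τ t) := by
      intro b mb pb hb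
      refine Measure.integrableOn_of_bounded (M := 4 * C * (R * R)) (by simp)
        (QInt_meas hB hd mb pb hg.1).aestronglyMeasurable ?_
      refine (ae_restrict_iff' measurableSet_Ioc).2 (ae_of_all _ fun r hr => ?_)
      have := (hb r ⟨hr.1.le, hr.2.trans ht.2⟩).mono (show 4 ≤ 6 by norm_num) le_rfl
      exact QInt_bound hB hd hg this this
    unfold Mg eta DQ
    rw [integral_sub (i a hp.ma hp.pa hp.aR) (i c hp.mc hp.pc hp.cR), hw g C hg t ht, h0]; ring
  have δ0 : 0 ≤ δ := by
    have := (abs_nonneg _).trans (hM (fun _ => 0) 1 ⟨fun v => by simp; have := pw_pos v; positivity, fun v w => by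
      simp; have := pw_pos v; have := pw_pos w; positivity⟩ t ht)
    linarith
  have main : ∀ f, Ft 1 f → eta B a c τ f t ≤ exp (80 * κ * R * (T - τ)) * (T - τ) * (24 * κ * R) * δ := by
    intro f hf
    rcases ht.1.eq_or_lt with h1 | h1
    · have : eta B a c τ f t = 0 := by unfold eta; rw [← h1]; simp
      rw [this]; positivity
    have lim : Tendsto (fun n : ℕ => exp (80 * κ * R * (T - τ)) * (T - τ) *
        (400 * κ * R ^ 4 * (1 + (T - τ)) * ((t - τ) / n) + 24 * κ * R * δ)) atTop
        (nhds (exp (80 * κ * R * (T - τ)) * (T - τ) * (400 * κ * R ^ 4 * (1 + (T - τ)) * 0 + 24 * κ * R * δ))) :=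
      ((tendsto_const_div_atTop_nhds_zero_nat (t - τ)).const_mul _ |>.add_const _).const_mul _
    have ev : ∀ᶠ n : ℕ in atTop, eta B a c τ f t ≤ exp (80 * κ * R * (T - τ)) * (T - τ) *
        (400 * κ * R ^ 4 * (1 + (T - τ)) * ((t - τ) / n) + 24 * κ * R * δ) := by
      have e0 : ∀ᶠ n : ℕ in atTop, 2 * ((t - τ) / n) * R ≤ 1 := by
        have : Tendsto (fun n : ℕ => 2 * ((t - τ) / (n:ℝ)) * R) atTop (nhds (2 * 0 * R)) :=
          ((tendsto_const_div_atTop_nhds_zero_nat (t - τ)).const_mul 2).mul_const R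
        exact (this.eventually_lt_const (by norm_num : 2 * 0 * R < 1)).mono fun n hn => hn.le
      filter_upwards [e0, eventually_gt_atTop 0] with n hn hn0
      have hn0' : (0:ℝ) < n := by exact_mod_cast hn0
      set h := (t - τ) / n with hh
      have hpos : 0 < h := div_pos (by linarith) hn0'
      have hnh : n * h = t - τ := by rw [hh]; field_simp
      set X := 400 * κ * R ^ 4 * (1 + (T - τ)) * h + 24 * κ * R * δ with hX
      have X0 : 0 ≤ X := by positivity
      set A := 80 * κ * R with hA
      have A0 : 0 ≤ A := by positivity
      have ind : ∀ k : ℕ, k ≤ n → ∀ f, Ft 1 f → eta B a c τ f (τ + k * h) ≤ exp (A * (k * h)) * (k * h) * X := by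
        intro k
        induction k with
        | zero => intro _ f _; unfold eta; simp
        | succ k ih =>
          intro hk f hf
          have hk' : ((k:ℝ) + 1) ≤ n := by exact_mod_cast hk
          have hkn : (k + 1) * h ≤ n * h := mlr hk' hpos.le
          have := eta_step hB hd hL hp hid hM (s := τ + k * h) (h := h) (by have : 0 ≤ k * h := by positivity
                                                                            linarith) hpos
            (by linarith [ht.2]) hn (ih (by omega)) hf
          have e : τ + ((k + 1 : ℕ) : ℝ) * h = τ + k * h + h := by push_cast; ring
          rw [e]
          refine this.trans ?_
          have x1 : 1 + A * h ≤ exp (A * h) := by linarith [Real.add_one_le_exp (A * h)]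
          have x2 : exp (A * (((k + 1 : ℕ) : ℝ) * h)) = exp (A * h) * exp (A * (k * h)) := by
            rw [← Real.exp_add]; congr 1; push_cast; ring
          have x3 : 1 ≤ exp (A * (((k + 1 : ℕ) : ℝ) * h)) := Real.one_le_exp (by positivity)
          have x4 : (1 + A * h) * (exp (A * (k * h)) * (k * h) * X) ≤ exp (A * h) * (exp (A * (k * h)) * (k * h) * X) :=
            mlr x1 (by positivity)
          have x5 : h * X ≤ exp (A * (((k + 1 : ℕ) : ℝ) * h)) * (h * X) := le_mul_of_one_le_left (by positivity) x3
          have x6 : exp (A * (((k + 1 : ℕ) : ℝ) * h)) * (((k + 1 : ℕ) : ℝ) * h) * X =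
            exp (A * h) * (exp (A * (k * h)) * (k * h) * X) + exp (A * (((k + 1 : ℕ) : ℝ) * h)) * (h * X) := by
            rw [x2]; push_cast; ring
          rw [x6]; exact add_le_add x4 x5
      have := ind n le_rfl f hf
      rw [hnh, add_sub_cancel] at this
      refine this.trans (mlr ?_ X0)
      have ht2 := ht.2
      exact mul_le_mul (Real.exp_le_exp.2 (mll (by linarith) A0)) (by linarith) (by linarith) (Real.exp_pos _).le
    have := ge_of_tendsto lim ev
    refine this.trans_eq ?_
    ring
  have : Nonempty (testF d) := ⟨⟨fun _ => 0, by simp [testF]⟩⟩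
  refine ciSup_le fun ⟨f, hf⟩ => ?_
  have h2 := (testF_Ft hf).smul (k := 2⁻¹) (by norm_num)
  norm_num at h2
  have h3 := main _ h2
  have h4 := hid _ _ ((h2.gr zero_le_one).mono (show 2 ≤ 3 by norm_num) le_rfl) t ht
  have h5 := (le_abs_self _).trans (hM _ _ h2.lp t ht)
  rw [integral_const_mul, integral_const_mul] at h4
  change ∫ v, f v ∂(a t) - ∫ v, f v ∂(c t) ≤ _
  linarith
end

lemma emp_rep {N : ℕ} {μ : Mv d} (h : μ ∈ empiricalSphere d N) :
    0 < N ∧ ∃ x : Fin N → Vd d, μ = (N : ℝ≥0∞)⁻¹ • ∑ i, Measure.dirac (x i) ∧ ∀ i, ‖x i‖ ≤ √N := by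
  obtain ⟨⟨h1, _, h3⟩, x, hx⟩ := h
  have hN : 0 < N := by
    rcases Nat.eq_zero_or_pos N with rfl | h
    · exact absurd (by simp [hx] : μ = 0) (IsProbabilityMeasure.ne_zero μ)
    · exact h
  refine ⟨hN, x, hx, fun i => ?_⟩
  rw [hx, integral_smul_measure, integral_finsetSum_measure
    (fun i _ => integrable_dirac (by simp)), ENNReal.toReal_inv, ENNReal.toReal_natCast, smul_eq_mul] at h3
  simp only [integral_dirac] at h3
  have hN' : (0:ℝ) < N := by exact_mod_cast hN
  rw [inv_mul_eq_iff_eq_mul₀ hN'.ne', mul_one] at h3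
  refine Real.le_sqrt_of_sq_le ?_
  rw [← h3]
  exact Finset.single_le_sum (f := fun i => ‖x i‖ ^ 2) (fun j _ => sq_nonneg _) (Finset.mem_univ i)

lemma ae_emp {N : ℕ} (c : ℝ≥0∞) (x : Fin N → Vd d) : ∀ᵐ v ∂(c • ∑ i, Measure.dirac (x i)), v ∈ Set.range x := by
  refine Measure.ae_smul_measure ?_ c
  rw [ae_iff, Measure.finsetSum_apply]
  refine Finset.sum_eq_zero fun i _ => ?_
  have hm : MeasurableSet {v | v ∉ Set.range x} := (Set.finite_range x).measurableSet.compl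
  rw [Measure.dirac_apply' _ hm]
  simp

lemma emp_ball {N : ℕ} {μ : Mv d} (h : μ ∈ empiricalSphere d N) : ∀ᵐ v ∂μ, ‖v‖ ≤ √N := by
  obtain ⟨_, x, hx, hb⟩ := emp_rep h
  rw [hx]
  refine (ae_emp _ x).mono fun v hv => ?_
  obtain ⟨i, rfl⟩ := hv; exact hb i

lemma emp_adm {N : ℕ} {μ : Mv d} (h : μ ∈ empiricalSphere d N) (k : ℕ) : Adm μ k ((1 + √N) ^ k) := by
  have := h.1.1
  have b : ∀ᵐ v ∂μ, ‖pw v ^ k‖ ≤ (1 + √N) ^ k := (emp_ball h).mono fun v hv => by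
    rw [Real.norm_of_nonneg (pow_nonneg (pw_pos v).le _)]
    exact pll (pw_pos v).le (by unfold pw; linarith) _
  have i : Integrable (fun v => pw v ^ k) μ := Integrable.of_bound (pw_meas.pow_const k).aestronglyMeasurable _ b
  refine ⟨this, i, ?_⟩
  have := norm_integral_le_of_norm_le_const b
  simp only [probReal_univ, mul_one] at this
  exact (le_abs_self _).trans this

lemma coll_int {N : ℕ} {μ : Mv d} (h : μ ∈ empiricalSphere d N) :
    ∀ᵐ v ∂μ, ∀ᵐ w ∂μ, v ≠ w → ∀ σ, Integrable f (collUpdate N μ v w σ) ∧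
      ∫ y, f y ∂(collUpdate N μ v w σ) = ∫ y, f y ∂μ + (N:ℝ)⁻¹ * dl f v w σ := by
  obtain ⟨hN, x, hx, _⟩ := emp_rep h
  have hr : ∀ᵐ v ∂μ, v ∈ Set.range x := by rw [hx]; exact ae_emp _ x
  filter_upwards [hr] with v hv
  filter_upwards [hr] with w hw
  intro hvw σ
  obtain ⟨i, rfl⟩ := hv
  obtain ⟨j, rfl⟩ := hw
  have hij : i ≠ j := fun e => hvw (by rw [e])
  have hN' : (N:ℝ≥0∞)⁻¹ ≠ ⊤ := by simp [hN.ne']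
  have id : ∀ a b : Vd d, Integrable f ((N:ℝ≥0∞)⁻¹ • (Measure.dirac a + Measure.dirac b)) := fun a b =>
    ((integrable_dirac (by simp)).add_measure (integrable_dirac (by simp))).smul_measure hN'
  have iμ : Integrable f μ := by
    rw [hx]; exact (integrable_finsetSum_measure.2 fun i _ => integrable_dirac (by simp)).smul_measure hN'
  have ev : ∀ a b : Vd d, ∫ y, f y ∂((N:ℝ≥0∞)⁻¹ • (Measure.dirac a + Measure.dirac b)) = (N:ℝ)⁻¹ * (f a + f b) := fun a b => by
    rw [integral_smul_measure, integral_add_measure (integrable_dirac (by simp)) (integrable_dirac (by simp)),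
      integral_dirac, integral_dirac]; simp
  have hfin : ∀ a b : Vd d, IsFiniteMeasure ((N:ℝ≥0∞)⁻¹ • (Measure.dirac a + Measure.dirac b)) := fun a b =>
    Measure.smul_finite _ hN'
  have hle : (N:ℝ≥0∞)⁻¹ • (Measure.dirac (x i) + Measure.dirac (x j)) ≤ μ := by
    rw [hx]
    refine Measure.le_iff.2 fun s hs => ?_
    rw [Measure.smul_apply, Measure.smul_apply, Measure.finsetSum_apply, Measure.add_apply, smul_eq_mul, smul_eq_mul]
    refine mul_le_mul_right ?_ _
    rw [← Finset.sum_pair (f := fun i => Measure.dirac (x i) s) hij]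
    exact Finset.sum_le_sum_of_subset (Finset.subset_univ _)
  have hc : collUpdate N μ (x i) (x j) σ + (N:ℝ≥0∞)⁻¹ • (Measure.dirac (x i) + Measure.dirac (x j)) =
      μ + (N:ℝ≥0∞)⁻¹ • (Measure.dirac (postV (x i) (x j) σ) + Measure.dirac (postVs (x i) (x j) σ)) := by
    have := hfin (x i) (x j)
    exact Measure.sub_add_cancel_of_le (hle.trans (Measure.le_add_right le_rfl))
  have ic : Integrable f (collUpdate N μ (x i) (x j) σ) :=
    (iμ.add_measure (id _ _)).mono_measure Measure.sub_le
  refine ⟨ic, ?_⟩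
  have h2 : ∫ y, f y ∂(collUpdate N μ (x i) (x j) σ + (N:ℝ≥0∞)⁻¹ • (Measure.dirac (x i) + Measure.dirac (x j))) =
      ∫ y, f y ∂(μ + (N:ℝ≥0∞)⁻¹ • (Measure.dirac (postV (x i) (x j) σ) + Measure.dirac (postVs (x i) (x j) σ))) := by
    rw [hc]
  rw [integral_add_measure ic (id _ _), integral_add_measure iμ (id _ _), ev, ev] at h2
  unfold dl; linarith

/-- measurable version of the integral -/
def lin (f : Vf d) (ν : Mv d) : ℝ :=
  (∫⁻ v, ENNReal.ofReal (f v) ∂ν).toReal - (∫⁻ v, ENNReal.ofReal (-f v) ∂ν).toReal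

lemma lin_meas (hf : Measurable f) : Measurable (lin f) :=
  (Measure.measurable_lintegral hf.ennreal_ofReal).ennreal_toReal.sub
    (Measure.measurable_lintegral hf.neg.ennreal_ofReal).ennreal_toReal

lemma lin_eq {ν : Mv d} (h : Integrable f ν) : lin f ν = ∫ v, f v ∂ν :=
  (integral_eq_lintegral_pos_part_sub_lintegral_neg_part h).symm

/-- clamp -/
def clm (C x : ℝ) : ℝ := max (-C) (min C x)

lemma clm_eq {C x : ℝ} (h : |x| ≤ C) : clm C x = x := by
  rw [abs_le] at h; unfold clm; rw [min_eq_right h.2, max_eq_right h.1]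

lemma clm_abs (hC : 0 ≤ C) (x : ℝ) : |clm C x| ≤ C := by
  unfold clm; rw [abs_le]; exact ⟨le_max_left _ _, max_le (by linarith) (min_le_left _ _)⟩

lemma clm_meas (C : ℝ) : Measurable (clm C) := measurable_const.max (measurable_const.min measurable_id)

/-- carre du champ -/
def Gam (B : Vd d → Mv d) (f : Vf d) (μ : Mv d) : ℝ :=
  ∫ v, ∫ w, ∫ σ, (dl f v w σ) ^ 2 ∂(B (v - w)) ∂μ ∂μ

section
variable {B : Vd d → Mv d} (hB : IsCollisionKernel B) (hd : 0 < d)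
include hB hd

lemma kacGen_eq {N : ℕ} {μ : Mv d} (h : μ ∈ empiricalSphere d N) (hf : Measurable f)
    (hC : ∀ v, |f v| ≤ C) (Φ : ℝ → ℝ) :
    kacGen B N (fun ν => Φ (clm (5 * C) (lin f ν))) μ =
      N * ∫ v, ∫ w, ∫ σ, (Φ (∫ y, f y ∂μ + (N:ℝ)⁻¹ * dl f v w σ) - Φ (∫ y, f y ∂μ)) ∂(B (v - w)) ∂μ ∂μ := by
  have := h.1.1
  obtain ⟨hN, _⟩ := emp_rep h
  have hN1 : (1:ℝ) ≤ N := by exact_mod_cast hN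
  have C0 : 0 ≤ C := (abs_nonneg _).trans (hC 0)
  have hfi : Integrable f μ := Integrable.of_bound hf.aestronglyMeasurable C (ae_of_all _ hC)
  have hm : |∫ y, f y ∂μ| ≤ C := by
    have := norm_integral_le_of_norm_le_const (μ := μ) (f := f) (ae_of_all _ hC)
    simpa using this
  unfold kacGen
  congr 1
  refine integral_congr_ae ?_
  filter_upwards [coll_int h (f := f)] with v hv
  refine integral_congr_ae ?_
  filter_upwards [hv] with w hw
  by_cases hvw : v = w
  · simp [hvw, B_zero hB hd]
  · congr 1; ext σ
    obtain ⟨h1, h2⟩ := hw hvw σ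
    rw [lin_eq h1, lin_eq hfi, h2, clm_eq, clm_eq (by linarith)]
    have hdl : |dl f v w σ| ≤ 4 * C := by
      unfold dl
      have a1 := abs_le.1 (hC (postV v w σ)); have a2 := abs_le.1 (hC (postVs v w σ))
      have a3 := abs_le.1 (hC v); have a4 := abs_le.1 (hC w)
      rw [abs_le]; constructor <;> linarith
    refine (abs_add_le _ _).trans ?_
    rw [abs_mul, abs_of_nonneg (by positivity : (0:ℝ) ≤ (N:ℝ)⁻¹)]
    have : (N:ℝ)⁻¹ ≤ 1 := inv_le_one_of_one_le₀ hN1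
    nlinarith [abs_nonneg (dl f v w σ)]

lemma kacGen_lin {N : ℕ} {μ : Mv d} (h : μ ∈ empiricalSphere d N) (hf : Measurable f)
    (hC : ∀ v, |f v| ≤ C) :
    kacGen B N (fun ν => clm (5 * C) (lin f ν)) μ = QInt B f μ μ := by
  obtain ⟨hN, _⟩ := emp_rep h
  have hN' : (N:ℝ) ≠ 0 := by exact_mod_cast hN.ne'
  rw [kacGen_eq hB hd h hf hC (fun x => x)]
  simp only [add_sub_cancel_left, integral_const_mul]
  rw [mul_inv_cancel_left₀ hN']; rfl

lemma sq_int_bound (hf : Gr k C f) (v w : Vd d) :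
    |∫ σ, (dl f v w σ) ^ 2 ∂(B (v - w))| ≤ 16 * C ^ 2 * (pw v ^ (2 * k + 1) * pw w ^ (2 * k + 1)) := by
  have hC := hf.nonneg
  refine (B_int_le hB hd (v - w) _ ((4 * C * (pw v ^ k * pw w ^ k)) ^ 2) fun σ hσ => ?_).trans ?_
  · rw [abs_pow]; exact pll (abs_nonneg _) (dl_bound hf v w σ hσ) _
  · have h1 := norm_sub_le_pw v w
    have h2 : 0 ≤ (4 * C * (pw v ^ k * pw w ^ k)) ^ 2 := sq_nonneg _
    refine (mlr h1 h2).trans (le_of_eq ?_)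
    ring

lemma sq_meas (hf : Measurable f) :
    Measurable (fun z : Vd d × Vd d => ∫ σ, (dl f z.1 z.2 σ) ^ 2 ∂(B (z.1 - z.2))) :=
  iB_meas hB hd ((dl_meas hf).pow_const 2)

omit hB hd in
lemma pw_prod_integrable {R : ℝ} {μ : Mv d} {F : Vd d × Vd d → ℝ} (hF : Measurable F)
    (hb : ∀ v w, |F (v, w)| ≤ C * (pw v ^ k * pw w ^ k)) (h : Adm μ k R) :
    Integrable F (μ.prod μ) := by
  have := h.1
  exact ((h.2.1.mul_prod h.2.1).const_mul C).mono' hF.aestronglyMeasurable (ae_of_all _ fun z => hb z.1 z.2)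

lemma Gam_prod {R : ℝ} (hf : Gr k C f) {μ : Mv d} (h : Adm μ (2 * k + 1) R) :
    Integrable (fun z : Vd d × Vd d => ∫ σ, (dl f z.1 z.2 σ) ^ 2 ∂(B (z.1 - z.2))) (μ.prod μ) ∧
    Gam B f μ = ∫ z : Vd d × Vd d, ∫ σ, (dl f z.1 z.2 σ) ^ 2 ∂(B (z.1 - z.2)) ∂(μ.prod μ) := by
  have := h.1
  have i := pw_prod_integrable (sq_meas hB hd hf.1) (fun v w => sq_int_bound hB hd hf v w) h
  exact ⟨i, by rw [integral_prod _ i]; rfl⟩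

lemma Gam_meas {α : Type*} [MeasurableSpace α] {c : α → Mv d} (hc : Measurable c)
    (hp : ∀ a, IsProbabilityMeasure (c a)) (hf : Measurable f) :
    Measurable (fun a => Gam B f (c a)) := ker_meas hc hp (sq_meas hB hd hf)

lemma kacGen_sq {N : ℕ} {μ : Mv d} (h : μ ∈ empiricalSphere d N) (hf : Measurable f)
    (hC : ∀ v, |f v| ≤ C) :
    kacGen B N (fun ν => (clm (5 * C) (lin f ν)) ^ 2) μ =
      2 * (∫ v, f v ∂μ) * QInt B f μ μ + (N:ℝ)⁻¹ * Gam B f μ := by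
  have := h.1.1
  obtain ⟨hN, _⟩ := emp_rep h
  have hN' : (N:ℝ) ≠ 0 := by exact_mod_cast hN.ne'
  have hf0 : Gr 0 C f := ⟨hf, fun v => by simpa using hC v⟩
  have ha := emp_adm h 1
  rw [kacGen_eq hB hd h hf hC (fun x => x ^ 2)]
  generalize (∫ v, f v ∂μ) = m
  have e1 : ∀ v w, ∫ σ, ((m + (N:ℝ)⁻¹ * dl f v w σ) ^ 2 - m ^ 2) ∂(B (v - w)) =
      2 * m * (N:ℝ)⁻¹ * qB B f v w + (N:ℝ)⁻¹ ^ 2 * ∫ σ, (dl f v w σ) ^ 2 ∂(B (v - w)) := by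
    intro v w
    have i1 := dl_integrable hB hd hf0 v w (v - w)
    have i2 : Integrable (fun σ => (dl f v w σ) ^ 2) (B (v - w)) :=
      B_integrable hB hd _ ((dl_meas1 hf v w).pow_const 2) ((4 * C * (pw v ^ 0 * pw w ^ 0)) ^ 2) fun σ hσ => by
        rw [abs_pow]; exact pll (abs_nonneg _) (dl_bound hf0 v w σ hσ) _
    unfold qB
    rw [← integral_const_mul, ← integral_const_mul, ← integral_add (i1.const_mul _) (i2.const_mul _)]
    congr 1; ext σ; ring
  simp only [e1]
  have j1 := qB_integrable hB hd hf0 ha ha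
  obtain ⟨j2, j3⟩ := Gam_prod hB hd hf0 (k := 0) ha
  rw [← integral_prod (f := fun z : Vd d × Vd d => 2 * m * (N:ℝ)⁻¹ * qB B f z.1 z.2 + (N:ℝ)⁻¹ ^ 2 * ∫ σ, (dl f z.1 z.2 σ) ^ 2 ∂(B (z.1 - z.2)))
    ((j1.const_mul _).add (j2.const_mul _)), integral_add (j1.const_mul _) (j2.const_mul _), integral_const_mul,
    integral_const_mul, ← j3, ← QInt_prod hB hd hf0 ha ha]
  field_simp
end

lemma lip_test {L : ℝ≥0} (hC : ∀ v, |f v| ≤ C) (hL : LipschitzWith L f) :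
    (fun v => (C + L + 1)⁻¹ * f v) ∈ testF d := by
  have C0 : 0 ≤ C := (abs_nonneg _).trans (hC 0)
  have hK : 0 < C + L + 1 := by positivity
  have hs : ∀ v : Vd d, 1 ≤ 1 + ‖v‖ ^ 2 := fun v => by nlinarith [sq_nonneg ‖v‖]
  constructor
  · intro v
    have := hs v
    rw [abs_div, abs_mul, abs_of_pos (inv_pos.2 hK), abs_of_pos (by linarith : 0 < 1 + ‖v‖ ^ 2), div_le_one (by linarith),
      inv_mul_le_iff₀ hK]
    nlinarith [hC v, L.2]
  · intro v w
    have h1 := hs v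
    have h2 := hs w
    have hl : |f v - f w| ≤ L * ‖v - w‖ := by
      have := hL.dist_le_mul v w; rwa [Real.dist_eq, dist_eq_norm] at this
    have e : (C + L + 1)⁻¹ * f v / (1 + ‖v‖ ^ 2) - (C + L + 1)⁻¹ * f w / (1 + ‖w‖ ^ 2) =
        (C + L + 1)⁻¹ * ((f v - f w) / (1 + ‖v‖ ^ 2) + f w * ((‖w‖ ^ 2 - ‖v‖ ^ 2) / ((1 + ‖v‖ ^ 2) * (1 + ‖w‖ ^ 2)))) := by
      field_simp; ring
    rw [e, abs_mul, abs_of_pos (inv_pos.2 hK), inv_mul_le_iff₀ hK]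
    refine (abs_add_le _ _).trans ?_
    have b1 : |(f v - f w) / (1 + ‖v‖ ^ 2)| ≤ L * ‖v - w‖ := by
      rw [abs_div, abs_of_pos (by linarith : 0 < 1 + ‖v‖ ^ 2)]
      exact (div_le_self (abs_nonneg _) h1).trans hl
    have b2 : |(‖w‖ ^ 2 - ‖v‖ ^ 2) / ((1 + ‖v‖ ^ 2) * (1 + ‖w‖ ^ 2))| ≤ ‖v - w‖ := by
      rw [abs_div, abs_of_pos (by positivity : 0 < (1 + ‖v‖ ^ 2) * (1 + ‖w‖ ^ 2)), div_le_iff₀ (by positivity)]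
      have e2 : ‖w‖ ^ 2 - ‖v‖ ^ 2 = (‖w‖ - ‖v‖) * (‖w‖ + ‖v‖) := by ring
      have b3 : |‖w‖ - ‖v‖| ≤ ‖v - w‖ := by rw [norm_sub_rev]; exact abs_norm_sub_norm_le w v
      rw [e2, abs_mul, abs_of_nonneg (by positivity : 0 ≤ ‖w‖ + ‖v‖)]
      refine mul_le_mul b3 ?_ (by positivity) (norm_nonneg _)
      nlinarith [sq_nonneg (‖w‖ - 1), sq_nonneg (‖v‖ - 1), sq_nonneg (‖w‖ * ‖v‖), sq_nonneg ‖w‖, sq_nonneg ‖v‖]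
    rw [abs_mul]
    have b4 := mul_le_mul (hC w) b2 (abs_nonneg _) C0
    nlinarith [norm_nonneg (v - w)]

lemma meas_of_lip {α : Type*} [MeasurableSpace α] {c : α → Mv d} (hp : ∀ a, IsProbabilityMeasure (c a))
    (h : ∀ (f : Vf d) (C : ℝ) (L : ℝ≥0), (∀ v, |f v| ≤ C) → LipschitzWith L f → Measurable fun a => ∫ v, f v ∂(c a)) :
    Measurable c := by
  refine Measurable.measure_of_isPiSystem_of_isProbabilityMeasure (S := {s | IsClosed s})
    (by rw [← borel_eq_generateFrom_isClosed]; exact BorelSpace.measurable_eq) isPiSystem_isClosed fun F hF => ?_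
  have hpos : ∀ n : ℕ, (0:ℝ) < 1 / ((n:ℝ) + 1) := fun n => by positivity
  have hlim : ∀ a, Tendsto (fun n => ∫⁻ v, (thickenedIndicator (hpos n) F v : ℝ≥0∞) ∂(c a)) atTop (nhds (c a F)) := fun a =>
    tendsto_lintegral_thickenedIndicator_of_isClosed (c a) hF hpos tendsto_one_div_add_atTop_nhds_zero_nat
  refine measurable_of_tendsto_metrizable (f := fun n a => ∫⁻ v, (thickenedIndicator (hpos n) F v : ℝ≥0∞) ∂(c a)) (fun n => ?_)
    (tendsto_pi_nhds.2 hlim)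
  have hl := lipschitzWith_thickenedIndicator (hpos n) F
  have hb : ∀ v, |((thickenedIndicator (hpos n) F v : ℝ≥0) : ℝ)| ≤ 1 := fun v => by
    rw [abs_of_nonneg (NNReal.coe_nonneg _)]; exact_mod_cast thickenedIndicator_le_one (hpos n) F v
  have hl2 : LipschitzWith _ (fun v => ((thickenedIndicator (hpos n) F v : ℝ≥0) : ℝ)) :=
    LipschitzWith.of_dist_le_mul fun x y => hl.dist_le_mul x y
  have := (h _ 1 _ hb hl2).ennreal_ofReal
  convert this using 1
  ext a
  have := hp a
  rw [ofReal_integral_eq_lintegral_ofReal (Integrable.of_bound hl2.continuous.measurable.aestronglyMeasurable 1 (ae_of_all _ hb))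
    (ae_of_all _ fun v => NNReal.coe_nonneg _)]
  simp

/-- truncation to the relevant ball -/
def cut (N : ℕ) (f : Vf d) (v : Vd d) : ℝ := if ‖v‖ ≤ 2 * √N then f v else 0

lemma cut_meas {N : ℕ} (hf : Measurable f) : Measurable (cut N f) :=
  Measurable.ite (measurableSet_le measurable_norm measurable_const) hf measurable_const

lemma cut_bdd {N k : ℕ} (hf : Gr k C f) (v : Vd d) : |cut N f v| ≤ C * (1 + 2 * √N) ^ k := by
  have := hf.nonneg
  unfold cut
  split_ifs with h
  · exact (hf.2 v).trans (mll (pll (pw_pos v).le (by unfold pw; linarith) _) this)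
  · simp; positivity

lemma cut_int {N : ℕ} {μ : Mv d} (h : μ ∈ empiricalSphere d N) (f : Vf d) :
    ∫ v, cut N f v ∂μ = ∫ v, f v ∂μ :=
  integral_congr_ae ((emp_ball h).mono fun v hv => if_pos (by linarith [Real.sqrt_nonneg N]))

lemma cut_dl {N : ℕ} (f : Vf d) {v w σ : Vd d} (hv : ‖v‖ ≤ √N) (hw : ‖w‖ ≤ √N) (hσ : ‖σ‖ = 1) :
    dl (cut N f) v w σ = dl f v w σ := by
  have := norm_post_le v w σ hσ
  have := Real.sqrt_nonneg (N:ℝ)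
  unfold dl cut
  rw [if_pos (by linarith), if_pos (by linarith), if_pos (by linarith), if_pos (by linarith)]

section
variable {B : Vd d → Mv d} (hB : IsCollisionKernel B) (hd : 0 < d)
include hB hd

lemma cut_QInt {N : ℕ} {μ : Mv d} (h : μ ∈ empiricalSphere d N) (f : Vf d) :
    QInt B (cut N f) μ μ = QInt B f μ μ := by
  refine integral_congr_ae ((emp_ball h).mono fun v hv => ?_)
  refine integral_congr_ae ((emp_ball h).mono fun w hw => ?_)
  exact integral_congr_ae ((B_sphere hB hd _).mono fun σ hσ => cut_dl f hv hw hσ)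

lemma cut_Gam {N : ℕ} {μ : Mv d} (h : μ ∈ empiricalSphere d N) (f : Vf d) :
    Gam B (cut N f) μ = Gam B f μ := by
  refine integral_congr_ae ((emp_ball h).mono fun v hv => ?_)
  refine integral_congr_ae ((emp_ball h).mono fun w hw => ?_)
  exact integral_congr_ae ((B_sphere hB hd _).mono fun σ hσ => congrArg (· ^ 2) (cut_dl f hv hw hσ))
end

/-- the compensated linear functional -/
def Xf {Ω : Type*} (B : Vd d → Mv d) (μp : ℝ → Ω → Mv d) (f : Vf d) (t : ℝ) (ω : Ω) : ℝ :=
  (∫ v, f v ∂(μp t ω)) - ∫ s in Ioc (0:ℝ) t, QInt B f (μp s ω) (μp s ω)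

section
variable {B : Vd d → Mv d} (hB : IsCollisionKernel B) (hd : 0 < d)
  {Ω : Type*} [m : MeasurableSpace Ω] {N : ℕ} {P : Measure Ω} [IsProbabilityMeasure P] {𝓕 : Filtration ℝ m}
  {μp : ℝ → Ω → Mv d} (hK : IsKacProcess B N P 𝓕 μp)
include hB hd hK

omit hB hd [IsProbabilityMeasure P] in
lemma K_prob (t : ℝ) (ω : Ω) : IsProbabilityMeasure (μp t ω) := (hK.mem t ω).1.1

omit hB hd [IsProbabilityMeasure P] in
lemma K_rc0 (ω : Ω) {L : ℝ≥0} (hC : ∀ v, |f v| ≤ C) (hL : LipschitzWith L f) (t : ℝ) :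
    ContinuousWithinAt (fun s => ∫ v, f v ∂(μp s ω)) (Ici t) t := by
  have C0 : 0 ≤ C := (abs_nonneg _).trans (hC 0)
  have hk : (C + L + 1) ≠ 0 := by positivity
  have := (hK.rightCont ω _ (lip_test hC hL) t).const_mul (C + L + 1)
  simpa only [integral_const_mul, mul_inv_cancel_left₀ hk] using this

omit hB hd [IsProbabilityMeasure P] in
lemma K_rc (ω : Ω) (hf : Continuous f) (t : ℝ) :
    ContinuousWithinAt (fun s => ∫ v, f v ∂(μp s ω)) (Ici t) t := by
  have hp := K_prob hK
  obtain ⟨C, hC⟩ := (isCompact_closedBall (0 : Vd d) (√N)).exists_bound_of_continuousOn hf.continuousOn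
  have hC0 : 0 ≤ C := (norm_nonneg _).trans (hC 0 (by simp))
  have e : ∀ s, ∫ v, f v ∂(μp s ω) = ∫ v, clm C (f v) ∂(μp s ω) := fun s =>
    integral_congr_ae ((emp_ball (hK.mem s ω)).mono fun v hv => (clm_eq (hC v (by simpa using hv))).symm)
  let ρ : ℝ → ProbabilityMeasure (Vd d) := fun s => ⟨μp s ω, hp s ω⟩
  have h1 : Tendsto ρ (nhdsWithin t (Ici t)) (nhds (ρ t)) := by
    rw [tendsto_iff_forall_lipschitz_integral_tendsto]
    rintro g ⟨D, hD⟩ ⟨L, hL⟩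
    refine K_rc0 hK ω (C := |g 0| + D) (fun v => ?_) hL t
    have := hD v 0
    rw [Real.dist_eq] at this
    have := abs_sub_abs_le_abs_sub (g v) (g 0)
    linarith
  rw [ProbabilityMeasure.tendsto_iff_forall_integral_tendsto] at h1
  have hc : Continuous (fun v => clm C (f v)) := continuous_const.max (continuous_const.min hf)
  have := h1 (BoundedContinuousFunction.ofNormedAddCommGroup _ hc C fun v => clm_abs hC0 (f v))
  unfold ContinuousWithinAt
  simp only [e]
  exact this

omit hB hd [IsProbabilityMeasure P] in
lemma K_meas (t : ℝ) : Measurable[𝓕 t] (μp t) := by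
  refine @meas_of_lip d Ω (𝓕 t) _ (K_prob hK t) fun f C L hC hL => ?_
  have C0 : 0 ≤ C := (abs_nonneg _).trans (hC 0)
  have hk : (C + L + 1) ≠ 0 := by positivity
  have := (hK.adapted _ (lip_test hC hL) t).const_mul (C + L + 1)
  simpa only [integral_const_mul, mul_inv_cancel_left₀ hk] using this

omit hB hd [IsProbabilityMeasure P] in
lemma K_joint : Measurable (fun z : ℝ × Ω => μp z.1 z.2) := by
  refine meas_of_lip (fun z => K_prob hK z.1 z.2) fun f C L hC hL => ?_
  set g : ℝ → Ω → ℝ := fun s ω => ∫ v, f v ∂(μp s ω) with hg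
  have gm : ∀ s, Measurable (g s) := fun s =>
    int_meas ((K_meas hK s).mono (𝓕.le s) le_rfl) (K_prob hK s) hL.continuous.measurable
  set φ : ℕ → ℝ → ℝ := fun n s => (⌊((n:ℝ) + 1) * s⌋ + 1) / ((n:ℝ) + 1) with hφ
  have b1 : ∀ n s, s ≤ φ n s ∧ φ n s ≤ s + 1 / ((n:ℝ) + 1) := fun n s => by
    have h1 := Int.lt_floor_add_one (((n:ℝ) + 1) * s)
    have h2 := Int.floor_le (((n:ℝ) + 1) * s)
    have hn : (0:ℝ) < (n:ℝ) + 1 := by positivity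
    constructor
    · rw [hφ, le_div_iff₀ hn]; linarith
    · rw [hφ]; dsimp only; rw [div_le_iff₀ hn, add_mul s, div_mul_cancel₀ _ hn.ne']; linarith
  have hφl : ∀ s, Tendsto (fun n => φ n s) atTop (nhdsWithin s (Ici s)) := fun s => by
    refine tendsto_nhdsWithin_iff.2 ⟨?_, Eventually.of_forall fun n => (b1 n s).1⟩
    have h := (tendsto_const_nhds (x := s)).add tendsto_one_div_add_atTop_nhds_zero_nat
    rw [add_zero] at h
    exact tendsto_of_tendsto_of_tendsto_of_le_of_le tendsto_const_nhds h (fun n => (b1 n s).1) (fun n => (b1 n s).2)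
  refine measurable_of_tendsto_metrizable (f := fun n (z : ℝ × Ω) => g (φ n z.1) z.2) (fun n => ?_)
    (tendsto_pi_nhds.2 fun z => (K_rc0 hK z.2 hC hL z.1).tendsto.comp (hφl z.1))
  have h1 : Measurable (fun z : ℤ × Ω => g ((z.1 + 1) / ((n:ℝ) + 1)) z.2) :=
    measurable_from_prod_countable_right fun k => gm (((k:ℝ) + 1) / ((n:ℝ) + 1))
  exact h1.comp (g := fun z : ℤ × Ω => g ((z.1 + 1) / ((n:ℝ) + 1)) z.2)
    (f := fun z : ℝ × Ω => (⌊((n:ℝ) + 1) * z.1⌋, z.2))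
    ((Int.measurable_floor.comp (measurable_fst.const_mul _)).prodMk measurable_snd)

omit [IsProbabilityMeasure P] in
lemma X_mart (hf : Gr k C f) : Martingale (Xf B μp f) 𝓕 P := by
  have hm := cut_meas (N := N) hf.1
  have hb := cut_bdd (N := N) hf
  have h5 : 0 ≤ 5 * (C * (1 + 2 * √N) ^ k) := by have := hf.nonneg; positivity
  have := hK.martingale (fun ν => clm (5 * (C * (1 + 2 * √N) ^ k)) (lin (cut N f) ν)) ((clm_meas _).comp (lin_meas hm))
    ⟨_, fun ν => clm_abs h5 _⟩
  convert this using 1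
  ext t ω
  have := K_prob hK
  simp only [kacGen_lin hB hd (hK.mem _ ω) hm hb, cut_QInt hB hd (hK.mem _ ω)]
  have hb' : |∫ v, cut N f v ∂(μp t ω)| ≤ C * (1 + 2 * √N) ^ k := by
    have := norm_integral_le_of_norm_le_const (μ := μp t ω) (f := cut N f) (ae_of_all _ hb)
    simpa using this
  rw [lin_eq (Integrable.of_bound hm.aestronglyMeasurable _ (ae_of_all _ hb)), clm_eq (by linarith [abs_nonneg (∫ v, cut N f v ∂(μp t ω))]),
    cut_int (hK.mem t ω)]
  rfl

omit [IsProbabilityMeasure P] in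
lemma X2_mart (hf : Gr k C f) : Martingale (fun t ω => (∫ v, f v ∂(μp t ω)) ^ 2 -
    ∫ s in Ioc (0:ℝ) t, (2 * (∫ v, f v ∂(μp s ω)) * QInt B f (μp s ω) (μp s ω) + (N:ℝ)⁻¹ * Gam B f (μp s ω))) 𝓕 P := by
  have hm := cut_meas (N := N) hf.1
  have hb := cut_bdd (N := N) hf
  have h5 : 0 ≤ 5 * (C * (1 + 2 * √N) ^ k) := by have := hf.nonneg; positivity
  have := hK.martingale (fun ν => (clm (5 * (C * (1 + 2 * √N) ^ k)) (lin (cut N f) ν)) ^ 2) (((clm_meas _).comp (lin_meas hm)).pow_const 2)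
    ⟨(5 * (C * (1 + 2 * √N) ^ k)) ^ 2, fun ν => by rw [abs_pow]; exact pll (abs_nonneg _) (clm_abs h5 _) _⟩
  convert this using 1
  ext t ω
  have := K_prob hK
  simp only [kacGen_sq hB hd (hK.mem _ ω) hm hb, cut_QInt hB hd (hK.mem _ ω), cut_Gam hB hd (hK.mem _ ω)]
  have hb' : |∫ v, cut N f v ∂(μp t ω)| ≤ C * (1 + 2 * √N) ^ k := by
    have := norm_integral_le_of_norm_le_const (μ := μp t ω) (f := cut N f) (ae_of_all _ hb)
    simpa using this
  rw [lin_eq (Integrable.of_bound hm.aestronglyMeasurable _ (ae_of_all _ hb)), clm_eq (by linarith [abs_nonneg (∫ v, cut N f v ∂(μp t ω))])]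
  simp only [cut_int (hK.mem _ ω)]
end

lemma pov1 {P S : ℝ} (hP : 0 ≤ P) (hS : 0 ≤ S) (j : ℕ) :
    P ^ (j + 2) + S ^ (j + 2) ≤ (P + S) ^ (j + 2) - 2 * (P * S) * (P + S) ^ j := by
  induction j with
  | zero => apply le_of_eq; ring
  | succ j ih =>
    have := mlr ih (add_nonneg hP hS)
    have h1 : 0 ≤ P ^ (j + 2) * S := by positivity
    have h2 : 0 ≤ S ^ (j + 2) * P := by positivity
    calc P ^ (j + 1 + 2) + S ^ (j + 1 + 2) ≤ (P ^ (j + 2) + S ^ (j + 2)) * (P + S) := by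
          have : (P ^ (j + 2) + S ^ (j + 2)) * (P + S) = P ^ (j + 1 + 2) + S ^ (j + 1 + 2) + (P ^ (j + 2) * S + S ^ (j + 2) * P) := by ring
          linarith
      _ ≤ _ := this
      _ = _ := by ring

lemma pov2 {p q : ℝ} (hq : 0 ≤ q) (h : q ≤ p) (j : ℕ) :
    (p + q) ^ (j + 1) ≤ p ^ (j + 1) + 3 ^ (j + 1) * (p ^ j * q) := by
  have hp := hq.trans h
  induction j with
  | zero => simp; linarith
  | succ j ih =>
    have := mlr ih (add_nonneg hp hq)
    have h3 : (1:ℝ) ≤ 3 ^ (j + 1) := one_le_pow₀ (by norm_num)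
    have h1 : p ^ j * q * q ≤ p ^ (j + 1) * q := by
      rw [pow_succ]; have : 0 ≤ p ^ j * q := by positivity
      nlinarith
    have h2 : 0 ≤ p ^ (j + 1) * q := by positivity
    calc (p + q) ^ (j + 1 + 1) = (p + q) ^ (j + 1) * (p + q) := by ring
      _ ≤ _ := this
      _ = p ^ (j + 1 + 1) + p ^ (j + 1) * q + 3 ^ (j + 1) * (p ^ (j + 1) * q) + 3 ^ (j + 1) * (p ^ j * q * q) := by ring
      _ ≤ p ^ (j + 1 + 1) + 3 ^ (j + 1 + 1) * (p ^ (j + 1) * q) := by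
        rw [pow_succ (3:ℝ) (j + 1)]
        nlinarith [mll h1 (by linarith : (0:ℝ) ≤ 3 ^ (j + 1)), mul_nonneg (sub_nonneg.2 h3) h2]

lemma pov_key {P S a b u x z : ℝ} (a0 : 0 ≤ a) (b0 : 0 ≤ b) (u0 : 0 ≤ u) (h : b ≤ a)
    (hPS : P + S = a ^ 2 + b ^ 2) (hx : P - S = u * (x + 2 * z)) (h1 : |x| ≤ u) (h2 : |z| ≤ b) (hu : u ≤ a + b) :
    u ^ 2 * (u ^ 2 - x ^ 2) - 60 * a ^ 3 * b ≤ 4 * (P * S) := by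
  have h3 : u ^ 2 ≤ a ^ 2 + b ^ 2 + 2 * (a * b) := by nlinarith
  have h4 : (x + 2 * z) ^ 2 ≤ x ^ 2 + (4 * u * b + 4 * b ^ 2) := by
    have : x * z ≤ u * b := by
      calc x * z ≤ |x| * |z| := by rw [← abs_mul]; exact le_abs_self _
        _ ≤ _ := mul_le_mul h1 h2 (abs_nonneg _) u0
    have : z ^ 2 ≤ b ^ 2 := by rw [← sq_abs]; exact pll (abs_nonneg _) h2 2
    nlinarith
  have e : 4 * (P * S) = (a ^ 2 + b ^ 2) ^ 2 - u ^ 2 * (x + 2 * z) ^ 2 := by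
    rw [← hPS, ← mul_pow, ← hx]; ring
  rw [e]
  have c1 := mll h4 (sq_nonneg u)
  have c2 : u ^ 2 * u ^ 2 ≤ (a ^ 2 + b ^ 2) ^ 2 + 12 * a ^ 3 * b := by
    have hab : b ^ 2 ≤ a ^ 2 := pll b0 h 2
    have := mul_le_mul h3 h3 (sq_nonneg u) (by positivity)
    have t1 : 0 ≤ a * b * (a ^ 2 - b ^ 2) := mul_nonneg (by positivity) (by linarith)
    have t2 : 0 ≤ a ^ 2 * (b * (a - b)) := mul_nonneg (by positivity) (mul_nonneg b0 (by linarith))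
    nlinarith
  have c3 : u ^ 2 * (4 * u * b + 4 * b ^ 2) ≤ 48 * a ^ 3 * b := by
    have s1 : u ^ 2 ≤ 4 * a ^ 2 := by nlinarith
    have s2 : 4 * u * b + 4 * b ^ 2 ≤ 12 * (a * b) := by nlinarith
    calc _ ≤ (4 * a ^ 2) * (12 * (a * b)) := mul_le_mul s1 s2 (by positivity) (by positivity)
      _ = _ := by ring
  linarith

lemma pov_real {P S a b u x z : ℝ} (P0 : 0 ≤ P) (S0 : 0 ≤ S) (a0 : 0 ≤ a) (b0 : 0 ≤ b) (u0 : 0 ≤ u) (h : b ≤ a)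
    (hPS : P + S = a ^ 2 + b ^ 2) (hx : P - S = u * (x + 2 * z)) (h1 : |x| ≤ u) (h2 : |z| ≤ b) (hu : u ≤ a + b) (j : ℕ) :
    P ^ (j + 2) + S ^ (j + 2) - (a ^ 2) ^ (j + 2) ≤ (3 ^ (j + 2) + 30) * (a ^ 2) ^ j * a ^ 3 * b
      - 2⁻¹ * (a ^ 2) ^ j * u ^ 2 * (u ^ 2 - x ^ 2) := by
  have key := pov_key a0 b0 u0 h hPS hx h1 h2 hu
  have hj : (0:ℝ) ≤ (a ^ 2) ^ j := by positivity
  have k1 := pov1 P0 S0 j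
  have k2 := pov2 (sq_nonneg b) (pll b0 h 2) (j + 1)
  have k3 : (a ^ 2) ^ j ≤ (P + S) ^ j := by rw [hPS]; exact pll (sq_nonneg _) (by nlinarith) _
  have k4 := mll k3 (by positivity : 0 ≤ 2 * (P * S))
  have k5 := mll key hj
  have k6 : (a ^ 2) ^ (j + 1) * b ^ 2 ≤ (a ^ 2) ^ j * a ^ 3 * b := by
    have t2 : 0 ≤ (a ^ 2) ^ j * (a ^ 2 * (b * (a - b))) := by
      have := sub_nonneg.2 h
      positivity
    have e : (a ^ 2) ^ j * (a ^ 2 * (b * (a - b))) = (a ^ 2) ^ j * a ^ 3 * b - (a ^ 2) ^ (j + 1) * b ^ 2 := by ring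
    linarith
  rw [hPS] at k1 k4
  have k8 := mll k6 (by positivity : (0:ℝ) ≤ 3 ^ (j + 2))
  have e9 : j + 1 + 1 = j + 2 := rfl
  rw [e9] at k2
  generalize (a ^ 2) ^ j = A at *
  generalize (a ^ 2 + b ^ 2) ^ j = A' at *
  linarith

lemma pov_pt (j : ℕ) (v w σ : Vd d) (hσ : ‖σ‖ = 1) (h : ‖w‖ ≤ ‖v‖) :
    dl (fun v : Vd d => ‖v‖ ^ (2 * (j + 2))) v w σ ≤ (3 ^ (j + 2) + 30) * (‖v‖ ^ 2) ^ j * ‖v‖ ^ 3 * ‖w‖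
      - 2⁻¹ * (‖v‖ ^ 2) ^ j * ‖v - w‖ ^ 2 * (‖v - w‖ ^ 2 - ⟪v - w, σ⟫ ^ 2) := by
  have hx : ‖postV v w σ‖ ^ 2 - ‖postVs v w σ‖ ^ 2 = ‖v - w‖ * (⟪v - w, σ⟫ + 2 * ⟪w, σ⟫) := by
    unfold postV postVs
    rw [norm_add_sq_real, norm_sub_sq_real, inner_smul_left, inner_smul_right, inner_add_left, inner_sub_left]
    simp only [map_inv₀, map_ofNat]
    ring
  have h1 := abs_real_inner_le_norm (v - w) σ
  have h2 := abs_real_inner_le_norm w σ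
  rw [hσ, mul_one] at h1 h2
  have := pov_real (sq_nonneg _) (sq_nonneg _) (norm_nonneg v) (norm_nonneg w) (norm_nonneg (v - w)) h (post_sq v w σ hσ) hx h1 h2
    (norm_sub_le v w) j
  have k7 : (0:ℝ) ≤ ‖w‖ ^ (2 * (j + 2)) := by positivity
  unfold dl
  dsimp only
  rw [pow_mul ‖postV v w σ‖, pow_mul ‖postVs v w σ‖, pow_mul ‖v‖]
  linarith

lemma ibp_le {y q : ℝ → ℝ} {M K t : ℝ} {m : ℕ} (hq : Measurable q) (hM : ∀ s, |q s| ≤ M)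
    (hy : ∀ t, 0 ≤ t → y t = y 0 + ∫ s in Ioc 0 t, q s)
    (hle : ∀ s, 0 < s → s ≤ t → ((m + 1 : ℕ) : ℝ) * s ^ m * y s + s ^ (m + 1) * q s ≤ K) (ht : 0 ≤ t) :
    t ^ (m + 1) * y t ≤ K * t := by
  have qi : IntervalIntegrable q volume 0 t := by
    rw [intervalIntegrable_iff_integrableOn_Ioc_of_le ht]
    exact Integrable.of_bound hq.aestronglyMeasurable M (ae_of_all _ hM)
  set g : ℝ → ℝ := fun x => y 0 + ∫ v in (0:ℝ)..x, q v with hg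
  have gy : ∀ s, 0 ≤ s → g s = y s := fun s hs => by rw [hg, hy s hs]; simp [intervalIntegral.integral_of_le hs]
  have h0 : (0:ℝ) ∈ Set.uIcc 0 t := by simp
  have gac : AbsolutelyContinuousOnInterval g 0 t := by
    have h1 := qi.absolutelyContinuousOnInterval_intervalIntegral h0
    have h2 : AbsolutelyContinuousOnInterval (fun _ : ℝ => y 0) 0 t :=
      (LipschitzOnWith.absolutelyContinuousOnInterval (K := 0) (LipschitzWith.const (y 0)).lipschitzOnWith)
    exact h2.add h1
  have fac : AbsolutelyContinuousOnInterval (fun x : ℝ => x ^ (m + 1)) 0 t :=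
    ContDiffOn.absolutelyContinuousOnInterval (by fun_prop)
  have := fac.integral_deriv_mul_eq_sub gac
  rw [gy t ht] at this
  simp only [ne_eq, Nat.add_eq_zero_iff, one_ne_zero, and_false, not_false_eq_true, zero_pow, zero_mul, sub_zero] at this
  rw [← this, intervalIntegral.integral_of_le ht]
  by_cases hi : IntegrableOn (fun x => deriv (fun x : ℝ => x ^ (m + 1)) x * g x + x ^ (m + 1) * deriv g x) (Ioc 0 t)
  · refine (integral_mono_ae hi (integrable_const K) ?_).trans (le_of_eq ?_)
    · filter_upwards [ae_restrict_mem measurableSet_Ioc, ae_restrict_of_ae qi.ae_hasDerivAt_integral] with x hx hx2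
      have h1 : HasDerivAt g (q x) x := (hx2 (by rw [Set.uIcc_of_le ht]; exact ⟨hx.1.le, hx.2⟩) 0 h0).const_add (y 0)
      rw [h1.deriv, gy x hx.1.le]
      have := hle x hx.1 hx.2
      simpa using this
    · simp [ht, mul_comm]
  · exfalso; apply hi
    have h1 : IntervalIntegrable (fun x => deriv (fun x : ℝ => x ^ (m + 1)) x * g x) volume 0 t := by
      refine ContinuousOn.intervalIntegrable (ContinuousOn.mul (Continuous.continuousOn ?_) gac.continuousOn)
      have : deriv (fun x : ℝ => x ^ (m + 1)) = fun x => ((m:ℝ) + 1) * x ^ m := by ext x; simp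
      rw [this]; fun_prop
    have h2 : IntervalIntegrable (fun x => x ^ (m + 1) * deriv g x) volume 0 t :=
      gac.intervalIntegrable_deriv.continuousOn_mul (by fun_prop)
    exact (intervalIntegrable_iff_integrableOn_Ioc_of_le ht).1 (h1.add h2)

lemma prod_pt {m : ℕ} {c D t r : ℝ} (hc : 0 < c) (hD : 0 ≤ D) (ht : 0 ≤ t) (hr : 0 ≤ r) :
    D * t ^ m * r ^ (m + 2) - c * t ^ (m + 1) * r ^ (m + 3) ≤ D * (D / c) ^ m * r ^ 2 := by
  have e : D * t ^ m * r ^ (m + 2) - c * t ^ (m + 1) * r ^ (m + 3) = (t * r) ^ m * (D - c * (t * r)) * r ^ 2 := by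
    rw [mul_pow]; ring
  rw [e]
  refine mlr ?_ (sq_nonneg r)
  have hx : 0 ≤ t * r := by positivity
  set x := t * r
  by_cases h : x ≤ D / c
  · rw [mul_comm D]
    exact mul_le_mul (pll hx h m) (by nlinarith) (by
      rw [le_div_iff₀ hc] at h; linarith) (by positivity)
  · push Not at h
    rw [div_lt_iff₀ hc] at h
    have : x ^ m * (D - c * x) ≤ 0 := mul_nonpos_of_nonneg_of_nonpos (by positivity) (by linarith)
    exact this.trans (by positivity)

lemma nrm_gr (p : ℕ) : Gr p 1 (fun v : Vd d => ‖v‖ ^ p) :=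
  ⟨by fun_prop, fun v => by
    rw [one_mul, abs_of_nonneg (by positivity)]; exact pll (norm_nonneg v) (norm_le_pw v) p⟩

section
variable {B : Vd d → Mv d} (hB : IsCollisionKernel B) (hd : 0 < d)
include hB hd

lemma pov_q {γ : ℝ} (g0 : 0 < γ) (g1 : γ ≤ 1) (hγ : ∀ v : Vd d, ∫ σ, (‖v‖ ^ 2 - ⟪v, σ⟫ ^ 2) ∂(B v) = γ * ‖v‖ ^ 3)
    (j : ℕ) (v w : Vd d) : qB B (fun v : Vd d => ‖v‖ ^ (2 * (j + 2))) v w ≤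
      (2 * (3 ^ (j + 2) + 30) + 3) * (‖v‖ ^ (2 * j + 4) * ‖w‖ + ‖w‖ ^ (2 * j + 4) * ‖v‖)
        - γ / 4 * (‖v‖ ^ (2 * j + 5) + ‖w‖ ^ (2 * j + 5)) := by
  wlog h : ‖w‖ ≤ ‖v‖ generalizing v w
  · push Not at h
    rw [qB_symm hB hd (by fun_prop)]
    have := this w v h.le
    linarith
  set E : ℝ := 3 ^ (j + 2) + 30 with hE
  have E0 : 0 ≤ E := by positivity
  have hx : ∀ σ : Vd d, ‖σ‖ = 1 → |‖v - w‖ ^ 2 - ⟪v - w, σ⟫ ^ 2| ≤ ‖v - w‖ ^ 2 := fun σ hσ => by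
    have h1 := abs_real_inner_le_norm (v - w) σ
    rw [hσ, mul_one] at h1
    have := sq_le_sq' (by linarith [abs_le.1 h1]) (abs_le.1 h1).2
    rw [abs_of_nonneg (by linarith)]
    linarith [sq_nonneg ⟪v - w, σ⟫]
  have i1 : Integrable (fun σ => ‖v - w‖ ^ 2 - ⟪v - w, σ⟫ ^ 2) (B (v - w)) :=
    B_integrable hB hd _ (by fun_prop) _ hx
  have h1 : qB B (fun v : Vd d => ‖v‖ ^ (2 * (j + 2))) v w ≤
      ‖v - w‖ * (E * (‖v‖ ^ 2) ^ j * ‖v‖ ^ 3 * ‖w‖) - 2⁻¹ * (‖v‖ ^ 2) ^ j * ‖v - w‖ ^ 2 * (γ * ‖v - w‖ ^ 3) := by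
    rw [← hγ, ← B_int_const hB hd, ← integral_const_mul, ← integral_sub ((B_integrable hB hd _ measurable_const _ fun σ _ => le_rfl)) (i1.const_mul _)]
    refine integral_mono_ae (dl_integrable hB hd (nrm_gr _) v w _)
      ((B_integrable hB hd _ measurable_const _ fun σ _ => le_rfl).sub (i1.const_mul _)) ?_
    filter_upwards [B_sphere hB hd (v - w)] with σ hσ
    exact pov_pt j v w σ hσ h
  refine h1.trans ?_
  have u1 := norm_sub_le v w
  have u2 := norm_sub_norm_le v w
  have a0 := norm_nonneg v
  have b0 := norm_nonneg w
  generalize ‖v - w‖ = u at *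
  generalize ‖v‖ = a at *
  generalize ‖w‖ = b at *
  have k1 : u * (E * (a ^ 2) ^ j * a ^ 3 * b) ≤ 2 * E * (a ^ (2 * j + 4) * b) := by
    have : u ≤ 2 * a := by linarith
    calc _ ≤ (2 * a) * (E * (a ^ 2) ^ j * a ^ 3 * b) := mlr this (by positivity)
      _ = _ := by ring
  have k2 : a ^ 5 - 5 * a ^ 4 * b ≤ u ^ 5 := by
    have : (a - b) ^ 5 ≤ u ^ 5 := pll (by linarith) u2 5
    have : a ^ 5 - 5 * a ^ 4 * b ≤ (a - b) ^ 5 := by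
      have : (a - b) ^ 5 - (a ^ 5 - 5 * a ^ 4 * b) = b ^ 2 * (6 * a ^ 3 + 4 * (a ^ 2 * (a - b)) + 5 * (a * b ^ 2) - b ^ 3 - 6 * (a ^ 2 * b)) := by ring
      have : 0 ≤ 6 * a ^ 3 + 4 * (a ^ 2 * (a - b)) + 5 * (a * b ^ 2) - b ^ 3 - 6 * (a ^ 2 * b) := by
        have q1 : 0 ≤ a ^ 2 * (a - b) := mul_nonneg (by positivity) (by linarith)
        have q2 : 0 ≤ b ^ 2 * (a - b) := mul_nonneg (by positivity) (by linarith)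
        nlinarith [mul_nonneg a0 (sq_nonneg b)]
      nlinarith [mul_nonneg (sq_nonneg b) this]
    linarith
  have k3 := mll k2 (by positivity : 0 ≤ 2⁻¹ * (a ^ 2) ^ j * γ)
  have k4 : b ^ (2 * j + 5) ≤ a ^ (2 * j + 5) := pll b0 h _
  have k5 : 2⁻¹ * (a ^ 2) ^ j * γ * (a ^ 5 - 5 * a ^ 4 * b) = γ / 2 * a ^ (2 * j + 5) - γ * (5 / 2) * (a ^ (2 * j + 4) * b) := by ring
  have k6 : 2⁻¹ * (a ^ 2) ^ j * γ * u ^ 5 = 2⁻¹ * (a ^ 2) ^ j * u ^ 2 * (γ * u ^ 3) := by ring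
  have p1 : 0 ≤ a ^ (2 * j + 4) * b := by positivity
  have p2 : 0 ≤ b ^ (2 * j + 4) * a := by positivity
  have p3 := mlr g1 p1
  have p4 := mul_nonneg E0 p2
  have p5 := mll k4 g0.le
  linarith

lemma pov_Q {γ : ℝ} (g0 : 0 < γ) (g1 : γ ≤ 1) (hγ : ∀ v : Vd d, ∫ σ, (‖v‖ ^ 2 - ⟪v, σ⟫ ^ 2) ∂(B v) = γ * ‖v‖ ^ 3)
    (j : ℕ) {N : ℕ} {μ : Mv d} (h : μ ∈ empiricalSphere d N) :
    QInt B (fun v : Vd d => ‖v‖ ^ (2 * (j + 2))) μ μ ≤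
      2 * (2 * (3 ^ (j + 2) + 30) + 3) * (∫ v, ‖v‖ ^ (2 * j + 4) ∂μ) - γ / 2 * ∫ v, ‖v‖ ^ (2 * j + 5) ∂μ := by
  have := h.1.1
  obtain ⟨m1, m1'⟩ := m1_le h.1
  have I : ∀ p, Integrable (fun v : Vd d => ‖v‖ ^ p) μ := fun p => (nrm_gr p).integrable (emp_adm h p)
  rw [QInt_prod hB hd (nrm_gr _) (emp_adm h _) (emp_adm h _)]
  have i1 : Integrable (fun z : Vd d × Vd d => ‖z.1‖ ^ (2 * j + 4) * ‖z.2‖) (μ.prod μ) := (I _).mul_prod m1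
  have i2 : Integrable (fun z : Vd d × Vd d => ‖z.2‖ ^ (2 * j + 4) * ‖z.1‖) (μ.prod μ) := by
    have := m1.mul_prod (I (2 * j + 4)); simpa only [mul_comm] using this
  have i3 : Integrable (fun z : Vd d × Vd d => ‖z.1‖ ^ (2 * j + 5)) (μ.prod μ) := (I _).comp_fst μ
  have i4 : Integrable (fun z : Vd d × Vd d => ‖z.2‖ ^ (2 * j + 5)) (μ.prod μ) := (I _).comp_snd μ
  refine (integral_mono (qB_integrable hB hd (nrm_gr _) (emp_adm h _) (emp_adm h _))
    (((i1.add i2).const_mul _).sub ((i3.add i4).const_mul _)) fun z => pov_q hB hd g0 g1 hγ j z.1 z.2).trans ?_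
  simp only [Pi.add_apply, Pi.sub_apply]
  have e : ∀ (a b : ℝ), ∫ z : Vd d × Vd d, (a * (‖z.1‖ ^ (2 * j + 4) * ‖z.2‖ + ‖z.2‖ ^ (2 * j + 4) * ‖z.1‖) - b * (‖z.1‖ ^ (2 * j + 5) + ‖z.2‖ ^ (2 * j + 5))) ∂(μ.prod μ)
      = a * ((∫ v, ‖v‖ ^ (2 * j + 4) ∂μ) * (∫ v, ‖v‖ ∂μ) + (∫ v, ‖v‖ ^ (2 * j + 4) ∂μ) * (∫ v, ‖v‖ ∂μ)) - b * ((∫ v, ‖v‖ ^ (2 * j + 5) ∂μ) + ∫ v, ‖v‖ ^ (2 * j + 5) ∂μ) := fun a b => by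
    have i12 : Integrable (fun z : Vd d × Vd d => ‖z.1‖ ^ (2 * j + 4) * ‖z.2‖ + ‖z.2‖ ^ (2 * j + 4) * ‖z.1‖) (μ.prod μ) := i1.add i2
    have i34 : Integrable (fun z : Vd d × Vd d => ‖z.1‖ ^ (2 * j + 5) + ‖z.2‖ ^ (2 * j + 5)) (μ.prod μ) := i3.add i4
    rw [integral_sub (i12.const_mul _) (i34.const_mul _), integral_const_mul, integral_const_mul,
      integral_add i1 i2, integral_add i3 i4, integral_prod_mul (fun v : Vd d => ‖v‖ ^ (2 * j + 4)) (fun v : Vd d => ‖v‖),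
      integral_fun_fst (μ := μ) (ν := μ) (fun v : Vd d => ‖v‖ ^ (2 * j + 5)), integral_fun_snd (μ := μ) (ν := μ) (fun v : Vd d => ‖v‖ ^ (2 * j + 5))]
    have := integral_prod_mul (μ := μ) (ν := μ) (fun v : Vd d => ‖v‖) (fun v : Vd d => ‖v‖ ^ (2 * j + 4))
    simp only [mul_comm (‖_‖)] at this
    rw [this]
    simp [mul_comm]
  rw [e]
  have p0 : 0 ≤ ∫ v, ‖v‖ ^ (2 * j + 4) ∂μ := integral_nonneg fun v => by positivity
  have p1 := mll m1' p0
  have p2 := mll p1 (by positivity : (0:ℝ) ≤ (2 * (3 ^ (j + 2) + 30) + 3))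
  linarith
end

lemma swapE {Ω : Type*} [MeasurableSpace Ω] {P : Measure Ω} [IsProbabilityMeasure P] {h : ℝ × Ω → ℝ} (hm : Measurable h)
    {M : ℝ} (hM : ∀ z, |h z| ≤ M) (a b : ℝ) :
    Integrable (fun ω => ∫ s in Ioc a b, h (s, ω)) P ∧
    ∫ ω, (∫ s in Ioc a b, h (s, ω)) ∂P = ∫ s in Ioc a b, (∫ ω, h (s, ω) ∂P) := by
  have i : Integrable (fun z : Ω × ℝ => h (z.2, z.1)) (P.prod (volume.restrict (Ioc a b))) :=
    Integrable.of_bound (hm.comp (measurable_snd.prodMk measurable_fst)).aestronglyMeasurable M (ae_of_all _ fun z => hM _)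
  exact ⟨i.integral_prod_left, integral_integral_swap i⟩

section
variable {B : Vd d → Mv d} (hB : IsCollisionKernel B) (hd : 0 < d)
  {Ω : Type*} [m : MeasurableSpace Ω] {N : ℕ} {P : Measure Ω} [IsProbabilityMeasure P] {𝓕 : Filtration ℝ m}
  {μp : ℝ → Ω → Mv d} (hK : IsKacProcess B N P 𝓕 μp)
include hB hd hK

omit [IsProbabilityMeasure P] in
lemma K_Qb (hf : Gr k C f) (s : ℝ) (ω : Ω) :
    |QInt B f (μp s ω) (μp s ω)| ≤ 4 * C * ((1 + √N) ^ (k + 1) * (1 + √N) ^ (k + 1)) :=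
  QInt_bound hB hd hf (emp_adm (hK.mem s ω) _) (emp_adm (hK.mem s ω) _)

omit [IsProbabilityMeasure P] in
lemma K_Qm (hf : Measurable f) : Measurable (fun z : ℝ × Ω => QInt B f (μp z.1 z.2) (μp z.1 z.2)) :=
  QInt_meas hB hd (K_joint hK) (fun z => K_prob hK z.1 z.2) hf

omit hB hd [IsProbabilityMeasure P] in
lemma K_fb (hf : Gr k C f) (s : ℝ) (ω : Ω) :
    |∫ v, f v ∂(μp s ω)| ≤ C * (1 + √N) ^ k := hf.bound (emp_adm (hK.mem s ω) _)

omit hB hd [IsProbabilityMeasure P] in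
lemma K_fm (hf : Measurable f) : Measurable (fun z : ℝ × Ω => ∫ v, f v ∂(μp z.1 z.2)) :=
  int_meas (K_joint hK) (fun z => K_prob hK z.1 z.2) hf

omit hB hd in
lemma K_fi (hf : Gr k C f) (s : ℝ) : Integrable (fun ω => ∫ v, f v ∂(μp s ω)) P :=
  Integrable.of_bound ((K_fm hK hf.1).comp (g := fun z : ℝ × Ω => ∫ v, f v ∂(μp z.1 z.2)) (f := fun ω => (s, ω)) (by fun_prop)).aestronglyMeasurable _
    (ae_of_all _ fun ω => K_fb hK hf s ω)

omit hB hd hK [IsProbabilityMeasure P] in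
lemma mart_E {X : ℝ → Ω → ℝ} [SigmaFiniteFiltration P 𝓕] (hX : Martingale X 𝓕 P) {s t : ℝ} (h : s ≤ t) : ∫ ω, X t ω ∂P = ∫ ω, X s ω ∂P := by
  rw [← integral_congr_ae (hX.2 s t h), integral_condExp]

lemma ito_E (hf : Gr k C f) {t : ℝ} (ht : 0 ≤ t) :
    ∫ ω, (∫ v, f v ∂(μp t ω)) ∂P = ∫ ω, (∫ v, f v ∂(μp 0 ω)) ∂P +
      ∫ s in Ioc 0 t, (∫ ω, QInt B f (μp s ω) (μp s ω) ∂P) := by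
  have h := mart_E (X_mart hB hd hK hf) ht
  obtain ⟨i, e⟩ := swapE (P := P) (K_Qm hB hd hK hf.1) (fun z => K_Qb hB hd hK hf z.1 z.2) 0 t
  unfold Xf at h
  rw [integral_sub (K_fi hK hf t) i, e] at h
  simp only [Set.Ioc_self, Measure.restrict_empty, integral_zero_measure, sub_zero] at h
  linarith

lemma mom_one {γ : ℝ} (g0 : 0 < γ) (g1 : γ ≤ 1) (hγ : ∀ v : Vd d, ∫ σ, (‖v‖ ^ 2 - ⟪v, σ⟫ ^ 2) ∂(B v) = γ * ‖v‖ ^ 3)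
    (j : ℕ) {T D : ℝ} (hD : D = ((2 * j + 2 + 1 : ℕ) : ℝ) + 2 * (2 * (3 ^ (j + 2) + 30) + 3) * T) {t : ℝ} (ht : 0 ≤ t) (htT : t ≤ T) :
    t ^ (2 * j + 2 + 1) * ∫ ω, (∫ v, ‖v‖ ^ (2 * (j + 2)) ∂(μp t ω)) ∂P ≤ D * (D / (γ / 2)) ^ (2 * j + 2) * t := by
  have T0 := ht.trans htT
  have D0 : 0 ≤ D := by rw [hD]; positivity
  have gr := nrm_gr (d := d) (2 * (j + 2))
  have Qi : ∀ s, Integrable (fun ω => QInt B (fun v : Vd d => ‖v‖ ^ (2 * (j + 2))) (μp s ω) (μp s ω)) P := fun s =>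
    Integrable.of_bound ((K_Qm hB hd hK gr.1).comp (g := fun z : ℝ × Ω => QInt B (fun v : Vd d => ‖v‖ ^ (2 * (j + 2))) (μp z.1 z.2) (μp z.1 z.2)) (f := fun ω => (s, ω)) (by fun_prop)).aestronglyMeasurable _
      (ae_of_all _ fun ω => K_Qb hB hd hK gr s ω)
  refine ibp_le (y := fun t => ∫ ω, (∫ v, ‖v‖ ^ (2 * (j + 2)) ∂(μp t ω)) ∂P)
    (q := fun s => ∫ ω, QInt B (fun v : Vd d => ‖v‖ ^ (2 * (j + 2))) (μp s ω) (μp s ω) ∂P)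
    (M := 4 * 1 * ((1 + √N) ^ (2 * (j + 2) + 1) * (1 + √N) ^ (2 * (j + 2) + 1))) ?_ ?_ (fun t ht => ito_E hB hd hK gr ht) ?_ ht
  · exact ((K_Qm hB hd hK gr.1).stronglyMeasurable.integral_prod_right' (ν := P)).measurable
  · intro s
    have := norm_integral_le_of_norm_le_const (μ := P) (f := fun ω => QInt B (fun v : Vd d => ‖v‖ ^ (2 * (j + 2))) (μp s ω) (μp s ω)) (ae_of_all _ fun ω => K_Qb hB hd hK gr s ω)
    simpa using this
  · intro s s0 st
    rw [← integral_const_mul, ← integral_const_mul, ← integral_add ((K_fi hK gr s).const_mul _) ((Qi s).const_mul _)]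
    have key : ∀ ω, ((2 * j + 2 + 1 : ℕ) : ℝ) * s ^ (2 * j + 2) * (∫ v, ‖v‖ ^ (2 * (j + 2)) ∂(μp s ω)) +
        s ^ (2 * j + 2 + 1) * QInt B (fun v : Vd d => ‖v‖ ^ (2 * (j + 2))) (μp s ω) (μp s ω) ≤ D * (D / (γ / 2)) ^ (2 * j + 2) := fun ω => by
      have h := hK.mem s ω
      have := h.1.1
      have I : ∀ p, Integrable (fun v : Vd d => ‖v‖ ^ p) (μp s ω) := fun p => (nrm_gr p).integrable (emp_adm h p)
      have q := mll (pov_Q hB hd g0 g1 hγ j h) (by positivity : 0 ≤ s ^ (2 * j + 2 + 1))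
      have r : ∫ v, (D * s ^ (2 * j + 2) * ‖v‖ ^ (2 * j + 2 + 2) - γ / 2 * s ^ (2 * j + 2 + 1) * ‖v‖ ^ (2 * j + 2 + 3)) ∂(μp s ω) ≤
          ∫ v, (D * (D / (γ / 2)) ^ (2 * j + 2) * ‖v‖ ^ 2) ∂(μp s ω) :=
        integral_mono (((I _).const_mul _).sub ((I _).const_mul _)) ((I 2).const_mul _) fun v => prod_pt (by positivity) D0 s0.le (norm_nonneg v)
      rw [integral_sub ((I _).const_mul _) ((I _).const_mul _), integral_const_mul, integral_const_mul, integral_const_mul, h.1.2.2, mul_one] at r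
      refine le_trans ?_ r
      rw [show 2 * (j + 2) = 2 * j + 4 by ring] at q ⊢
      rw [show 2 * j + 2 + 2 = 2 * j + 4 by ring, show 2 * j + 2 + 3 = 2 * j + 5 by ring]
      have y0 : 0 ≤ ∫ v, ‖v‖ ^ (2 * j + 4) ∂(μp s ω) := integral_nonneg fun v => by positivity
      generalize (∫ v, ‖v‖ ^ (2 * j + 4) ∂(μp s ω)) = Y at *
      generalize (∫ v, ‖v‖ ^ (2 * j + 5) ∂(μp s ω)) = Z at *
      have e : s ^ (2 * j + 2 + 1) = s ^ (2 * j + 2) * s := pow_succ _ _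
      have f1 : (2 * (2 * (3 ^ (j + 2) + 30) + 3) * s) * (s ^ (2 * j + 2) * Y) ≤ (2 * (2 * (3 ^ (j + 2) + 30) + 3) * T) * (s ^ (2 * j + 2) * Y) :=
        mlr (mll (st.trans htT) (by positivity)) (by positivity)
      rw [hD]
      rw [e] at q ⊢
      nlinarith
    refine (integral_mono (((K_fi hK gr s).const_mul _).add ((Qi s).const_mul _)) (integrable_const _) key).trans (le_of_eq (by simp))
end

lemma mom_prod {B : Vd d → Mv d} (hB : IsCollisionKernel B) (hd : 0 < d) (n : ℕ) {τ T : ℝ} (hτ : 0 < τ) :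
    ∃ C : ℝ, 0 ≤ C ∧ ∀ (Ω : Type) [m : MeasurableSpace Ω] (N : ℕ) (P : Measure Ω) [IsProbabilityMeasure P] (𝓕 : Filtration ℝ m)
      (μp : ℝ → Ω → Mv d), IsKacProcess B N P 𝓕 μp → ∀ t ∈ Icc τ T,
      ∫ ω, (∫ v, pw v ^ n ∂(μp t ω)) ∂P ≤ C := by
  obtain ⟨γ, g0, g1, hγ⟩ := gamma_exists hB hd
  set D : ℝ := ((2 * n + 2 + 1 : ℕ) : ℝ) + 2 * (2 * (3 ^ (n + 2) + 30) + 3) * T with hD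
  set K := D * (D / (γ / 2)) ^ (2 * n + 2) with hK
  refine ⟨2 ^ (2 * (n + 2)) * (1 + |K * T / τ ^ (2 * n + 2 + 1)|), by positivity, fun Ω m N P _ 𝓕 μp hK t ht => ?_⟩
  have t0 := hτ.le.trans ht.1
  have h := mom_one hB hd hK g0 g1 hγ n hD t0 ht.2
  set y := ∫ ω, (∫ v, ‖v‖ ^ (2 * (n + 2)) ∂(μp t ω)) ∂P with hy
  have D0 : 0 ≤ D := by have := t0.trans ht.2; positivity
  have y0 : 0 ≤ y := integral_nonneg fun ω => integral_nonneg fun v => by positivity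
  have h2 : y ≤ |K * T / τ ^ (2 * n + 2 + 1)| := by
    refine le_trans ?_ (le_abs_self _)
    rw [le_div_iff₀ (by positivity)]
    calc y * τ ^ (2 * n + 2 + 1) ≤ y * t ^ (2 * n + 2 + 1) := mll (pll hτ.le ht.1 _) y0
      _ ≤ K * t := by rw [mul_comm]; exact h
      _ ≤ K * T := mll ht.2 (by positivity)
  have pg : Gr n 1 (fun v : Vd d => pw v ^ n) := ⟨pw_meas.pow_const n, fun v => by rw [one_mul, abs_of_nonneg (by have := pw_pos v; positivity)]⟩
  have gr := nrm_gr (d := d) (2 * (n + 2))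
  calc _ ≤ ∫ ω, (2 ^ (2 * (n + 2)) * (1 + ∫ v, ‖v‖ ^ (2 * (n + 2)) ∂(μp t ω))) ∂P := by
        refine integral_mono (K_fi hK pg t) (((integrable_const _).add (K_fi hK gr t)).const_mul _) fun ω => ?_
        have := K_prob hK t ω
        have I : Integrable (fun v : Vd d => ‖v‖ ^ (2 * (n + 2))) (μp t ω) := gr.integrable (emp_adm (hK.mem t ω) _)
        have e : 2 ^ (2 * (n + 2)) * (1 + ∫ v, ‖v‖ ^ (2 * (n + 2)) ∂(μp t ω)) = ∫ v, 2 ^ (2 * (n + 2)) * (1 + ‖v‖ ^ (2 * (n + 2))) ∂(μp t ω) := by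
          rw [integral_const_mul, integral_add (integrable_const _) I]; simp
        dsimp only
        rw [e]
        refine integral_mono (pg.integrable (emp_adm (hK.mem t ω) _)) (((integrable_const _).add I).const_mul _) fun v => ?_
        refine (pw_pow_mono v (by omega : n ≤ 2 * (n + 2))).trans ?_
        have := add_pow_le (zero_le_one) (norm_nonneg v) (2 * (n + 2))
        refine this.trans ?_
        simp only [one_pow]
        gcongr
        · norm_num
        · omega
    _ = 2 ^ (2 * (n + 2)) * (1 + y) := by
      rw [integral_const_mul, integral_add (integrable_const _) (K_fi hK gr t)]; simp [hy]
    _ ≤ _ := by gcongr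

lemma sq_prim {q : ℝ → ℝ} {M t : ℝ} (hq : Measurable q) (hM : ∀ s, |q s| ≤ M) (ht : 0 ≤ t) :
    (∫ s in Ioc 0 t, q s) ^ 2 = ∫ s in Ioc 0 t, 2 * (∫ r in Ioc 0 s, q r) * q s := by
  have qi : IntervalIntegrable q volume 0 t := by
    rw [intervalIntegrable_iff_integrableOn_Ioc_of_le ht]
    exact Integrable.of_bound hq.aestronglyMeasurable M (ae_of_all _ hM)
  have h0 : (0:ℝ) ∈ Set.uIcc 0 t := by simp
  have gac := qi.absolutelyContinuousOnInterval_intervalIntegral h0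
  have := gac.integral_deriv_mul_eq_sub gac
  simp only [intervalIntegral.integral_same, mul_zero, sub_zero] at this
  rw [← intervalIntegral.integral_of_le ht, sq, ← this, intervalIntegral.integral_of_le ht]
  refine integral_congr_ae ?_
  filter_upwards [ae_restrict_mem measurableSet_Ioc, ae_restrict_of_ae qi.ae_hasDerivAt_integral] with x hx hx2
  rw [(hx2 (by rw [Set.uIcc_of_le ht]; exact ⟨hx.1.le, hx.2⟩) 0 h0).deriv, intervalIntegral.integral_of_le hx.1.le]
  ring

section
variable {Ω : Type*} [m : MeasurableSpace Ω] {P : Measure Ω} [IsProbabilityMeasure P] {𝓕 : Filtration ℝ m}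

omit [IsProbabilityMeasure P] in
lemma swapL [IsProbabilityMeasure P] {h : ℝ × Ω → ℝ} (hm : Measurable h) {M a b : ℝ} (hM : ∀ s ∈ Ioc a b, ∀ ω, |h (s, ω)| ≤ M) :
    Integrable (fun ω => ∫ s in Ioc a b, h (s, ω)) P ∧ IntegrableOn (fun s => ∫ ω, h (s, ω) ∂P) (Ioc a b) ∧
    ∫ ω, (∫ s in Ioc a b, h (s, ω)) ∂P = ∫ s in Ioc a b, (∫ ω, h (s, ω) ∂P) := by
  have i : Integrable (fun z : Ω × ℝ => h (z.2, z.1)) (P.prod (volume.restrict (Ioc a b))) := by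
    refine Integrable.of_bound (hm.comp (measurable_snd.prodMk measurable_fst)).aestronglyMeasurable M ?_
    have : ∀ᵐ z : Ω × ℝ ∂(P.prod (volume.restrict (Ioc a b))), z.2 ∈ Ioc a b :=
      Measure.quasiMeasurePreserving_snd.ae (ae_restrict_mem measurableSet_Ioc)
    filter_upwards [this] with z hz
    exact hM _ hz _
  exact ⟨i.integral_prod_left, i.integral_prod_right, integral_integral_swap i⟩

lemma mart_orth {X : ℝ → Ω → ℝ} (hX : Martingale X 𝓕 P) {s t : ℝ} (h : s ≤ t) {Y : Ω → ℝ} (hY : StronglyMeasurable[𝓕 s] Y)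
    {M : ℝ} (hM : ∀ ω, |Y ω| ≤ M) : ∫ ω, X t ω * Y ω ∂P = ∫ ω, X s ω * Y ω ∂P := by
  have i : Integrable (fun ω => X t ω * Y ω) P := (hX.integrable t).mul_bdd
    (hY.mono (𝓕.le s)).aestronglyMeasurable (ae_of_all _ hM)
  have e := condExp_mul_of_stronglyMeasurable_right hY i (hX.integrable t)
  rw [← integral_condExp (𝓕.le s)]
  refine integral_congr_ae ?_
  filter_upwards [e, hX.2 s t h] with ω h1 h2
  have h1' : (P[fun ω => X t ω * Y ω|𝓕 s]) ω = (P[X t|𝓕 s] * Y) ω := h1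
  rw [h1', Pi.mul_apply, h2]

lemma l2_abs {G A Γ : ℝ × Ω → ℝ} (Gm : Measurable G) (Am : Measurable A) (Γm : Measurable Γ) {M : ℝ}
    (Gb : ∀ z, |G z| ≤ M) (Ab : ∀ z, |A z| ≤ M) (Γb : ∀ z, |Γ z| ≤ M)
    (hA : ∀ r, StronglyMeasurable[𝓕 r] (fun ω => A (r, ω)))
    (hX : Martingale (fun t ω => G (t, ω) - ∫ s in Ioc 0 t, A (s, ω)) 𝓕 P)
    (hZ : Martingale (fun t ω => G (t, ω) ^ 2 - ∫ s in Ioc 0 t, (2 * G (s, ω) * A (s, ω) + Γ (s, ω))) 𝓕 P)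
    {t : ℝ} (ht : 0 ≤ t) :
    ∫ ω, (G (t, ω) - ∫ s in Ioc 0 t, A (s, ω)) ^ 2 ∂P = ∫ ω, G (0, ω) ^ 2 ∂P + ∫ s in Ioc 0 t, (∫ ω, Γ (s, ω) ∂P) := by
  rcases isEmpty_or_nonempty Ω with hΩ | ⟨⟨ω0⟩⟩
  · simp [Measure.eq_zero_of_isEmpty P]
  have M0 : 0 ≤ M := (abs_nonneg _).trans (Gb (0, ω0))
  set H : ℝ × Ω → ℝ := fun z => ∫ s in Ioc 0 z.1, A (s, z.2) with hH
  have Hm : Measurable H := by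
    have e : H = fun z => ∫ s, (if 0 < s ∧ s ≤ z.1 then A (s, z.2) else 0) := by
      ext z
      rw [hH]; dsimp only
      rw [← integral_indicator measurableSet_Ioc]
      congr 1; ext s; simp [Set.indicator_apply]
    rw [e]
    refine (StronglyMeasurable.integral_prod_right' (ν := volume) (f := fun p : (ℝ × Ω) × ℝ => if 0 < p.2 ∧ p.2 ≤ p.1.1 then A (p.2, p.1.2) else 0) ?_).measurable
    refine (Measurable.ite ?_ (by fun_prop) measurable_const).stronglyMeasurable
    exact (measurableSet_lt measurable_const measurable_snd).inter (measurableSet_le measurable_snd (by fun_prop))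
  have Hb : ∀ s, 0 ≤ s → s ≤ t → ∀ ω, |H (s, ω)| ≤ M * t := fun s s0 st ω => by
    have := norm_setIntegral_le_of_norm_le_const (μ := volume) (s := Ioc 0 s) (f := fun r => A (r, ω)) (C := M) (by simp) (fun r _ => Ab _)
    refine this.trans ?_
    simp only [Real.volume_real_Ioc, sub_zero, max_eq_left s0]
    gcongr
  set X : ℝ × Ω → ℝ := fun z => G z - H z with hXd
  have Xm : Measurable X := Gm.sub Hm
  have Xb : ∀ s, 0 ≤ s → s ≤ t → ∀ ω, |X (s, ω)| ≤ M + M * t := fun s s0 st ω =>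
    (abs_sub _ _).trans (add_le_add (Gb _) (Hb s s0 st ω))
  have mk : ∀ {h : ℝ × Ω → ℝ}, Measurable h → ∀ s, Measurable (fun ω => h (s, ω)) := fun hm s => hm.comp (measurable_const.prodMk measurable_id)
  have mk2 : ∀ {h : ℝ × Ω → ℝ}, Measurable h → ∀ ω, Measurable (fun s => h (s, ω)) := fun hm ω => hm.comp (measurable_id.prodMk measurable_const)
  have pb : ∀ {x y a b : ℝ}, |x| ≤ a → |y| ≤ b → |x * y| ≤ a * b := fun hx hy => by
    rw [abs_mul]; exact mul_le_mul hx hy (abs_nonneg _) ((abs_nonneg _).trans hx)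
  have e1 := mart_E hZ ht
  obtain ⟨u1, u2, u3⟩ := swapL (P := P) (h := fun z => 2 * G z * A z + Γ z) (M := 2 * M * M + M) (a := 0) (b := t) (by fun_prop)
    (fun s _ ω => (abs_add_le _ _).trans (add_le_add (pb (by rw [abs_mul, abs_two]; linarith [Gb (s, ω)]) (Ab _)) (Γb _)))
  have G2 : ∀ s, Integrable (fun ω => G (s, ω) ^ 2) P := fun s =>
    Integrable.of_bound ((mk Gm s).pow_const 2).aestronglyMeasurable (M ^ 2) (ae_of_all _ fun ω => by
      rw [norm_pow]; exact pll (norm_nonneg _) (Gb _) 2)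
  rw [integral_sub (G2 t) u1, u3] at e1
  simp only [Set.Ioc_self, Measure.restrict_empty, integral_zero_measure, sub_zero] at e1
  obtain ⟨x1, x2, x3⟩ := swapL (P := P) (h := fun z => X (t, z.2) * A z) (M := (M + M * t) * M) (a := 0) (b := t)
    (((mk Xm t).comp measurable_snd).mul Am) (fun s _ ω => pb (Xb t ht le_rfl ω) (Ab _))
  obtain ⟨_, y2, _⟩ := swapL (P := P) (h := fun z => X z * A z) (M := (M + M * t) * M) (a := 0) (b := t)
    (Xm.mul Am) (fun s hs ω => pb (Xb s hs.1.le hs.2 ω) (Ab _))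
  obtain ⟨h1, h2, h3⟩ := swapL (P := P) (h := fun z => 2 * H z * A z) (M := (2 * (M * t)) * M) (a := 0) (b := t)
    (by fun_prop) (fun s hs ω => pb (by rw [abs_mul, abs_two]; linarith [Hb s hs.1.le hs.2 ω]) (Ab _))
  have x4 : ∫ s in Ioc 0 t, (∫ ω, X (t, ω) * A (s, ω) ∂P) = ∫ s in Ioc 0 t, (∫ ω, X (s, ω) * A (s, ω) ∂P) :=
    setIntegral_congr_fun measurableSet_Ioc fun s hs => mart_orth hX hs.2 (hA s) (fun ω => Ab _)
  have x5 : ∀ ω, ∫ s in Ioc 0 t, X (t, ω) * A (s, ω) = X (t, ω) * H (t, ω) := fun ω => integral_const_mul _ _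
  have h5 : ∀ ω, ∫ s in Ioc 0 t, 2 * H (s, ω) * A (s, ω) = H (t, ω) ^ 2 := fun ω =>
    (sq_prim (mk2 Am ω) (fun s => Ab _) ht).symm
  simp only [x5] at x3 x1
  simp only [h5] at h3 h1
  have e : ∀ ω, X (t, ω) ^ 2 = G (t, ω) ^ 2 - 2 * (X (t, ω) * H (t, ω)) - H (t, ω) ^ 2 := fun ω => by
    simp only [hXd]; ring
  change ∫ ω, X (t, ω) ^ 2 ∂P = _
  simp only [e]
  have i12 : Integrable (fun ω => G (t, ω) ^ 2 - 2 * (X (t, ω) * H (t, ω))) P := (G2 t).sub (x1.const_mul 2)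
  rw [integral_sub i12 h1, integral_sub (G2 t) (x1.const_mul 2), integral_const_mul, x3, h3, x4]
  have f : ∫ s in Ioc 0 t, (∫ ω, Γ (s, ω) ∂P) = ∫ s in Ioc 0 t, ((∫ ω, (2 * G (s, ω) * A (s, ω) + Γ (s, ω)) ∂P) -
      2 * (∫ ω, X (s, ω) * A (s, ω) ∂P) - ∫ ω, 2 * H (s, ω) * A (s, ω) ∂P) := by
    refine setIntegral_congr_fun measurableSet_Ioc fun s hs => ?_
    have j1 : Integrable (fun ω => 2 * G (s, ω) * A (s, ω) + Γ (s, ω)) P :=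
      Integrable.of_bound ((((mk Gm s).const_mul 2).mul (mk Am s)).add (mk Γm s)).aestronglyMeasurable (2 * M * M + M)
        (ae_of_all _ fun ω => (abs_add_le _ _).trans (add_le_add (pb (by rw [abs_mul, abs_two]; linarith [Gb (s, ω)]) (Ab _)) (Γb _)))
    have j2 : Integrable (fun ω => X (s, ω) * A (s, ω)) P :=
      Integrable.of_bound ((mk Xm s).mul (mk Am s)).aestronglyMeasurable _ (ae_of_all _ fun ω => pb (Xb s hs.1.le hs.2 ω) (Ab _))
    have j3 : Integrable (fun ω => 2 * H (s, ω) * A (s, ω)) P :=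
      Integrable.of_bound (((mk Hm s).const_mul 2).mul (mk Am s)).aestronglyMeasurable ((2 * (M * t)) * M) (ae_of_all _ fun ω =>
        pb (by rw [abs_mul, abs_two]; linarith [Hb s hs.1.le hs.2 ω]) (Ab _))
    have j12 : Integrable (fun ω => 2 * G (s, ω) * A (s, ω) + Γ (s, ω) - 2 * (X (s, ω) * A (s, ω))) P := j1.sub (j2.const_mul 2)
    rw [← integral_const_mul, ← integral_sub j1 (j2.const_mul 2), ← integral_sub j12 j3]
    congr 1; ext ω
    simp only [hXd]; ring
  have i34 : IntegrableOn (fun s => (∫ ω, (2 * G (s, ω) * A (s, ω) + Γ (s, ω)) ∂P) - 2 * (∫ ω, X (s, ω) * A (s, ω) ∂P)) (Ioc 0 t) :=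
    u2.sub (y2.const_mul 2)
  rw [f, integral_sub i34 h2, integral_sub u2 (y2.const_mul 2), integral_const_mul]
  linarith
end

section
variable {B : Vd d → Mv d} (hB : IsCollisionKernel B) (hd : 0 < d)
  {Ω : Type*} [m : MeasurableSpace Ω] {N : ℕ} {P : Measure Ω} [IsProbabilityMeasure P] {𝓕 : Filtration ℝ m}
  {μp : ℝ → Ω → Mv d} (hK : IsKacProcess B N P 𝓕 μp)
include hB hd hK

omit [IsProbabilityMeasure P] in
lemma K_Gam (hf : Gr k C f) :
    Measurable (fun z : ℝ × Ω => Gam B f (μp z.1 z.2)) ∧ ∀ z : ℝ × Ω, |Gam B f (μp z.1 z.2)| ≤ 16 * C ^ 2 * ((1 + √N) ^ (2 * k + 1) * (1 + √N) ^ (2 * k + 1)) := by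
  refine ⟨Gam_meas hB hd (K_joint hK) (fun z => K_prob hK z.1 z.2) hf.1, fun z => ?_⟩
  have h := hK.mem z.1 z.2
  have := h.1.1
  have a := emp_adm h (2 * k + 1)
  rw [(Gam_prod hB hd hf a).2]
  have i : Integrable (fun y : Vd d × Vd d => 16 * C ^ 2 * (pw y.1 ^ (2 * k + 1) * pw y.2 ^ (2 * k + 1))) ((μp z.1 z.2).prod (μp z.1 z.2)) :=
    (a.2.1.mul_prod a.2.1).const_mul _
  have b := norm_integral_le_of_norm_le i (f := fun z : Vd d × Vd d => ∫ σ, (dl f z.1 z.2 σ) ^ 2 ∂(B (z.1 - z.2)))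
    (ae_of_all _ fun y => sq_int_bound hB hd hf y.1 y.2)
  refine b.trans ?_
  rw [integral_const_mul, integral_prod_mul (fun v : Vd d => pw v ^ (2 * k + 1)) (fun v : Vd d => pw v ^ (2 * k + 1))]
  have := a.2.2
  have : 0 ≤ ∫ v, pw v ^ (2 * k + 1) ∂(μp z.1 z.2) := integral_nonneg fun v => (pow_nonneg (pw_pos v).le _)
  gcongr

lemma X_sq (hf : Gr k C f) {t : ℝ} (ht : 0 ≤ t) :
    ∫ ω, (Xf B μp f t ω) ^ 2 ∂P = ∫ ω, (∫ v, f v ∂(μp 0 ω)) ^ 2 ∂P +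
      ∫ s in Ioc 0 t, (∫ ω, (N:ℝ)⁻¹ * Gam B f (μp s ω) ∂P) := by
  obtain ⟨g1, g2⟩ := K_Gam hB hd hK hf
  have C0 := hf.nonneg
  refine l2_abs (G := fun z => ∫ v, f v ∂(μp z.1 z.2)) (A := fun z => QInt B f (μp z.1 z.2) (μp z.1 z.2)) (Γ := fun z => (N:ℝ)⁻¹ * Gam B f (μp z.1 z.2))
    (M := C * (1 + √N) ^ k + 4 * C * ((1 + √N) ^ (k + 1) * (1 + √N) ^ (k + 1)) + (N:ℝ)⁻¹ * (16 * C ^ 2 * ((1 + √N) ^ (2 * k + 1) * (1 + √N) ^ (2 * k + 1))))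
    (K_fm hK hf.1) (K_Qm hB hd hK hf.1) (g1.const_mul _) (fun z => (K_fb hK hf z.1 z.2).trans ?_)
    (fun z => (K_Qb hB hd hK hf z.1 z.2).trans ?_) (fun z => ?_) (fun r => ?_) (X_mart hB hd hK hf) (X2_mart hB hd hK hf) ht
  · have : 0 ≤ 4 * C * ((1 + √N) ^ (k + 1) * (1 + √N) ^ (k + 1)) + (N:ℝ)⁻¹ * (16 * C ^ 2 * ((1 + √N) ^ (2 * k + 1) * (1 + √N) ^ (2 * k + 1))) := by positivity
    linarith
  · have : 0 ≤ C * (1 + √N) ^ k + (N:ℝ)⁻¹ * (16 * C ^ 2 * ((1 + √N) ^ (2 * k + 1) * (1 + √N) ^ (2 * k + 1))) := by positivity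
    linarith
  · rw [abs_mul, abs_of_nonneg (by positivity : (0:ℝ) ≤ (N:ℝ)⁻¹)]
    have : 0 ≤ C * (1 + √N) ^ k + 4 * C * ((1 + √N) ^ (k + 1) * (1 + √N) ^ (k + 1)) := by positivity
    have := mll (g2 z) (by positivity : (0:ℝ) ≤ (N:ℝ)⁻¹)
    linarith
  · exact (@QInt_meas d f B hB hd Ω (𝓕 r) (μp r) (K_meas hK r) (K_prob hK r) hf.1).stronglyMeasurable

omit [IsProbabilityMeasure P] in
lemma X_bdd (hf : Gr k C f) (t : ℝ) : ∃ M, ∀ ω, |Xf B μp f t ω| ≤ M := by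
  refine ⟨C * (1 + √N) ^ k + 4 * C * ((1 + √N) ^ (k + 1) * (1 + √N) ^ (k + 1)) * volume.real (Ioc 0 t), fun ω => (abs_sub _ _).trans (add_le_add (K_fb hK hf t ω) ?_)⟩
  exact norm_setIntegral_le_of_norm_le_const (μ := volume) (s := Ioc 0 t) (f := fun r => QInt B f (μp r ω) (μp r ω)) (by simp) (fun r _ => K_Qb hB hd hK hf r ω)

lemma l2 (hf : Gr k C f) {s t : ℝ} (hs : 0 ≤ s) (ht : s ≤ t) :
    ∫ ω, (Xf B μp f t ω - Xf B μp f s ω) ^ 2 ∂P = (N:ℝ)⁻¹ * ∫ r in Ioc s t, (∫ ω, Gam B f (μp r ω) ∂P) := by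
  have X := X_mart hB hd hK hf
  obtain ⟨M, hM⟩ := X_bdd hB hd hK hf s
  obtain ⟨M', hM'⟩ := X_bdd hB hd hK hf t
  have o := mart_orth X ht (X.stronglyAdapted s) hM
  have i1 : Integrable (fun ω => Xf B μp f t ω * Xf B μp f s ω) P := (X.integrable t).mul_bdd (X.integrable s).1 (ae_of_all _ hM)
  have i2 : Integrable (fun ω => Xf B μp f s ω * Xf B μp f s ω) P := (X.integrable s).mul_bdd (X.integrable s).1 (ae_of_all _ hM)
  have i3 : Integrable (fun ω => Xf B μp f t ω * Xf B μp f t ω) P := (X.integrable t).mul_bdd (X.integrable t).1 (ae_of_all _ hM')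
  have e : ∀ ω, (Xf B μp f t ω - Xf B μp f s ω) ^ 2 = Xf B μp f t ω * Xf B μp f t ω - 2 * (Xf B μp f t ω * Xf B μp f s ω) + Xf B μp f s ω * Xf B μp f s ω := fun ω => by ring
  simp only [e]
  have i4 : Integrable (fun ω => Xf B μp f t ω * Xf B μp f t ω - 2 * (Xf B μp f t ω * Xf B μp f s ω)) P := i3.sub (i1.const_mul 2)
  rw [integral_add i4 i2, integral_sub i3 (i1.const_mul 2), integral_const_mul, o]
  have a1 := X_sq hB hd hK hf (hs.trans ht)
  have a2 := X_sq hB hd hK hf hs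
  simp only [sq (Xf B μp f _ _)] at a1 a2
  simp only [integral_const_mul] at a1 a2
  obtain ⟨g1, g2⟩ := K_Gam hB hd hK hf
  have I : ∀ b, IntegrableOn (fun r => ∫ ω, Gam B f (μp r ω) ∂P) (Ioc 0 b) := fun b =>
    (swapL (P := P) (h := fun z => Gam B f (μp z.1 z.2)) g1 (fun r _ ω => g2 (r, ω))).2.1
  have u : ∫ r in Ioc 0 t, (∫ ω, Gam B f (μp r ω) ∂P) = (∫ r in Ioc 0 s, (∫ ω, Gam B f (μp r ω) ∂P)) + ∫ r in Ioc s t, (∫ ω, Gam B f (μp r ω) ∂P) := by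
    rw [← Set.Ioc_union_Ioc_eq_Ioc hs ht, setIntegral_union (Set.Ioc_disjoint_Ioc_of_le le_rfl) measurableSet_Ioc (I s) ((I t).mono_set (Set.Ioc_subset_Ioc_left hs))]
  rw [a1, a2, u]
  ring
end

/-- cell index -/
def ix (k : ℕ) (v : Vd d) : Fin d → ℤ := fun i => ⌊2 ^ k * v i⌋

/-- cell corner -/
def pt (k : ℕ) (j : Fin d → ℤ) : Vd d := WithLp.toLp 2 (fun i => (j i : ℝ) / 2 ^ k)

/-- rounding -/
def xk (k : ℕ) (v : Vd d) : Vd d := pt k (ix k v)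

open Classical in
/-- cell indicator -/
def ce (k : ℕ) (j : Fin d → ℤ) (v : Vd d) : ℝ := if ix k v = j then 1 else 0

/-- box of cells -/
def bx (d N k : ℕ) : Finset (Fin d → ℤ) := Fintype.piFinset fun _ => Finset.Icc (-((2 ^ k * (2 * N + 1) : ℕ) : ℤ)) ((2 ^ k * (2 * N + 1) : ℕ) : ℤ)

/-- increment -/
def hk (g : Vf d) : ℕ → Vd d → ℝ
  | 0, y => g y
  | k + 1, y => g y - g (xk k y)

lemma xk_near (k : ℕ) (v : Vd d) : ‖v - xk k v‖ ≤ d / 2 ^ k := by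
  have p : (0:ℝ) < 2 ^ k := by positivity
  apply le_of_sq_le_sq _ (by positivity)
  rw [EuclideanSpace.norm_sq_eq]
  have : ∀ i, ‖(v - xk k v) i‖ ^ 2 ≤ (1 / 2 ^ k) ^ 2 := fun i => by
    refine pll (norm_nonneg _) ?_ 2
    have e : (v - xk k v) i = (2 ^ k * v i - ⌊2 ^ k * v i⌋) / 2 ^ k := by
      simp only [xk, pt, ix, PiLp.sub_apply]; field_simp
    rw [e, Real.norm_eq_abs, abs_div, abs_of_pos p]
    gcongr
    rw [abs_of_nonneg (by linarith [Int.floor_le ((2:ℝ) ^ k * v i)])]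
    linarith [Int.lt_floor_add_one ((2:ℝ) ^ k * v i)]
  refine (Finset.sum_le_sum fun i _ => this i).trans ?_
  simp only [Finset.sum_const, Finset.card_univ, Fintype.card_fin, nsmul_eq_mul]
  rw [div_pow, div_pow, mul_div_assoc', one_pow, mul_one]
  gcongr
  exact_mod_cast Nat.le_self_pow (by norm_num) d

lemma xk_pw (k : ℕ) (v : Vd d) : pw (xk k v) ≤ (1 + d) * pw v := by
  have h := xk_near k v
  have h1 : (d:ℝ) / 2 ^ k ≤ d := div_le_self (by positivity) (one_le_pow₀ (by norm_num))
  have h2 : ‖xk k v‖ ≤ ‖v‖ + ‖v - xk k v‖ := by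
    have := norm_sub_le v (v - xk k v); simpa using this
  unfold pw
  have := mul_nonneg (Nat.cast_nonneg (α := ℝ) d) (norm_nonneg v)
  nlinarith

lemma ix_pt (k : ℕ) (j : Fin d → ℤ) : ix k (pt k j) = j := by
  ext i
  have : (2:ℝ) ^ k * ((j i : ℝ) / 2 ^ k) = j i := by field_simp
  simp [ix, pt, this]

lemma xk_pt (k : ℕ) (j : Fin d → ℤ) : xk k (pt k j) = pt k j := by rw [xk, ix_pt]

lemma xk_xk (k : ℕ) (v : Vd d) : xk k (xk (k + 1) v) = xk k v := by
  have : ix k (xk (k + 1) v) = ix k v := by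
    ext i
    simp only [ix, xk, pt]
    have e : (2:ℝ) ^ k * ((⌊(2:ℝ) ^ (k + 1) * v i⌋ : ℝ) / 2 ^ (k + 1)) = (⌊(2:ℝ) ^ (k + 1) * v i⌋ : ℝ) / 2 := by
      rw [pow_succ]; field_simp
    rw [e, Int.floor_eq_iff]
    have a1 := Int.floor_le ((2:ℝ) ^ k * v i)
    have a2 := Int.lt_floor_add_one ((2:ℝ) ^ k * v i)
    have b1 : 2 * ⌊(2:ℝ) ^ k * v i⌋ ≤ ⌊(2:ℝ) ^ (k + 1) * v i⌋ := by
      rw [Int.le_floor]; push_cast; rw [pow_succ]; linarith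
    have b2 : ⌊(2:ℝ) ^ (k + 1) * v i⌋ < 2 * ⌊(2:ℝ) ^ k * v i⌋ + 2 := by
      rw [Int.floor_lt]; push_cast; rw [pow_succ]; linarith
    have b1' : 2 * (⌊(2:ℝ) ^ k * v i⌋ : ℝ) ≤ ⌊(2:ℝ) ^ (k + 1) * v i⌋ := by exact_mod_cast b1
    have b2' : (⌊(2:ℝ) ^ (k + 1) * v i⌋ : ℝ) < 2 * ⌊(2:ℝ) ^ k * v i⌋ + 2 := by exact_mod_cast b2
    constructor <;> linarith
  rw [xk, this, ← xk]

lemma mem_bx {N : ℕ} (k : ℕ) {v : Vd d} (h : ‖v‖ ≤ 2 * √N) : ix k v ∈ bx d N k := by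
  rw [bx, Fintype.mem_piFinset]
  intro i
  have h1 : |v i| ≤ 2 * N := by
    have a : ‖v i‖ ≤ ‖v‖ := PiLp.norm_apply_le v i
    rw [Real.norm_eq_abs] at a
    have : √(N:ℝ) ≤ N := by
      rw [Real.sqrt_le_left (by positivity)]
      exact_mod_cast Nat.le_self_pow (by norm_num) N
    linarith
  have p : (1:ℝ) ≤ 2 ^ k := one_le_pow₀ (by norm_num)
  obtain ⟨h2, h3⟩ := abs_le.1 h1
  rw [Finset.mem_Icc, ix, Int.le_floor]
  constructor
  · push_cast; nlinarith
  · have := Int.floor_le ((2:ℝ) ^ k * v i)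
    have : ((⌊(2:ℝ) ^ k * v i⌋ : ℤ) : ℝ) ≤ (((2 ^ k * (2 * N + 1) : ℕ) : ℤ) : ℝ) := by push_cast; nlinarith
    exact (Int.cast_le (R := ℝ)).1 this

lemma ix_meas (k : ℕ) : Measurable (ix k : Vd d → Fin d → ℤ) :=
  measurable_pi_lambda _ fun i => Int.measurable_floor.comp (by fun_prop)

lemma xk_meas (k : ℕ) : Measurable (xk k : Vd d → Vd d) :=
  (measurable_from_top (f := (pt k : (Fin d → ℤ) → Vd d))).comp (ix_meas k |>.mono le_rfl (by
    rw [← (inferInstance : DiscreteMeasurableSpace (Fin d → ℤ)).forall_measurableSet |> fun h => show (MeasurableSpace.pi : MeasurableSpace (Fin d → ℤ)) = ⊤ from top_le_iff.1 fun s _ => h s]))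

lemma ce_gr (k : ℕ) (j : Fin d → ℤ) : Gr 0 1 (ce k j : Vf d) := by
  have : Measurable (ce k j : Vf d) := by
    unfold ce
    exact Measurable.ite (ix_meas k (MeasurableSet.singleton j)) measurable_const measurable_const
  refine bdd_gr this fun v => ?_
  unfold ce; split_ifs <;> simp

lemma ce_nn (k : ℕ) (j : Fin d → ℤ) (v : Vd d) : 0 ≤ ce k j v ∧ ce k j v ^ 2 = ce k j v := by
  unfold ce; split_ifs <;> simp

lemma ce_sum {s : Finset (Fin d → ℤ)} (c : (Fin d → ℤ) → ℝ) {v : Vd d} (h : ix k v ∈ s) :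
    ∑ j ∈ s, c j * ce k j v = c (ix k v) := by
  rw [Finset.sum_eq_single (ix k v)]
  · simp [ce]
  · intro b _ hb; simp [ce, hb.symm]
  · intro h2; exact absurd h h2

lemma ce_sum_le (s : Finset (Fin d → ℤ)) {c : (Fin d → ℤ) → ℝ} (hc : ∀ j, 0 ≤ c j) (v : Vd d) :
    ∑ j ∈ s, c j * ce k j v ≤ c (ix k v) := by
  by_cases h : ix k v ∈ s
  · exact (ce_sum c h).le
  · rw [Finset.sum_eq_zero]; · exact hc _
    intro j hj
    have : ix k v ≠ j := fun e => h (e ▸ hj)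
    simp [ce, this]

lemma hk_tele (g : Vf d) (K : ℕ) (v : Vd d) : ∑ k ∈ Finset.range (K + 1), hk g k (xk k v) = g (xk K v) := by
  induction K with
  | zero => simp [hk]
  | succ K ih => rw [Finset.sum_range_succ, ih]; simp only [hk, xk_xk]; ring

lemma Lp.nonneg {g : Vf d} (h : Lp C g) : 0 ≤ C := h.gr.nonneg

lemma xk_diff {g : Vf d} (h : Lp C g) (k : ℕ) (v : Vd d) :
    |g v - g (xk k v)| ≤ C * (1 + d) ^ 4 / 2 ^ k * pw v ^ 6 := by
  have C0 := h.nonneg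
  refine (h.2 v (xk k v)).trans ?_
  have h1 := xk_near k v
  have h2 : pw (xk k v) ^ 3 ≤ ((1 + d) * pw v) ^ 3 := pll (pw_pos _).le (xk_pw k v) 3
  have p := pw_pos v
  have p' := pw_pos (xk k v)
  calc _ ≤ C * (d / 2 ^ k * (pw v ^ 3 * ((1 + d) * pw v) ^ 3)) := by gcongr
    _ = C * (d * (1 + d) ^ 3) / 2 ^ k * pw v ^ 6 := by ring
    _ ≤ C * (1 + d) ^ 4 / 2 ^ k * pw v ^ 6 := by
      gcongr
      rw [pow_succ' _ 3]; gcongr; linarith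

lemma hk_bound {g : Vf d} (h : Lp C g) (k : ℕ) (v : Vd d) :
    |hk g k v| ≤ C * (2 * (1 + d) ^ 4) / 2 ^ k * pw v ^ 6 := by
  have C0 := h.nonneg
  have p := pw_pos v
  cases k with
  | zero =>
    refine (h.1 v).trans ?_
    have : (1:ℝ) ≤ (1 + d) ^ 4 := one_le_pow₀ (by linarith [Nat.cast_nonneg (α := ℝ) d])
    rw [pow_zero, div_one]
    refine mul_le_mul (le_mul_of_one_le_right C0 (by linarith)) (pw_pow_mono v (by norm_num)) (by positivity) (by positivity)
  | succ k =>
    refine (xk_diff h k v).trans (le_of_eq ?_)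
    rw [pow_succ (2:ℝ)]; field_simp

/-- one-dimensional weight -/
lemma sum1 {m : ℝ} (hm : 1 ≤ m) (L : ℕ) :
    ∑ n ∈ Finset.Icc (-(L : ℤ)) L, (1 + ((n : ℝ) / m) ^ 2)⁻¹ ≤ 8 * m := by
  have m0 : 0 < m := by linarith
  have key : ∀ n : ℕ, (1 + ((n : ℝ) / m) ^ 2)⁻¹ ≤ 4 * m ^ 2 * (1 / (m + n) - 1 / (m + n + 1)) := fun n => by
    have n0 : (0:ℝ) ≤ n := by positivity
    have e1 : (1 + ((n : ℝ) / m) ^ 2)⁻¹ = m ^ 2 / (m ^ 2 + n ^ 2) := by field_simp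
    have e2 : 4 * m ^ 2 * (1 / (m + n) - 1 / (m + n + 1)) = 4 * m ^ 2 / ((m + n) * (m + n + 1)) := by
      field_simp; ring
    rw [e1, e2, div_le_div_iff₀ (by positivity) (by positivity)]
    have : (m + n) * (m + n + 1) ≤ 4 * (m ^ 2 + n ^ 2) := by nlinarith [sq_nonneg (m - n)]
    nlinarith [mll this (sq_nonneg m)]
  have : ∑ n ∈ Finset.Icc (-(L : ℤ)) L, (1 + ((n : ℝ) / m) ^ 2)⁻¹ ≤ 8 * m ^ 2 * (1 / m - 1 / (m + L + 1)) := by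
    induction L with
    | zero =>
      have := key 0
      simp only [Nat.cast_zero, add_zero] at this ⊢
      have p : 0 ≤ 1 / m - 1 / (m + 1) := by
        rw [sub_nonneg]; exact one_div_le_one_div_of_le m0 (by linarith)
      simp only [neg_zero, Finset.Icc_self, Finset.sum_singleton, Int.cast_zero]
      nlinarith [mul_nonneg (sq_nonneg m) p]
    | succ L ih =>
      have e : Finset.Icc (-((L + 1 : ℕ) : ℤ)) ((L + 1 : ℕ) : ℤ) = insert ((L + 1 : ℕ) : ℤ) (insert (-((L + 1 : ℕ) : ℤ)) (Finset.Icc (-(L : ℤ)) L)) := by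
        ext x; simp only [Finset.mem_Icc, Finset.mem_insert]; omega
      rw [e, Finset.sum_insert, Finset.sum_insert]
      · have := key (L + 1)
        push_cast at this ⊢
        rw [neg_add_rev, show (-1 + -(L:ℝ)) / m = -(((L:ℝ) + 1) / m) by ring, neg_sq]
        rw [show m + ((L:ℝ) + 1) = m + L + 1 by ring] at *
        linarith
      · simp
      · simp only [Finset.mem_insert, Finset.mem_Icc]; omega
  refine this.trans ?_
  have p : 0 ≤ 1 / (m + L + 1) := by positivity
  have : 8 * m ^ 2 * (1 / m) = 8 * m := by field_simp
  nlinarith [mul_nonneg (sq_nonneg m) p]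

lemma pt_weight (k : ℕ) (j : Fin d → ℤ) : (pw (pt k j) ^ (2 * d))⁻¹ ≤ ∏ i, (1 + ((j i : ℝ) / 2 ^ k) ^ 2)⁻¹ := by
  rw [Finset.prod_inv_distrib]
  refine inv_anti₀ (Finset.prod_pos fun i _ => by positivity) ?_
  rw [pow_mul]
  calc ∏ i, (1 + ((j i : ℝ) / 2 ^ k) ^ 2) ≤ ∏ _i : Fin d, pw (pt k j) ^ 2 := by
        refine Finset.prod_le_prod (fun i _ => by positivity) fun i _ => ?_
        have a : ‖(pt k j) i‖ ≤ ‖pt k j‖ := PiLp.norm_apply_le (pt k j) i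
        have b : (pt k j) i = (j i : ℝ) / 2 ^ k := rfl
        rw [← b, ← sq_abs, ← Real.norm_eq_abs]
        unfold pw
        nlinarith [norm_nonneg ((pt k j) i), norm_nonneg (pt k j)]
    _ = _ := by simp

lemma sum_weight (N k : ℕ) : ∑ j ∈ bx d N k, (pw (pt k j) ^ (2 * d))⁻¹ ≤ (8 * 2 ^ k) ^ d := by
  refine (Finset.sum_le_sum fun j _ => pt_weight k j).trans ?_
  rw [bx, ← Finset.prod_univ_sum (fun _ : Fin d => Finset.Icc (-((2 ^ k * (2 * N + 1) : ℕ) : ℤ)) ((2 ^ k * (2 * N + 1) : ℕ) : ℤ))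
    (fun _ n => (1 + ((n : ℝ) / 2 ^ k) ^ 2)⁻¹)]
  refine (Finset.prod_le_prod (fun i _ => Finset.sum_nonneg fun n _ => by positivity) fun i _ => sum1 (one_le_pow₀ (by norm_num)) _).trans ?_
  simp

/-- index set of all cells -/
def sg (d N K : ℕ) : Finset (Σ _ : ℕ, Fin d → ℤ) := (Finset.range (K + 1)).sigma (bx d N)

/-- weighted cell sum -/
def SS {Ω : Type*} (B : Vd d → Mv d) (μp : ℝ → Ω → Mv d) (N K : ℕ) (τ t : ℝ) (ω : Ω) : ℝ :=
  ∑ p ∈ sg d N K, (2 ^ p.1)⁻¹ * pw (pt p.1 p.2) ^ 6 * |Xf B μp (ce p.1 p.2) t ω - Xf B μp (ce p.1 p.2) τ ω|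

section
variable {B : Vd d → Mv d} (hB : IsCollisionKernel B) (hd : 0 < d)
  {Ω : Type*} [m : MeasurableSpace Ω] {N : ℕ} {P : Measure Ω} [IsProbabilityMeasure P] {𝓕 : Filtration ℝ m}
  {μp : ℝ → Ω → Mv d} (hK : IsKacProcess B N P 𝓕 μp)
include hB hd hK

omit [IsProbabilityMeasure P] in
lemma K_Qi (hf : Gr k C f) (a b : ℝ) (ω : Ω) :
    IntegrableOn (fun s => QInt B f (μp s ω) (μp s ω)) (Ioc a b) :=
  Measure.integrableOn_of_bounded (M := 4 * C * ((1 + √N) ^ (k + 1) * (1 + √N) ^ (k + 1))) (by simp)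
    ((K_Qm hB hd hK hf.1).comp (g := fun z : ℝ × Ω => QInt B f (μp z.1 z.2) (μp z.1 z.2)) (f := fun s => (s, ω)) (by fun_prop)).aestronglyMeasurable
    (ae_of_all _ fun s => K_Qb hB hd hK hf s ω)

omit [IsProbabilityMeasure P] in
lemma Mg_X (hf : Gr k C f) {τ t : ℝ} (h0 : 0 ≤ τ) (h : τ ≤ t) (ω : Ω) :
    Mg B (fun s => μp s ω) τ f t = Xf B μp f t ω - Xf B μp f τ ω := by
  unfold Mg Xf
  rw [← Set.Ioc_union_Ioc_eq_Ioc h0 h, setIntegral_union (Set.Ioc_disjoint_Ioc_of_le le_rfl) measurableSet_Ioc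
    (K_Qi hB hd hK hf _ _ ω) (K_Qi hB hd hK hf _ _ ω)]
  ring

omit [IsProbabilityMeasure P] in
lemma X_lin {C D : ℝ} {f g : Vf d} (hf : Gr k C f) (hg : Gr k D g) (a b : ℝ) (t : ℝ) (ω : Ω) :
    Xf B μp (fun v => a * f v + b * g v) t ω = a * Xf B μp f t ω + b * Xf B μp g t ω := by
  have e : ∀ s, QInt B (fun v => a * f v + b * g v) (μp s ω) (μp s ω) = a * QInt B f (μp s ω) (μp s ω) + b * QInt B g (μp s ω) (μp s ω) :=
    fun s => QInt_lin hB hd hf hg a b (emp_adm (hK.mem s ω) _) (emp_adm (hK.mem s ω) _)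
  unfold Xf
  simp only [e]
  rw [integral_add ((hf.integrable (emp_adm (hK.mem t ω) _)).const_mul a) ((hg.integrable (emp_adm (hK.mem t ω) _)).const_mul b),
    integral_add ((K_Qi hB hd hK hf 0 t ω).const_mul a) ((K_Qi hB hd hK hg 0 t ω).const_mul b)]
  simp only [integral_const_mul]
  ring

omit [IsProbabilityMeasure P] in
lemma X_sum {ι : Type*} (s : Finset ι) (c : ι → ℝ) {f : ι → Vd d → ℝ} (hf : ∀ i, Gr 0 1 (f i)) (t : ℝ) (ω : Ω) :
    (∃ C, Gr 0 C (fun v => ∑ i ∈ s, c i * f i v)) ∧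
    Xf B μp (fun v => ∑ i ∈ s, c i * f i v) t ω = ∑ i ∈ s, c i * Xf B μp (f i) t ω := by
  classical
  induction s using Finset.induction_on with
  | empty =>
    refine ⟨⟨0, measurable_const, fun v => by simp⟩, ?_⟩
    simp [Xf, QInt]
  | insert i s hi ih =>
    obtain ⟨⟨C, hC⟩, e⟩ := ih
    simp only [Finset.sum_insert hi]
    refine ⟨⟨_, ((hf i).smul (c i)).add hC⟩, ?_⟩
    have := X_lin hB hd hK (hf i) hC (c i) 1 t ω
    simp only [one_mul] at this
    rw [this, e]

omit [IsProbabilityMeasure P] in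
lemma X_cut {f g : Vf d} (h : ∀ v : Vd d, ‖v‖ ≤ 2 * √N → f v = g v) (t : ℝ) (ω : Ω) : Xf B μp f t ω = Xf B μp g t ω := by
  have e : cut N f = cut N g := by ext v; unfold cut; split_ifs with hv; exacts [h v hv, rfl]
  have e1 : ∀ s, QInt B f (μp s ω) (μp s ω) = QInt B g (μp s ω) (μp s ω) := fun s => by
    rw [← cut_QInt hB hd (hK.mem s ω) f, e, cut_QInt hB hd (hK.mem s ω) g]
  unfold Xf
  simp only [e1]
  rw [← cut_int (hK.mem t ω) f, e, cut_int (hK.mem t ω) g]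

omit [IsProbabilityMeasure P] in
lemma dec {R : ℝ} {g : Vf d} (hg : Lp C g) (K : ℕ) {τ t : ℝ} (h0 : 0 ≤ τ) (h : τ ≤ t) (ω : Ω)
    (hR : ∀ s ∈ Icc τ t, Adm (μp s ω) 8 R) :
    |Mg B (fun s => μp s ω) τ g t| ≤ C * (2 * (1 + d) ^ 4) * SS B μp N K τ t ω +
      C * (1 + d) ^ 4 / 2 ^ K * (2 * R + 4 * (t - τ) * R ^ 2) := by
  have C0 := hg.nonneg
  have gx : Gr 3 (C * (1 + d) ^ 3) (fun v => g (xk K v)) := ⟨hg.meas.comp (xk_meas K), fun v => (hg.1 _).trans (by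
    rw [mul_assoc, ← mul_pow]; exact mll (pll (pw_pos _).le (xk_pw K v) 3) C0)⟩
  set c : (Σ _ : ℕ, Fin d → ℤ) → ℝ := fun p => hk g p.1 (pt p.1 p.2) with hc
  have e1 : ∀ u, Xf B μp (fun v => g (xk K v)) u ω = ∑ p ∈ sg d N K, c p * Xf B μp (ce p.1 p.2) u ω := fun u => by
    rw [← (X_sum hB hd hK (sg d N K) c (f := fun p => ce p.1 p.2) (fun p => ce_gr _ _) u ω).2]
    refine X_cut hB hd hK (fun v hv => ?_) u ω
    rw [sg, Finset.sum_sigma, ← hk_tele g K v]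
    exact Finset.sum_congr rfl fun k _ => (ce_sum (fun j => hk g k (pt k j)) (mem_bx k hv)).symm
  have r3 := hg.gr.sub gx
  have r6 : Gr 6 (C * (1 + d) ^ 4 / 2 ^ K) (fun v => g v - g (xk K v)) := ⟨r3.1, xk_diff hg K⟩
  have e2 : ∀ u, Xf B μp g u ω = Xf B μp (fun v => g (xk K v)) u ω + Xf B μp (fun v => g v - g (xk K v)) u ω := fun u => by
    have := X_lin hB hd hK gx r3 1 1 u ω
    simp only [one_mul, add_sub_cancel] at this
    exact this
  have e3 : Mg B (fun s => μp s ω) τ g t = ∑ p ∈ sg d N K, c p * (Xf B μp (ce p.1 p.2) t ω - Xf B μp (ce p.1 p.2) τ ω) +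
      Mg B (fun s => μp s ω) τ (fun v => g v - g (xk K v)) t := by
    rw [Mg_X hB hd hK hg.gr h0 h, Mg_X hB hd hK r6 h0 h, e2, e2, e1, e1]
    simp only [mul_sub, Finset.sum_sub_distrib]; ring
  rw [e3]
  refine (abs_add_le _ _).trans (add_le_add ?_ ?_)
  · refine (Finset.abs_sum_le_sum_abs _ _).trans ?_
    rw [SS, Finset.mul_sum]
    refine Finset.sum_le_sum fun p _ => ?_
    rw [abs_mul]
    refine (mlr (hk_bound hg p.1 (pt p.1 p.2)) (abs_nonneg _)).trans (le_of_eq ?_)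
    rw [div_eq_mul_inv]; ring
  · set D := C * (1 + d) ^ 4 / 2 ^ K with hD
    have b : ∀ s ∈ Icc τ t, |∫ v, (g v - g (xk K v)) ∂(μp s ω)| ≤ D * R := fun s hs => r6.bound ((hR s hs).mono (by norm_num) le_rfl)
    have b2 := norm_setIntegral_le_of_norm_le_const (μ := volume) (s := Ioc τ t) (C := 4 * D * (R * R))
      (f := fun s => QInt B (fun v => g v - g (xk K v)) (μp s ω) (μp s ω)) (by simp) (fun s hs => QInt_bound hB hd r6
        ((hR s ⟨hs.1.le, hs.2⟩).mono (by norm_num) le_rfl) ((hR s ⟨hs.1.le, hs.2⟩).mono (by norm_num) le_rfl))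
    rw [Real.norm_eq_abs, Measure.real, Real.volume_Ioc, ENNReal.toReal_ofReal (by linarith)] at b2
    have b3 := b t ⟨h, le_rfl⟩
    have b4 := b τ ⟨le_rfl, h⟩
    unfold Mg
    have := abs_sub (∫ v, (g v - g (xk K v)) ∂(μp t ω) - ∫ v, (g v - g (xk K v)) ∂(μp τ ω)) (∫ s in Ioc τ t, QInt B (fun v => g v - g (xk K v)) (μp s ω) (μp s ω))
    have := abs_sub (∫ v, (g v - g (xk K v)) ∂(μp t ω)) (∫ v, (g v - g (xk K v)) ∂(μp τ ω))
    nlinarith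

end

lemma int_sq_le {μ : Mv d} {n : ℕ} {R : ℝ} (h : Adm μ (2 * n) R) : (∫ v, pw v ^ n ∂μ) ^ 2 ≤ ∫ v, pw v ^ (2 * n) ∂μ := by
  have := h.1
  have i := (h.mono (l := n) (by omega) le_rfl).2.1
  set a := ∫ v, pw v ^ n ∂μ with ha
  have i2 : Integrable (fun v => 2 * a * pw v ^ n - a ^ 2) μ := (i.const_mul (2 * a)).sub (integrable_const _)
  have := integral_mono i2 h.2.1 (fun v => by
    show 2 * a * pw v ^ n - a ^ 2 ≤ pw v ^ (2 * n)
    rw [mul_comm 2 n, pow_mul]; nlinarith [sq_nonneg (pw v ^ n - a)])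
  rw [integral_sub (i.const_mul _) (integrable_const _), integral_const_mul, ← ha] at this
  simp at this
  nlinarith

lemma ce_w (k q : ℕ) (s : Finset (Fin d → ℤ)) {u : Vd d} {x : ℝ} (h : pw u ≤ x) :
    ∑ j ∈ s, pw (pt k j) ^ q * ce k j u ≤ (1 + d) ^ q * x ^ q := by
  refine (ce_sum_le s (c := fun j => pw (pt k j) ^ q) (fun j => pow_nonneg (pw_pos _).le _) u).trans ?_
  rw [← mul_pow]
  exact pll (pw_pos _).le ((xk_pw k u).trans (by gcongr)) q

section
variable {B : Vd d → Mv d} (hB : IsCollisionKernel B) (hd : 0 < d)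
include hB hd

lemma Gam_sum (k q : ℕ) (s : Finset (Fin d → ℤ)) {μ : Mv d} {R : ℝ} (h : Adm μ (2 * (q + 1)) R) :
    ∑ j ∈ s, pw (pt k j) ^ q * Gam B (ce k j) μ ≤ 16 * (1 + d) ^ q * ∫ v, pw v ^ (2 * (q + 1)) ∂μ := by
  have := h.1
  have h1 := h.mono (l := 2 * 0 + 1) (by omega) le_rfl
  have hq := h.mono (l := q + 1) (by omega) le_rfl
  have e : ∀ j, pw (pt k j) ^ q * Gam B (ce k j) μ = ∫ z : Vd d × Vd d, pw (pt k j) ^ q * ∫ σ, (dl (ce k j) z.1 z.2 σ) ^ 2 ∂(B (z.1 - z.2)) ∂(μ.prod μ) :=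
    fun j => by rw [(Gam_prod hB hd (ce_gr k j) h1).2, integral_const_mul]
  simp only [e]
  rw [← integral_finsetSum _ fun j _ => ((Gam_prod hB hd (ce_gr k j) h1).1.const_mul _)]
  have i : Integrable (fun y : Vd d × Vd d => 16 * (1 + (d:ℝ)) ^ q * (pw y.1 ^ (q + 1) * pw y.2 ^ (q + 1))) (μ.prod μ) :=
    (hq.2.1.mul_prod hq.2.1).const_mul _
  refine (integral_mono (integrable_finsetSum _ fun j _ => ((Gam_prod hB hd (ce_gr k j) h1).1.const_mul _)) i fun z => ?_).trans ?_
  · obtain ⟨v, w⟩ := z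
    have sb : ∀ j, Integrable (fun σ => pw (pt k j) ^ q * dl (ce k j) v w σ ^ 2) (B (v - w)) := fun j =>
      (B_integrable hB hd (v - w) ((dl_meas1 (ce_gr k j).1 v w).pow_const 2) ((4 * 1 * (pw v ^ 0 * pw w ^ 0)) ^ 2) fun σ hσ => by
        rw [abs_pow]; exact pll (abs_nonneg _) (dl_bound (ce_gr k j) v w σ hσ) _).const_mul _
    simp only [← integral_const_mul]
    show ∑ j ∈ s, ∫ σ, pw (pt k j) ^ q * dl (ce k j) v w σ ^ 2 ∂(B (v - w)) ≤ 16 * (1 + (d:ℝ)) ^ q * (pw v ^ (q + 1) * pw w ^ (q + 1))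
    rw [← integral_finsetSum _ fun j _ => sb j]
    have S0 : ∀ σ, 0 ≤ ∑ j ∈ s, pw (pt k j) ^ q * dl (ce k j) v w σ ^ 2 := fun σ =>
      Finset.sum_nonneg fun j _ => mul_nonneg (pow_nonneg (pw_pos _).le _) (sq_nonneg _)
    refine (le_abs_self _).trans ((B_int_le hB hd (v - w) _ (16 * ((1 + d) ^ q * (pw v * pw w) ^ q)) fun σ hσ => ?_).trans ?_)
    · rw [abs_of_nonneg (S0 σ)]
      have p := pw_post_le v w σ hσ
      have a1 := ce_w k q s p.1
      have a2 := ce_w k q s p.2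
      have a3 := ce_w k q s (u := v) (x := pw v * pw w) (le_mul_of_one_le_right (pw_pos v).le (pw_one_le w))
      have a4 := ce_w k q s (u := w) (x := pw v * pw w) (le_mul_of_one_le_left (pw_pos w).le (pw_one_le v))
      have : ∑ j ∈ s, pw (pt k j) ^ q * dl (ce k j) v w σ ^ 2 ≤ 4 * (∑ j ∈ s, pw (pt k j) ^ q * ce k j (postV v w σ) +
          ∑ j ∈ s, pw (pt k j) ^ q * ce k j (postVs v w σ) + ∑ j ∈ s, pw (pt k j) ^ q * ce k j v + ∑ j ∈ s, pw (pt k j) ^ q * ce k j w) := by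
        rw [← Finset.sum_add_distrib, ← Finset.sum_add_distrib, ← Finset.sum_add_distrib, Finset.mul_sum]
        refine Finset.sum_le_sum fun j _ => ?_
        simp only [← mul_add]
        rw [mul_left_comm]
        refine mll ?_ (pow_nonneg (pw_pos _).le _)
        unfold dl
        have c1 := (ce_nn k j (postV v w σ)).2
        have c2 := (ce_nn k j (postVs v w σ)).2
        have c3 := (ce_nn k j v).2
        have c4 := (ce_nn k j w).2
        generalize ce k j (postV v w σ) = a at *
        generalize ce k j (postVs v w σ) = b at *
        generalize ce k j v = c at *
        generalize ce k j w = e at *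
        nlinarith [sq_nonneg (a - b), sq_nonneg (a + c), sq_nonneg (a + e), sq_nonneg (b + c), sq_nonneg (b + e), sq_nonneg (c - e)]
      linarith
    · have : 0 ≤ 16 * ((1 + (d:ℝ)) ^ q * (pw v * pw w) ^ q) := by
        have := pw_pos v; have := pw_pos w; positivity
      refine (mlr (norm_sub_le_pw v w) this).trans (le_of_eq ?_)
      ring
  · rw [integral_const_mul, integral_prod_mul (fun v : Vd d => pw v ^ (q + 1)) (fun v : Vd d => pw v ^ (q + 1)), ← sq]
    exact mll (int_sq_le h) (by positivity)

variable {Ω : Type*} [m : MeasurableSpace Ω] {N : ℕ} {P : Measure Ω} [IsProbabilityMeasure P] {𝓕 : Filtration ℝ m}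
  {μp : ℝ → Ω → Mv d} (hK : IsKacProcess B N P 𝓕 μp)
include hK

lemma E_cell (k : ℕ) (s : Finset (Fin d → ℤ)) (q : ℕ) {A τ T : ℝ} (h0 : 0 ≤ τ) (h : τ ≤ T)
    (hA : ∀ t ∈ Icc τ T, ∫ ω, (∫ v, pw v ^ (2 * (q + 1)) ∂(μp t ω)) ∂P ≤ A) :
    ∑ j ∈ s, pw (pt k j) ^ q * ∫ ω, (Xf B μp (ce k j) T ω - Xf B μp (ce k j) τ ω) ^ 2 ∂P ≤ (N:ℝ)⁻¹ * ((T - τ) * (16 * (1 + d) ^ q * A)) := by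
  have iG : ∀ j, IntegrableOn (fun r => ∫ ω, Gam B (ce k j) (μp r ω) ∂P) (Ioc τ T) := fun j =>
    (swapL (P := P) (h := fun z => Gam B (ce k j) (μp z.1 z.2)) (K_Gam hB hd hK (ce_gr k j)).1 (fun r _ ω => (K_Gam hB hd hK (ce_gr k j)).2 (r, ω))).2.1
  have iG2 : ∀ j r, Integrable (fun ω => Gam B (ce k j) (μp r ω)) P := fun j r =>
    Integrable.of_bound ((K_Gam hB hd hK (ce_gr k j)).1.comp (g := fun z : ℝ × Ω => Gam B (ce k j) (μp z.1 z.2)) (f := fun ω => (r, ω)) (by fun_prop)).aestronglyMeasurable _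
    (ae_of_all _ fun ω => (K_Gam hB hd hK (ce_gr k j)).2 (r, ω))
  have e : ∑ j ∈ s, pw (pt k j) ^ q * ∫ ω, (Xf B μp (ce k j) T ω - Xf B μp (ce k j) τ ω) ^ 2 ∂P =
      (N:ℝ)⁻¹ * ∫ r in Ioc τ T, ∑ j ∈ s, pw (pt k j) ^ q * ∫ ω, Gam B (ce k j) (μp r ω) ∂P := by
    rw [integral_finsetSum _ fun j _ => (iG j).const_mul _, Finset.mul_sum]
    refine Finset.sum_congr rfl fun j _ => ?_
    rw [l2 hB hd hK (ce_gr k j) h0 h, integral_const_mul]; ring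
  rw [e]
  refine mll ?_ (by positivity)
  have : ∀ r ∈ Ioc τ T, ∑ j ∈ s, pw (pt k j) ^ q * ∫ ω, Gam B (ce k j) (μp r ω) ∂P ≤ 16 * (1 + d) ^ q * A := fun r hr => by
    simp only [← integral_const_mul]
    rw [← integral_finsetSum _ fun j _ => (iG2 j r).const_mul _]
    have g : Gr (2 * (q + 1)) 1 (fun v : Vd d => pw v ^ (2 * (q + 1))) := ⟨pw_meas.pow_const _, fun v => by
      rw [abs_of_nonneg (pow_nonneg (pw_pos v).le _), one_mul]⟩
    refine (integral_mono (integrable_finsetSum _ fun j _ => (iG2 j r).const_mul _) ((K_fi hK g r).const_mul (16 * (1 + (d:ℝ)) ^ q))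
      fun ω => Gam_sum hB hd k q s (emp_adm (hK.mem r ω) _)).trans ?_
    rw [integral_const_mul]
    exact mll (hA r ⟨hr.1.le, hr.2⟩) (by positivity)
  refine (setIntegral_mono_on (integrable_finsetSum _ fun j _ => (iG j).const_mul _) (integrableOn_const (C := 16 * (1 + (d:ℝ)) ^ q * A) (by simp)) measurableSet_Ioc this).trans (le_of_eq ?_)
  rw [setIntegral_const, Measure.real, Real.volume_Ioc, ENNReal.toReal_ofReal (by linarith), smul_eq_mul]

omit [IsProbabilityMeasure P] in
lemma X_di (hf : Gr k C f) (τ t : ℝ) :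
    Integrable (fun ω => Xf B μp f t ω - Xf B μp f τ ω) P := ((X_mart hB hd hK hf).integrable t).sub ((X_mart hB hd hK hf).integrable τ)

lemma E_SS (N0 : 0 < N) (K : ℕ) {A τ T : ℝ} (h0 : 0 ≤ τ) (h : τ ≤ T)
    (hA : ∀ t ∈ Icc τ T, ∫ ω, (∫ v, pw v ^ (2 * (12 + 2 * d + 1)) ∂(μp t ω)) ∂P ≤ A) :
    ∫ ω, SS B μp N K τ T ω ∂P ≤ (8 ^ d + (T - τ) * (16 * (1 + d) ^ (12 + 2 * d) * A)) *
      ∑ k ∈ Finset.range (K + 1), (2 ^ k)⁻¹ * √(2 ^ (k * d)) / √N := by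
  have nn : 0 < √(N:ℝ) := by positivity
  have n2 : √(N:ℝ) * √N = N := Real.mul_self_sqrt (by positivity)
  unfold SS
  rw [integral_finsetSum _ fun p _ => ((X_di hB hd hK (ce_gr p.1 p.2) τ T).abs.const_mul _), sg, Finset.sum_sigma, Finset.mul_sum]
  refine Finset.sum_le_sum fun k _ => ?_
  set L := √(2 ^ (k * d) : ℝ) with hL
  have L0 : 0 < L := by positivity
  have L2 : L * L = 2 ^ (k * d) := Real.mul_self_sqrt (by positivity)
  set E1 := fun j => ∫ ω, (Xf B μp (ce k j) T ω - Xf B μp (ce k j) τ ω) ^ 2 ∂P with hE1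
  have cell : ∀ j, ∫ ω, (2 ^ k)⁻¹ * pw (pt k j) ^ 6 * |Xf B μp (ce k j) T ω - Xf B μp (ce k j) τ ω| ∂P ≤
      (2 ^ k)⁻¹ * ((L * √N)⁻¹ * (pw (pt k j) ^ (2 * d))⁻¹ + (L * √N) * (pw (pt k j) ^ (12 + 2 * d) * E1 j)) := fun j => by
    obtain ⟨M, hM⟩ := X_bdd hB hd hK (ce_gr k j) T
    obtain ⟨M', hM'⟩ := X_bdd hB hd hK (ce_gr k j) τ
    have i1 := X_di hB hd hK (ce_gr k j) τ T
    have i2 : Integrable (fun ω => (Xf B μp (ce k j) T ω - Xf B μp (ce k j) τ ω) ^ 2) P := by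
      simp only [sq]
      exact i1.mul_bdd i1.1 (ae_of_all _ fun ω => (abs_sub _ _).trans (add_le_add (hM ω) (hM' ω)))
    have y0 := pw_pos (pt k j)
    set y := pw (pt k j) with hy
    have i3 : Integrable (fun ω => (L * √N)⁻¹ * (y ^ (2 * d))⁻¹ + L * √N * (y ^ (12 + 2 * d) * (Xf B μp (ce k j) T ω - Xf B μp (ce k j) τ ω) ^ 2)) P :=
      (integrable_const _).add ((i2.const_mul _).const_mul _)
    have hl : 0 < L * √N := by positivity
    simp only [mul_assoc ((2:ℝ) ^ k)⁻¹]
    rw [integral_const_mul]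
    refine mll ((integral_mono (i1.abs.const_mul _) i3 fun ω => ?_).trans (le_of_eq ?_)) (by positivity)
    · generalize Xf B μp (ce k j) T ω - Xf B μp (ce k j) τ ω = x
      generalize L * √N = l at hl
      show y ^ 6 * |x| ≤ l⁻¹ * (y ^ (2 * d))⁻¹ + l * (y ^ (12 + 2 * d) * x ^ 2)
      have e : l⁻¹ * (y ^ (2 * d))⁻¹ + l * (y ^ (12 + 2 * d) * x ^ 2) - 2 * (y ^ 6 * |x|) = l⁻¹ * (y ^ (2 * d))⁻¹ * (1 - l * y ^ (6 + 2 * d) * |x|) ^ 2 := by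
        rw [← sq_abs x, pow_add, pow_add]; field_simp; ring
      have : 0 ≤ l⁻¹ * (y ^ (2 * d))⁻¹ * (1 - l * y ^ (6 + 2 * d) * |x|) ^ 2 := by positivity
      have : 0 ≤ y ^ 6 * |x| := by positivity
      linarith
    · have c : Integrable (fun _ : Ω => (L * √N)⁻¹ * (y ^ (2 * d))⁻¹) P := integrable_const _
      rw [integral_add c ((i2.const_mul _).const_mul _), integral_const_mul]
      simp [hE1, integral_const_mul]
  refine (Finset.sum_le_sum fun j _ => cell j).trans ?_
  rw [← Finset.mul_sum, Finset.sum_add_distrib, ← Finset.mul_sum, ← Finset.mul_sum]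
  have a1 := sum_weight (d := d) N k
  have a2 := E_cell hB hd hK k (bx d N k) (12 + 2 * d) h0 h hA
  have e1 : (8 * (2:ℝ) ^ k) ^ d = 8 ^ d * (L * L) := by rw [L2, mul_pow, pow_mul]
  rw [e1] at a1
  set Z := (T - τ) * (16 * (1 + (d:ℝ)) ^ (12 + 2 * d) * A) with hZ
  calc _ ≤ (2 ^ k)⁻¹ * ((L * √N)⁻¹ * (8 ^ d * (L * L)) + (L * √N) * ((N:ℝ)⁻¹ * Z)) := by gcongr
    _ = _ := by rw [show (N:ℝ)⁻¹ = (√(N:ℝ))⁻¹ * (√(N:ℝ))⁻¹ by rw [← mul_inv, n2]]; field_simp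
end

section
variable {Ω : Type*} [m : MeasurableSpace Ω] {P : Measure Ω} [IsProbabilityMeasure P] {𝓕 : Filtration ℝ m}

/-- sampled filtration -/
def smp (𝓕 : Filtration ℝ m) (φ : ℕ → ℝ) (h : Monotone φ) : Filtration ℕ m :=
  ⟨fun i => 𝓕 (φ i), fun _ _ hij => 𝓕.mono (h hij), fun i => 𝓕.le (φ i)⟩

lemma smp_mart {X : ℝ → Ω → ℝ} (hX : Martingale X 𝓕 P) {φ : ℕ → ℝ} (h : Monotone φ) :
    Martingale (fun i ω => X (φ i) ω - X (φ 0) ω) (smp 𝓕 φ h) P := by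
  have h1 : Martingale (fun i => X (φ i)) (smp 𝓕 φ h) P := ⟨fun i => hX.1 (φ i), fun i j hij => hX.2 (φ i) (φ j) (h hij)⟩
  have h2 : Martingale (fun _ : ℕ => X (φ 0)) (smp 𝓕 φ h) P := by
    have s : ∀ i, StronglyMeasurable[smp 𝓕 φ h i] (X (φ 0)) := fun i => (hX.1 (φ 0)).mono (𝓕.mono (h (Nat.zero_le i)))
    refine ⟨s, fun i j _ => ?_⟩
    rw [condExp_of_stronglyMeasurable ((smp 𝓕 φ h).le i) (s i) (hX.integrable _)]
  exact h1.sub h2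

lemma smp_sub {ι : Type*} (s : Finset ι) {w : ι → ℝ} (hw : ∀ p, 0 ≤ w p) {X : ι → ℝ → Ω → ℝ} (hX : ∀ p, Martingale (X p) 𝓕 P)
    {φ : ℕ → ℝ} (h : Monotone φ) :
    Submartingale (fun i ω => ∑ p ∈ s, w p * |X p (φ i) ω - X p (φ 0) ω|) (smp 𝓕 φ h) P := by
  classical
  induction s using Finset.induction_on with
  | empty => simpa using (martingale_const (smp 𝓕 φ h) P (0:ℝ)).submartingale
  | insert p s hp ih =>
    simp only [Finset.sum_insert hp]
    have M := smp_mart (hX p) h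
    exact ((M.submartingale.sup M.neg.submartingale).smul_nonneg (hw p)).add ih

lemma doob {ι : Type*} (s : Finset ι) {w : ι → ℝ} (hw : ∀ p, 0 ≤ w p) {X : ι → ℝ → Ω → ℝ} (hX : ∀ p, Martingale (X p) 𝓕 P)
    {φ : ℕ → ℝ} (h : Monotone φ) (n : ℕ) {a E : ℝ} (ha : 0 < a)
    (hE : ∫ ω, ∑ p ∈ s, w p * |X p (φ n) ω - X p (φ 0) ω| ∂P ≤ E) :
    P {ω | ∃ i ≤ n, a ≤ ∑ p ∈ s, w p * |X p (φ i) ω - X p (φ 0) ω|} ≤ ENNReal.ofReal (E / a) := by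
  have S := smp_sub s hw hX h
  have nn : ∀ i ω, 0 ≤ ∑ p ∈ s, w p * |X p (φ i) ω - X p (φ 0) ω| := fun i ω => Finset.sum_nonneg fun p _ => mul_nonneg (hw p) (abs_nonneg _)
  lift a to ℝ≥0 using ha.le
  have := maximal_ineq S nn (ε := a) n
  have e : {ω | (a : ℝ) ≤ (Finset.range (n + 1)).sup' Finset.nonempty_range_add_one fun k => ∑ p ∈ s, w p * |X p (φ k) ω - X p (φ 0) ω|} =
      {ω | ∃ i ≤ n, (a:ℝ) ≤ ∑ p ∈ s, w p * |X p (φ i) ω - X p (φ 0) ω|} := by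
    ext ω; simp [Finset.le_sup'_iff]
  rw [e, ← ENNReal.ofReal_coe_nnreal] at this
  rw [ENNReal.ofReal_div_of_pos ha, ENNReal.le_div_iff_mul_le (Or.inl (ENNReal.ofReal_pos.2 ha).ne') (Or.inl (by simp)), mul_comm]
  exact this.trans (ENNReal.ofReal_le_ofReal ((setIntegral_le_integral (S.integrable n) (ae_of_all _ (nn n))).trans hE))

lemma doob_dy {ι : Type*} (s : Finset ι) {w : ι → ℝ} (hw : ∀ p, 0 ≤ w p) {X : ι → ℝ → Ω → ℝ} (hX : ∀ p, Martingale (X p) 𝓕 P)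
    {τ T a E : ℝ} (hT : τ ≤ T) (ha : 0 < a) (hE : ∫ ω, ∑ p ∈ s, w p * |X p T ω - X p τ ω| ∂P ≤ E) :
    P {ω | ∃ n : ℕ, ∃ i : ℕ, i ≤ 2 ^ n ∧ a ≤ ∑ p ∈ s, w p * |X p (τ + i * ((T - τ) / 2 ^ n)) ω - X p τ ω|} ≤ ENNReal.ofReal (E / a) := by
  have hT0 : 0 ≤ T - τ := by linarith
  rw [Set.ofPred_exists, Monotone.measure_iUnion]
  · refine iSup_le fun n => ?_
    have h : Monotone (fun i : ℕ => τ + i * ((T - τ) / 2 ^ n)) := fun i j hij => by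
      have : (i:ℝ) ≤ j := by exact_mod_cast hij
      dsimp only; gcongr
    have := doob s hw hX h (2 ^ n) ha (E := E) (by
      have e : τ + ((2 ^ n : ℕ) : ℝ) * ((T - τ) / 2 ^ n) = T := by push_cast; field_simp; ring
      simp only [Nat.cast_zero, zero_mul, add_zero, e]; exact hE)
    simpa using this
  · refine monotone_nat_of_le_succ fun n ω hω => ?_
    obtain ⟨i, hi, h⟩ := hω
    refine ⟨2 * i, by rw [pow_succ]; omega, ?_⟩
    have e : ((2 * i : ℕ) : ℝ) * ((T - τ) / 2 ^ (n + 1)) = i * ((T - τ) / 2 ^ n) := by push_cast; rw [pow_succ]; field_simp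
    rw [e]; exact h
end

lemma dyad {τ T t : ℝ} (ht : t ∈ Icc τ T) : ∃ u : ℕ → ℝ, (∀ n, (∃ i : ℕ, i ≤ 2 ^ n ∧ u n = τ + i * ((T - τ) / 2 ^ n)) ∧ u n ∈ Icc t T) ∧
    Tendsto u atTop (nhdsWithin t (Ici t)) := by
  obtain ⟨x, x0, x1, hx⟩ : ∃ x : ℝ, 0 ≤ x ∧ x ≤ 1 ∧ t = τ + x * (T - τ) := by
    rcases (ht.1.trans ht.2).eq_or_lt with e | h
    · exact ⟨0, le_rfl, zero_le_one, by have := ht.1; have := ht.2; linarith⟩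
    · have p : 0 < T - τ := by linarith
      exact ⟨(t - τ) / (T - τ), div_nonneg (by linarith [ht.1]) p.le, (div_le_one p).2 (by linarith [ht.2]), by field_simp; ring⟩
  have h0 : 0 ≤ T - τ := by linarith [ht.1, ht.2]
  have c : ∀ n : ℕ, x * 2 ^ n ≤ ⌈x * 2 ^ n⌉₊ ∧ (⌈x * 2 ^ n⌉₊ : ℝ) < x * 2 ^ n + 1 ∧ ⌈x * 2 ^ n⌉₊ ≤ 2 ^ n := fun n => by
    refine ⟨Nat.le_ceil _, Nat.ceil_lt_add_one (by positivity), Nat.ceil_le.2 ?_⟩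
    push_cast; exact mul_le_of_le_one_left (by positivity) x1
  set u : ℕ → ℝ := fun n => τ + (⌈x * 2 ^ n⌉₊ : ℝ) * ((T - τ) / 2 ^ n) with hu
  have lo : ∀ n, t ≤ u n := fun n => by
    have := mlr (c n).1 (by positivity : 0 ≤ (T - τ) / 2 ^ n)
    have e : x * 2 ^ n * ((T - τ) / 2 ^ n) = x * (T - τ) := by field_simp
    simp only [hu]; linarith
  have hi : ∀ n, u n ≤ t + (T - τ) * (1 / 2) ^ n := fun n => by
    have := mlr (c n).2.1.le (by positivity : 0 ≤ (T - τ) / 2 ^ n)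
    have e : (x * 2 ^ n + 1) * ((T - τ) / 2 ^ n) = x * (T - τ) + (T - τ) * (1 / 2) ^ n := by rw [div_pow, one_pow]; field_simp
    simp only [hu]; linarith
  refine ⟨u, fun n => ⟨⟨_, (c n).2.2, rfl⟩, lo n, ?_⟩, tendsto_nhdsWithin_iff.2 ⟨?_, Eventually.of_forall lo⟩⟩
  · have : (⌈x * 2 ^ n⌉₊ : ℝ) ≤ 2 ^ n := by exact_mod_cast (c n).2.2
    have := mlr this (by positivity : 0 ≤ (T - τ) / 2 ^ n)
    have e : (2 ^ n : ℝ) * ((T - τ) / 2 ^ n) = T - τ := by field_simp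
    simp only [hu]; linarith
  · refine tendsto_of_tendsto_of_tendsto_of_le_of_le tendsto_const_nhds ?_ lo hi
    have := (tendsto_pow_atTop_nhds_zero_of_lt_one (by norm_num : (0:ℝ) ≤ 1 / 2) (by norm_num)).const_mul (T - τ)
    simpa using this.const_add t

section
variable {B : Vd d → Mv d} (hB : IsCollisionKernel B) (hd : 0 < d)
  {Ω : Type*} [m : MeasurableSpace Ω] {N : ℕ} {P : Measure Ω} [IsProbabilityMeasure P] {𝓕 : Filtration ℝ m}
  {μp : ℝ → Ω → Mv d} (hK : IsKacProcess B N P 𝓕 μp)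
include hB hd hK

omit [IsProbabilityMeasure P] in
lemma M_rc (hf : Gr k C f) (hc : Continuous f) {τ t : ℝ} (h : τ ≤ t) (ω : Ω) :
    ContinuousWithinAt (fun s => Mg B (fun r => μp r ω) τ f s) (Ici t) t := by
  have c1 := K_rc hK ω hc t
  have c2 : Continuous fun s => ∫ r in τ..s, QInt B f (μp r ω) (μp r ω) :=
    intervalIntegral.continuous_primitive (fun a b => ⟨K_Qi hB hd hK hf _ _ ω, K_Qi hB hd hK hf _ _ ω⟩) τ
  have e : ∀ s, τ ≤ s → Mg B (fun r => μp r ω) τ f s = (∫ v, f v ∂(μp s ω)) - (∫ v, f v ∂(μp τ ω)) - ∫ r in τ..s, QInt B f (μp r ω) (μp r ω) :=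
    fun s hs => by rw [intervalIntegral.integral_of_le hs]; rfl
  exact ((c1.sub (continuousWithinAt_const (b := ∫ v, f v ∂(μp τ ω)))).sub c2.continuousWithinAt).congr (fun s hs => e s (h.trans hs)) (e t h)

omit [IsProbabilityMeasure P] in
lemma M_ext (hf : Gr k C f) (hc : Continuous f) {τ T a : ℝ} (ω : Ω)
    (h : ∀ n i : ℕ, i ≤ 2 ^ n → |Mg B (fun r => μp r ω) τ f (τ + i * ((T - τ) / 2 ^ n))| ≤ a) {t : ℝ} (ht : t ∈ Icc τ T) :
    |Mg B (fun r => μp r ω) τ f t| ≤ a := by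
  obtain ⟨u, h1, h2⟩ := dyad ht
  refine le_of_tendsto ((M_rc hB hd hK hf hc ht.1 ω).tendsto.comp h2).abs (Eventually.of_forall fun n => ?_)
  obtain ⟨⟨i, hi, e⟩, _⟩ := h1 n
  simp only [Function.comp, e]
  exact h n i hi
end

lemma pw_gr (n : ℕ) : Gr n 1 (fun v : Vd d => pw v ^ n) :=
  ⟨pw_meas.pow_const n, fun v => by rw [one_mul, abs_of_nonneg (by have := pw_pos v; positivity)]⟩

lemma int_pw_nonneg (μ : Mv d) (n : ℕ) : 0 ≤ ∫ v, pw v ^ n ∂μ := integral_nonneg fun v => pow_nonneg (pw_pos v).le _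

/-- moment control variable -/
def VV {Ω : Type*} (μp : ℝ → Ω → Mv d) (n : ℕ) (τ T : ℝ) (ω : Ω) : ℝ :=
  (∫ v, pw v ^ n ∂(μp τ ω)) + 4 * ∫ s in Ioc τ T, ∫ v, pw v ^ n ∂(μp s ω)

section
variable {B : Vd d → Mv d} (hB : IsCollisionKernel B) (hd : 0 < d)
  {Ω : Type*} [m : MeasurableSpace Ω] {N : ℕ} {P : Measure Ω} [IsProbabilityMeasure P] {𝓕 : Filtration ℝ m}
  {μp : ℝ → Ω → Mv d} (hK : IsKacProcess B N P 𝓕 μp)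
include hB hd hK

omit [IsProbabilityMeasure P] in
lemma V_bd {n : ℕ} (hn : 18 ≤ n) {τ T t : ℝ} (ht : t ∈ Icc τ T) (ω : Ω) :
    |(∫ v, pw v ^ 8 ∂(μp t ω)) - Mg B (fun s => μp s ω) τ (fun v => pw v ^ 8) t| ≤ VV μp n τ T ω := by
  have am : ∀ s k l, k ≤ l → ∫ v, pw v ^ k ∂(μp s ω) ≤ ∫ v, pw v ^ l ∂(μp s ω) := fun s k l h => by
    have x : Adm (μp s ω) l (∫ v, pw v ^ l ∂(μp s ω)) := ⟨K_prob hK s ω, (emp_adm (hK.mem s ω) l).2.1, le_rfl⟩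
    exact (x.mono h le_rfl).2.2
  have q : ∀ s, |QInt B (fun v => pw v ^ 8) (μp s ω) (μp s ω)| ≤ 4 * ∫ v, pw v ^ n ∂(μp s ω) := fun s => by
    have a9 : Adm (μp s ω) 9 (∫ v, pw v ^ 9 ∂(μp s ω)) := ⟨K_prob hK s ω, (emp_adm (hK.mem s ω) 9).2.1, le_rfl⟩
    have h1 := QInt_bound hB hd (pw_gr 8) a9 a9
    have h2 := int_sq_le (n := 9) (emp_adm (hK.mem s ω) (2 * 9))
    have h3 := am s (2 * 9) n hn
    nlinarith
  have ii : ∀ b, IntegrableOn (fun s => ∫ v, pw v ^ n ∂(μp s ω)) (Ioc τ b) := fun b =>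
    Measure.integrableOn_of_bounded (M := 1 * (1 + √N) ^ n) (by simp)
      ((K_fm hK (pw_gr n).1).comp (g := fun z : ℝ × Ω => ∫ v, pw v ^ n ∂(μp z.1 z.2)) (f := fun s => (s, ω)) (by fun_prop)).aestronglyMeasurable
      (ae_of_all _ fun s => K_fb hK (pw_gr n) s ω)
  have h1 : |∫ s in Ioc τ t, QInt B (fun v => pw v ^ 8) (μp s ω) (μp s ω)| ≤ 4 * ∫ s in Ioc τ T, ∫ v, pw v ^ n ∂(μp s ω) := by
    have := norm_integral_le_of_norm_le (f := fun s => QInt B (fun v => pw v ^ 8) (μp s ω) (μp s ω)) ((ii t).const_mul 4) (ae_of_all _ q)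
    rw [integral_const_mul] at this
    refine this.trans (mll ?_ (by norm_num))
    exact setIntegral_mono_set (ii T) (ae_of_all _ fun s => int_pw_nonneg _ n) (Set.Ioc_subset_Ioc_right ht.2).eventuallyLE
  have h2 := am τ 8 n (by omega)
  have h3 := int_pw_nonneg (μp τ ω) 8
  unfold Mg VV
  rw [abs_le] at h1 ⊢
  constructor <;> linarith [h1.1, h1.2]

omit hB hd in
lemma V_E (n : ℕ) {A τ T : ℝ} (h : τ ≤ T) (hA : ∀ t ∈ Icc τ T, ∫ ω, (∫ v, pw v ^ n ∂(μp t ω)) ∂P ≤ A) :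
    Integrable (VV μp n τ T) P ∧ ∫ ω, VV μp n τ T ω ∂P ≤ A + 4 * ((T - τ) * A) := by
  obtain ⟨i1, i2, e⟩ := swapL (P := P) (h := fun z => ∫ v, pw v ^ n ∂(μp z.1 z.2)) (K_fm hK (pw_gr n).1) (a := τ) (b := T)
    (fun s _ ω => K_fb hK (pw_gr n) s ω)
  have i0 := K_fi hK (pw_gr n) τ
  refine ⟨i0.add (i1.const_mul 4), ?_⟩
  unfold VV
  rw [integral_add i0 (i1.const_mul 4), integral_const_mul, e]
  have := setIntegral_mono_on i2 (integrable_const A) measurableSet_Ioc fun s hs => hA s ⟨hs.1.le, hs.2⟩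
  simp only [integral_const, smul_eq_mul, measureReal_restrict_apply_univ, Real.volume_real_Ioc_of_le h] at this
  linarith [hA τ ⟨le_rfl, h⟩]

omit [IsProbabilityMeasure P] in
lemma good {κ : ℝ} (hL : IsLipschitzKernel B κ) {n : ℕ} (hn : 18 ≤ n) {τ T a δ : ℝ} (h0 : 0 ≤ τ) (hT : τ ≤ T) (K : ℕ) (ω : Ω) {b : ℝ → Mv d}
    (hb0 : b τ = μp τ ω) (hb : IsBoltzmannSolutionFrom B τ b) (hδ : (2 ^ K : ℝ)⁻¹ ≤ δ) (hV : VV μp n τ T ω ≤ a)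
    (h1 : ∀ n i : ℕ, i ≤ 2 ^ n → |Xf B μp (fun v => pw v ^ 8) (τ + i * ((T - τ) / 2 ^ n)) ω - Xf B μp (fun v => pw v ^ 8) τ ω| ≤ a)
    (h2 : ∀ n i : ℕ, i ≤ 2 ^ n → SS B μp N K τ (τ + i * ((T - τ) / 2 ^ n)) ω ≤ a * δ) {t : ℝ} (ht : t ∈ Icc τ T) :
    Wdist (μp t ω) (b t) ≤ 2 * (exp (80 * κ * (2 * a + 32 * (1 + 2 * a * exp (48 * (T - τ)))) * (T - τ)) * (T - τ) *
      (24 * κ * (2 * a + 32 * (1 + 2 * a * exp (48 * (T - τ))))) + 1) *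
      (((1 + d) ^ 4 * (2 * a + (2 * (2 * a) + 4 * (T - τ) * (2 * a) ^ 2))) * δ) := by
  have T0 : 0 ≤ T - τ := by linarith
  have dy : ∀ n i : ℕ, i ≤ 2 ^ n → τ + i * ((T - τ) / 2 ^ n) ∈ Icc τ T := fun n i hi => by
    have : (i:ℝ) ≤ 2 ^ n := by exact_mod_cast hi
    have := mlr this (by positivity : 0 ≤ (T - τ) / 2 ^ n)
    have e : (2 ^ n : ℝ) * ((T - τ) / 2 ^ n) = T - τ := by field_simp
    exact ⟨by have : 0 ≤ (i:ℝ) * ((T - τ) / 2 ^ n) := by positivity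
              linarith, by linarith⟩
  have ad : ∀ s ∈ Icc τ T, Adm (μp s ω) 8 (2 * a) := fun s hs => by
    refine ⟨K_prob hK s ω, (emp_adm (hK.mem s ω) 8).2.1, ?_⟩
    have x1 := M_ext hB hd hK (pw_gr 8) (by have := @pw_cont d; fun_prop) (τ := τ) (T := T) (a := a) ω (fun n i hi => by
      rw [Mg_X hB hd hK (pw_gr 8) h0 (dy n i hi).1]; exact h1 n i hi) hs
    have x2 := V_bd hB hd hK hn hs ω
    rw [abs_le] at x1 x2
    linarith [x1.2, x2.2]
  have a1 := (ad τ ⟨le_rfl, hT⟩).one_le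
  have a0 : 0 < a := by linarith
  have δ0 : 0 < δ := lt_of_lt_of_le (by positivity) hδ
  have hS := sol_of hB hd hb
  have cτ : (fun t => b (max t τ)) τ = μp τ ω := by simp [hb0]
  have ca : ∀ s ∈ Icc τ T, Adm ((fun t => b (max t τ)) s) 6 (32 * (1 + 2 * a * exp (48 * (T - τ)))) := fun s hs =>
    hS.adm hB hd (by rw [max_self, hb0]; exact (ad τ ⟨le_rfl, hT⟩).mono (by norm_num) le_rfl) hs
  have hp : Pair (fun s => μp s ω) (fun t => b (max t τ)) τ T (2 * a + 32 * (1 + 2 * a * exp (48 * (T - τ)))) :=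
    { ma := (K_joint hK).comp (g := fun z : ℝ × Ω => μp z.1 z.2) (f := fun s => (s, ω)) (by fun_prop)
      mc := hS.meas
      pa := fun s => K_prob hK s ω
      pc := fun s => (hS.mem s).1
      aR := fun s hs => (ad s hs).mono (by norm_num) (by have := Real.exp_pos (48 * (T - τ)); nlinarith [mul_pos a0 this])
      cR := fun s hs => (ca s hs).mono le_rfl (by linarith) }
  have := pathwise hB hd hL hp cτ.symm (fun g C hg s hs => hS.ext hB hd ca hg hs) (δ := ((1 + d) ^ 4 * (2 * a + (2 * (2 * a) + 4 * (T - τ) * (2 * a) ^ 2))) * δ) (fun g C hg s hs => by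
    have hc : Continuous g := cont_of_lip (K := fun v w => C * (pw v ^ 3 * pw w ^ 3)) (fun v => by have := @pw_cont d; fun_prop)
      fun v w => (hg.2 v w).trans_eq (by ring)
    refine M_ext hB hd hK hg.gr hc ω (fun n i hi => ?_) hs
    have C0 := hg.nonneg
    have D := dy n i hi
    refine (dec hB hd hK hg K h0 D.1 ω fun s hs => ad s ⟨hs.1, hs.2.trans D.2⟩).trans ?_
    have e1 := h2 n i hi
    generalize τ + i * ((T - τ) / 2 ^ n) = u at D e1
    rw [div_eq_mul_inv]
    have e2 : 2 * (2 * a) + 4 * (u - τ) * (2 * a) ^ 2 ≤ 2 * (2 * a) + 4 * (T - τ) * (2 * a) ^ 2 := by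
      have := D.2; gcongr
    have e4 : 0 ≤ u - τ := by linarith [D.1]
    have e3 : 0 ≤ 2 * (2 * a) + 4 * (u - τ) * (2 * a) ^ 2 := by positivity
    calc _ ≤ C * (2 * (1 + d) ^ 4) * (a * δ) + C * (1 + d) ^ 4 * δ * (2 * (2 * a) + 4 * (T - τ) * (2 * a) ^ 2) := by gcongr
      _ = _ := by ring) ht
  simpa only [max_eq_left ht.1] using this
end

lemma core {B : Vd d → Mv d} (hB : IsCollisionKernel B) (hd : 0 < d) {κ : ℝ} (hL : IsLipschitzKernel B κ) {ε τ T : ℝ}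
    (hε : 0 < ε) (hε1 : ε ≤ 1) (hτ : 0 < τ) (hT : τ ≤ T) : ∃ C : ℝ, 0 ≤ C ∧
    ∀ (Ω : Type) (m : MeasurableSpace Ω) (P : Measure Ω), IsProbabilityMeasure P →
      ∀ (𝓕 : Filtration ℝ m) (N : ℕ) (μp : ℝ → Ω → Mv d), IsKacProcess B N P 𝓕 μp →
      ∀ μsol : Ω → ℝ → Mv d, (∀ ω, μsol ω τ = μp τ ω) → (∀ ω, IsBoltzmannSolutionFrom B τ (μsol ω)) →
      ∀ (K : ℕ) (δ : ℝ), (2 ^ K : ℝ)⁻¹ ≤ δ → ∑ k ∈ Finset.range (K + 1), (2 ^ k)⁻¹ * √(2 ^ (k * d)) / √N ≤ δ →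
        ENNReal.ofReal (1 - ε) < P {ω | ∀ t ∈ Icc τ T, Wdist (μp t ω) (μsol ω t) ≤ C * δ} := by
  obtain ⟨A, A0, hA⟩ := mom_prod hB hd (2 * (12 + 2 * d + 1)) (τ := τ) (T := T) hτ
  have T0 : 0 ≤ T - τ := by linarith
  set n := 2 * (12 + 2 * d + 1) with hn
  set E1 := A + (A + 4 * ((T - τ) * A)) with hE1
  set E2 := 8 ^ d + (T - τ) * (16 * (1 + d) ^ (12 + 2 * d) * A) with hE2
  have E10 : 0 ≤ E1 := by positivity
  have E20 : 0 ≤ E2 := by positivity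
  set a := (E1 + E2 + 1) * (6 / ε) with ha
  have a0 : 0 < a := by positivity
  have aE : ∀ x, x ≤ E1 + E2 + 1 → x / a ≤ ε / 6 := fun x hx => by
    rw [div_le_iff₀ a0, ha]
    have : ε / 6 * ((E1 + E2 + 1) * (6 / ε)) = E1 + E2 + 1 := by field_simp
    linarith
  have κ0 : 0 ≤ κ := by linarith [hL.1]
  refine ⟨2 * (exp (80 * κ * (2 * a + 32 * (1 + 2 * a * exp (48 * (T - τ)))) * (T - τ)) * (T - τ) *
      (24 * κ * (2 * a + 32 * (1 + 2 * a * exp (48 * (T - τ))))) + 1) *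
      ((1 + d) ^ 4 * (2 * a + (2 * (2 * a) + 4 * (T - τ) * (2 * a) ^ 2))), by positivity, ?_⟩
  intro Ω m P hP 𝓕 N μp hK μsol hs0 hs K δ hδ hS
  have δ0 : 0 < δ := lt_of_lt_of_le (by positivity) hδ
  have hA := hA Ω N P 𝓕 μp hK
  have N0 : 0 < N := by
    obtain ⟨ω⟩ : Nonempty Ω := nonempty_of_isProbabilityMeasure P
    exact (emp_rep (hK.mem τ ω)).1
  obtain ⟨Vi, VE⟩ := V_E hK n hT hA
  have Vn : ∀ ω, 0 ≤ VV μp n τ T ω := fun ω => add_nonneg (int_pw_nonneg _ n) (mul_nonneg (by norm_num)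
    (integral_nonneg fun s => int_pw_nonneg _ n))
  set S1 := {ω | ∃ n : ℕ, ∃ i : ℕ, i ≤ 2 ^ n ∧ a ≤ ∑ p ∈ ({()} : Finset Unit), 1 * |Xf B μp (fun v => pw v ^ 8) (τ + i * ((T - τ) / 2 ^ n)) ω - Xf B μp (fun v => pw v ^ 8) τ ω|} with hS1
  set S2 := {ω | ∃ n : ℕ, ∃ i : ℕ, i ≤ 2 ^ n ∧ a * δ ≤ SS B μp N K τ (τ + i * ((T - τ) / 2 ^ n)) ω} with hS2
  set S3 := {ω | a ≤ VV μp n τ T ω} with hS3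
  have p1 : P S1 ≤ ENNReal.ofReal (ε / 6) := by
    refine (doob_dy ({()} : Finset Unit) (w := fun _ => 1) (fun _ => zero_le_one) (X := fun _ => Xf B μp (fun v => pw v ^ 8)) (fun _ => X_mart hB hd hK (pw_gr 8)) hT a0 (E := E1) ?_).trans
      (ENNReal.ofReal_le_ofReal (aE _ (by linarith)))
    simp only [Finset.sum_singleton, one_mul]
    have i0 := K_fi hK (pw_gr n) T
    have := integral_mono (X_di hB hd hK (pw_gr 8) τ T).abs (i0.add Vi) fun ω => by
      show |_| ≤ (∫ v, pw v ^ n ∂(μp T ω)) + VV μp n τ T ω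
      rw [← Mg_X hB hd hK (pw_gr 8) hτ.le hT]
      have b1 := V_bd hB hd hK (n := n) (by omega) (t := T) ⟨hT, le_rfl⟩ ω
      have x : Adm (μp T ω) n (∫ v, pw v ^ n ∂(μp T ω)) := ⟨K_prob hK T ω, (emp_adm (hK.mem T ω) n).2.1, le_rfl⟩
      have b2 := (x.mono (l := 8) (by omega) le_rfl).2.2
      have b3 := int_pw_nonneg (μp T ω) 8
      rw [abs_le] at b1 ⊢
      constructor <;> linarith [b1.1, b1.2]
    refine this.trans ?_
    have e := integral_add i0 Vi
    simp only [Pi.add_apply]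
    linarith [hA T ⟨hT, le_rfl⟩]
  have p2 : P S2 ≤ ENNReal.ofReal (ε / 6) := by
    refine (doob_dy (sg d N K) (w := fun p => (2 ^ p.1)⁻¹ * pw (pt p.1 p.2) ^ 6) (fun p => by have := pw_pos (pt p.1 p.2); positivity)
      (X := fun p => Xf B μp (ce p.1 p.2)) (fun p => X_mart hB hd hK (ce_gr _ _)) hT (mul_pos a0 δ0) (E := E2 * δ) ?_).trans
      (ENNReal.ofReal_le_ofReal ?_)
    · exact (E_SS hB hd hK N0 K hτ.le hT hA).trans (mll hS E20)
    · rw [mul_div_mul_right _ _ δ0.ne']; exact aE _ (by linarith)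
  have p3 : P S3 ≤ ENNReal.ofReal (ε / 6) := by
    have := mul_meas_ge_le_integral_of_nonneg (ae_of_all _ Vn) Vi a
    rw [← ENNReal.ofReal_toReal (measure_ne_top P S3)]
    refine ENNReal.ofReal_le_ofReal (le_trans ?_ (aE E1 (by linarith)))
    rw [le_div_iff₀ a0, mul_comm]
    have t : a * (P S3).toReal ≤ ∫ ω, VV μp n τ T ω ∂P := this
    linarith
  set G := {ω | ∀ t ∈ Icc τ T, Wdist (μp t ω) (μsol ω t) ≤ _ * δ} with hG
  have cov : (Set.univ : Set Ω) ⊆ G ∪ (S1 ∪ (S2 ∪ S3)) := fun ω _ => by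
    by_contra hω
    simp only [Set.mem_union, not_or] at hω
    obtain ⟨g, g1, g2, g3⟩ := hω
    refine g fun t ht => ?_
    rw [mul_assoc]
    refine good hB hd hK hL (n := n) (by omega) hτ.le hT K ω (hs0 ω) (hs ω) hδ ?_ (fun n i hi => ?_) (fun n i hi => ?_) ht
    · by_contra h; exact g3 (not_le.1 h).le
    · by_contra h; exact g1 ⟨n, i, hi, by simpa using (not_le.1 h).le⟩
    · by_contra h; exact g2 ⟨n, i, hi, (not_le.1 h).le⟩
  have q : 1 ≤ P G + ENNReal.ofReal (ε / 2) := by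
    calc 1 = P Set.univ := measure_univ.symm
      _ ≤ P G + (P S1 + (P S2 + P S3)) := (measure_mono cov).trans ((measure_union_le _ _).trans (add_le_add le_rfl
          ((measure_union_le _ _).trans (add_le_add le_rfl (measure_union_le _ _)))))
      _ ≤ P G + (ENNReal.ofReal (ε / 6) + (ENNReal.ofReal (ε / 6) + ENNReal.ofReal (ε / 6))) := by gcongr
      _ = _ := by
        rw [← ENNReal.ofReal_add (by positivity) (by positivity), ← ENNReal.ofReal_add (by positivity) (by positivity)]
        congr 2; ring
  by_contra hc
  have := q.trans (add_le_add (not_lt.1 hc) le_rfl)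
  rw [← ENNReal.ofReal_add (by linarith) (by linarith), ENNReal.one_le_ofReal] at this
  linarith

/-- norm of the single-particle case -/
lemma N_two {N : ℕ} {μ : Mv d} (h : μ ∈ empiricalSphere d N) : 2 ≤ N := by
  have N0 := (emp_rep h).1
  by_contra hN
  obtain rfl : N = 1 := by omega
  obtain ⟨⟨_, h1, h2⟩, x, hx⟩ := h
  have : μ = Measure.dirac (x 0) := by rw [hx]; simp
  rw [this] at h1 h2
  simp only [integral_dirac] at h1 h2
  rw [h1] at h2; simp at h2

lemma scale {d N : ℕ} (hd : 0 < d) (N0 : 0 < N) : ∃ K : ℕ, (2:ℝ) ^ (K * d) ≤ N ∧ (2 ^ K : ℝ)⁻¹ ≤ 2 * (N:ℝ) ^ (-(1:ℝ)/d) := by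
  have h1 : 1 < 2 ^ d := Nat.one_lt_two_pow hd.ne'
  refine ⟨Nat.log (2 ^ d) N, ?_, ?_⟩
  · have := Nat.pow_log_le_self (2 ^ d) N0.ne'
    rw [← pow_mul, mul_comm] at this
    exact_mod_cast this
  · have h2 := Nat.lt_pow_succ_log_self h1 N
    rw [← pow_mul, mul_comm] at h2
    set K := Nat.log (2 ^ d) N
    have np : (0:ℝ) < N := by exact_mod_cast N0
    set y := (N:ℝ) ^ ((1:ℝ)/d) with hy
    have y0 : 0 < y := Real.rpow_pos_of_pos np _
    have yd : y ^ d = N := by rw [hy, one_div]; exact Real.rpow_inv_natCast_pow np.le hd.ne'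
    have e : (N:ℝ) ^ (-(1:ℝ)/d) = y⁻¹ := by rw [neg_div, Real.rpow_neg np.le]
    have h3 : y < 2 ^ (K + 1) := by
      refine lt_of_pow_lt_pow_left₀ d (by positivity) ?_
      rw [yd, ← pow_mul]; exact_mod_cast h2
    rw [e, pow_succ] at *
    rw [← div_eq_mul_inv, inv_eq_one_div, div_le_div_iff₀ (by positivity) y0]
    linarith

lemma sum3 {d : ℕ} (hd : 3 ≤ d) (K : ℕ) : ∑ k ∈ Finset.range (K + 1), ((2:ℝ) ^ k)⁻¹ * √(2 ^ (k * d)) ≤ 4 * ((2 ^ K)⁻¹ * √(2 ^ (K * d))) := by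
  induction K with
  | zero => simp
  | succ K ih =>
    rw [Finset.sum_range_succ]
    have e : √((2:ℝ) ^ ((K + 1) * d)) = √(2 ^ (K * d)) * √(2 ^ d) := by
      rw [← Real.sqrt_mul (by positivity), ← pow_add]; congr 2; ring
    have h8 : 8 / 3 ≤ √((2:ℝ) ^ d) := by
      apply Real.le_sqrt_of_sq_le
      have := pow_le_pow_right₀ (by norm_num : (1:ℝ) ≤ 2) hd
      linarith
    have e2 : ((2:ℝ) ^ (K + 1))⁻¹ = (2 ^ K)⁻¹ * (1 / 2) := by rw [pow_succ, mul_inv]; norm_num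
    rw [e, e2]
    have p : 0 ≤ ((2:ℝ) ^ K)⁻¹ * √(2 ^ (K * d)) := by positivity
    nlinarith [mll h8 p]

end KacModel

/-- Corollary 10.3 (accuracy of the Boltzmann equation as an approximation to the
Kac process, restarted at a positive time). -/
theorem boltzmann_approximates_kac
    (d : ℕ) (hd : 2 ≤ d) (B : Vd d → Measure (Vd d)) (κ : ℝ)
    (hB : IsCollisionKernel B) (hBL : IsLipschitzKernel B κ)
    (ε : ℝ) (hε0 : 0 < ε) (hε1 : ε ≤ 1)
    (τ T : ℝ) (hτ : 0 < τ) (hτT : τ ≤ T) :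
    (3 ≤ d → ∃ C : ℝ, 0 ≤ C ∧
      ∀ (Ω : Type) (m : MeasurableSpace Ω) (P : Measure Ω),
        IsProbabilityMeasure P →
      ∀ (𝓕 : MeasureTheory.Filtration ℝ m) (N : ℕ) (μp : ℝ → Ω → Measure (Vd d)),
        IsKacProcess B N P 𝓕 μp →
      ∀ μsol : Ω → ℝ → Measure (Vd d),
        (∀ ω, μsol ω τ = μp τ ω) →
        (∀ ω, IsBoltzmannSolutionFrom B τ (μsol ω)) →
        (∀ ω, ∃ p : ℝ, 2 < p ∧ LocBddMomentFrom p τ (μsol ω)) →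
        ENNReal.ofReal (1 - ε) <
          P {ω | ∀ t ∈ Set.Icc τ T,
            Wdist (μp t ω) (μsol ω t) ≤ C * (N : ℝ) ^ (-(1:ℝ)/d)}) ∧
    (d = 2 → ∃ C : ℝ, 0 ≤ C ∧
      ∀ (Ω : Type) (m : MeasurableSpace Ω) (P : Measure Ω),
        IsProbabilityMeasure P →
      ∀ (𝓕 : MeasureTheory.Filtration ℝ m) (N : ℕ) (μp : ℝ → Ω → Measure (Vd d)),
        IsKacProcess B N P 𝓕 μp →
      ∀ μsol : Ω → ℝ → Measure (Vd d),
        (∀ ω, μsol ω τ = μp τ ω) →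
        (∀ ω, IsBoltzmannSolutionFrom B τ (μsol ω)) →
        (∀ ω, ∃ p : ℝ, 2 < p ∧ LocBddMomentFrom p τ (μsol ω)) →
        ENNReal.ofReal (1 - ε) <
          P {ω | ∀ t ∈ Set.Icc τ T,
            Wdist (μp t ω) (μsol ω t) ≤
              C * ((N : ℝ) ^ (-(1:ℝ)/2) * Real.log N)}) := by
  have d0 : 0 < d := by omega
  obtain ⟨C, C0, hC⟩ := core hB d0 hBL hε0 hε1 hτ hτT
  constructor
  · intro h3
    refine ⟨C * 8, by positivity, fun Ω m P hP 𝓕 N μp hK μsol hs0 hs _ => ?_⟩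
    have N2 : 2 ≤ N := by
      obtain ⟨ω⟩ : Nonempty Ω := nonempty_of_isProbabilityMeasure P
      exact N_two (hK.mem τ ω)
    have np : (0:ℝ) < N := by positivity
    obtain ⟨K, k1, k2⟩ := scale d0 (by omega : 0 < N)
    have x0 := Real.rpow_pos_of_pos np (-(1:ℝ)/d)
    have := hC Ω m P hP 𝓕 N μp hK μsol hs0 hs K (8 * (N : ℝ) ^ (-(1:ℝ)/d)) (by linarith) (by
      rw [← Finset.sum_div, div_le_iff₀ (by positivity)]
      refine (sum3 h3 K).trans ?_
      have := Real.sqrt_le_sqrt k1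
      calc 4 * ((2 ^ K : ℝ)⁻¹ * √(2 ^ (K * d))) ≤ 4 * ((2 * (N:ℝ) ^ (-(1:ℝ)/d)) * √N) := by gcongr
        _ = _ := by ring)
    simpa only [mul_assoc] using this
  · rintro rfl
    refine ⟨C * 4, by positivity, fun Ω m P hP 𝓕 N μp hK μsol hs0 hs _ => ?_⟩
    have N2 : 2 ≤ N := by
      obtain ⟨ω⟩ : Nonempty Ω := nonempty_of_isProbabilityMeasure P
      exact N_two (hK.mem τ ω)
    have np : (0:ℝ) < N := by positivity
    obtain ⟨K, k1, k2⟩ := scale d0 (by omega : 0 < N)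
    rw [show -(1:ℝ)/(2:ℕ) = -(1:ℝ)/2 by norm_num] at k2
    have x0 := Real.rpow_pos_of_pos np (-(1:ℝ)/2)
    have e : (N:ℝ) ^ (-(1:ℝ)/2) = (√N)⁻¹ := by rw [neg_div, Real.rpow_neg np.le, Real.sqrt_eq_rpow]
    have l2 : 1 / 2 ≤ Real.log N := by
      have := Real.log_le_log (by norm_num) (by exact_mod_cast N2 : (2:ℝ) ≤ N)
      linarith [Real.log_two_gt_d9]
    have lK : (K:ℝ) ≤ Real.log N := by
      have := Real.log_le_log (by positivity) k1
      rw [Real.log_pow] at this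
      push_cast at this
      nlinarith [Real.log_two_gt_d9, (Nat.cast_nonneg K : (0:ℝ) ≤ K)]
    have := hC Ω m P hP 𝓕 N μp hK μsol hs0 hs K (4 * ((N : ℝ) ^ (-(1:ℝ)/2) * Real.log N)) (by nlinarith) (by
      have t : ∀ k : ℕ, ((2:ℝ) ^ k)⁻¹ * √(2 ^ (k * 2)) = 1 := fun k => by
        rw [pow_mul, Real.sqrt_sq (by positivity), inv_mul_cancel₀ (by positivity)]
      simp only [t, Finset.sum_const, Finset.card_range, nsmul_eq_mul]
      rw [e, one_div]
      have : 0 < (√(N:ℝ))⁻¹ := by positivity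
      push_cast
      nlinarith)
    simpa only [mul_assoc] using this
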